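/- Every finite Frobenius group that is insoluble and has perfect order classes is a perfect group (equal to its own derived subgroup). -/

import Mathlib

/-- The number of elements of order `n` in the group `G`. -/
noncomputable def orderCount (G : Type*) [Group G] (n : ℕ) : ℕ :=
  Nat.card {g : G // orderOf g = n}

/-- A group has *perfect order classes* if, for every positive integer `n`, the number of
elements of order `n` is either zero or a divisor of the order of the group. -/
def PerfectOrderClasses (G : Type*) [Group G] : Prop :=
  ∀ n : ℕ, 0 < n → orderCount G n = 0 ∨ orderCount G n ∣ Nat.card G

/-- `G` is a Frobenius group with Frobenius kernel `K` and Frobenius complement `H`: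
`K` is a nontrivial proper normal subgroup, `H` a subgroup with `K ⊓ H = ⊥` and `KH = G`,
and the conjugation action of `H` on `K` is fixed-point-free. -/
def IsFrobeniusWith {G : Type*} [Group G] (K H : Subgroup G) : Prop :=
  K ≠ ⊥ ∧ K ≠ ⊤ ∧ K.Normal ∧ K ⊓ H = ⊥ ∧
    (∀ g : G, ∃ k ∈ K, ∃ h ∈ H, g = k * h) ∧
    ∀ h ∈ H, h ≠ 1 → ∀ k ∈ K, k ≠ 1 → h * k * h⁻¹ ≠ k

/-! ### Fixed-point-free representations -/

/-- A linear action in which no non-identity element fixes a nonzero vector. -/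
def FixedPointFreeRep {k V H : Type*} [Field k] [AddCommGroup V] [Module k V] [Group H]
    (ρ : H →* Module.End k V) : Prop :=
  ∀ h : H, h ≠ 1 → ∀ v : V, ρ h v = v → v = 0

/-- Commuting endomorphisms over an algebraically closed field share an eigenvector. -/
theorem exists_common_eigenvector {k V : Type*} [Field k] [IsAlgClosed k] [AddCommGroup V]
    [Module k V] [FiniteDimensional k V] [Nontrivial V] {f g : Module.End k V}
    (h : Commute f g) : ∃ (α β : k) (v : V), v ≠ 0 ∧ f v = α • v ∧ g v = β • v := by
  obtain ⟨α, hα⟩ := Module.End.exists_eigenvalue f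
  have hmaps : ∀ v ∈ f.eigenspace α, g v ∈ f.eigenspace α := by
    intro v hv
    rw [Module.End.mem_eigenspace_iff] at hv ⊢
    have h1 : f (g v) = g (f v) := LinearMap.congr_fun h v
    rw [h1, hv, map_smul]
  have : Nontrivial (f.eigenspace α) := (Submodule.nontrivial_iff_ne_bot).2 hα
  obtain ⟨β, hβ⟩ := Module.End.exists_eigenvalue (g.restrict hmaps)
  obtain ⟨v, hv⟩ := hβ.exists_hasEigenvector
  refine ⟨α, β, v, fun h0 => hv.2 (Subtype.ext h0), ?_, ?_⟩
  · exact Module.End.mem_eigenspace_iff.1 v.2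
  · exact congrArg Subtype.val hv.apply_eq_smul

namespace FixedPointFreeRep

variable {k V H : Type*} [Field k] [AddCommGroup V] [Module k V] [Group H]
  {ρ : H →* Module.End k V}

theorem eq_of_apply_eq (hρ : FixedPointFreeRep ρ) {g h : H} {v : V} (hv : v ≠ 0)
    (hgh : ρ g v = ρ h v) : g = h := by
  by_contra hne
  refine hv (hρ (h⁻¹ * g) (fun h1 => hne (inv_mul_eq_one.1 h1).symm) v ?_)
  rw [map_mul, Module.End.mul_apply, hgh, ← Module.End.mul_apply, ← map_mul, inv_mul_cancel,
    map_one, Module.End.one_apply]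

theorem injective [Nontrivial V] (hρ : FixedPointFreeRep ρ) : Function.Injective ρ := by
  intro g h hgh
  obtain ⟨v, hv⟩ := exists_ne (0 : V)
  exact hρ.eq_of_apply_eq hv (by rw [hgh])

theorem pow_apply_of_eigen {g : H} {v : V} {α : k} (h : ρ g v = α • v) (n : ℕ) :
    ρ (g ^ n) v = α ^ n • v := by
  induction n with
  | zero => simp
  | succ n ih => rw [pow_succ, map_mul, Module.End.mul_apply, h, map_smul, ih, smul_smul,
      pow_succ, mul_comm]

theorem isPrimitiveRoot_of_eigen (hρ : FixedPointFreeRep ρ) {g : H} {v : V} (hv : v ≠ 0) {α : k}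
    (h : ρ g v = α • v) : IsPrimitiveRoot α (orderOf g) := by
  rw [IsPrimitiveRoot.iff_def]
  have key : ∀ n : ℕ, α ^ n = 1 ↔ orderOf g ∣ n := by
    intro n
    constructor
    · intro h1
      rw [orderOf_dvd_iff_pow_eq_one]
      refine hρ.eq_of_apply_eq hv ?_
      rw [pow_apply_of_eigen h, h1]
      simp
    · intro h1
      have h2 := pow_apply_of_eigen h n
      rw [orderOf_dvd_iff_pow_eq_one.1 h1] at h2
      simp only [map_one, Module.End.one_apply] at h2
      have h3 : (α ^ n - 1) • v = 0 := by rw [sub_smul, ← h2]; simp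
      rcases smul_eq_zero.1 h3 with h4 | h4
      · exact sub_eq_zero.1 h4
      · exact absurd h4 hv
  exact ⟨(key _).2 dvd_rfl, fun n hn => (key n).1 hn⟩

theorem map_involution (hρ : FixedPointFreeRep ρ) {z : H} (hz : orderOf z = 2) : ρ z = -1 := by
  ext v
  have h1 : z ≠ 1 := by rintro rfl; simp at hz
  have h2 : z * z = 1 := by rw [← pow_two, ← hz, pow_orderOf_eq_one]
  have := hρ z h1 (v + ρ z v) (by
    rw [map_add, ← Module.End.mul_apply, ← map_mul, h2, map_one, Module.End.one_apply, add_comm])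
  simp only [LinearMap.neg_apply, Module.End.one_apply]
  exact eq_neg_of_add_eq_zero_right this

theorem involution_unique [Nontrivial V] (hρ : FixedPointFreeRep ρ) {z y : H} (hz : orderOf z = 2)
    (hy : orderOf y = 2) : y = z :=
  hρ.injective (by rw [hρ.map_involution hz, hρ.map_involution hy])

theorem involution_commute [Nontrivial V] (hρ : FixedPointFreeRep ρ) {z : H} (hz : orderOf z = 2)
    (h : H) :
    Commute z h :=
  hρ.injective (by rw [map_mul, map_mul, hρ.map_involution hz]; simp)

/-- Elements with a common eigenvector and compatible orders lie in one cyclic group. -/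
theorem mem_zpowers_of_eigen [Finite H] (hρ : FixedPointFreeRep ρ) {a b : H} {v : V}
    (hv : v ≠ 0) {α β : k}
    (ha : ρ a v = α • v) (hb : ρ b v = β • v) (hab : b ^ orderOf a = 1) :
    b ∈ Subgroup.zpowers a := by
  have h1 := hρ.isPrimitiveRoot_of_eigen hv ha
  have h2 := hρ.isPrimitiveRoot_of_eigen hv hb
  have : NeZero (orderOf a) := ⟨(orderOf_pos a).ne'⟩
  obtain ⟨i, -, hi⟩ := h1.eq_pow_of_pow_eq_one
    (h2.pow_eq_one_iff_dvd _ |>.2 (orderOf_dvd_iff_pow_eq_one.2 hab))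
  have : b = a ^ i := hρ.eq_of_apply_eq hv (by rw [hb, pow_apply_of_eigen ha, hi])
  rw [this]
  exact Subgroup.npow_mem_zpowers a i

theorem mem_zpowers_of_commute [IsAlgClosed k] [FiniteDimensional k V] [Nontrivial V] [Finite H]
    (hρ : FixedPointFreeRep ρ) {a b : H} (hc : Commute a b)
    (hab : b ^ orderOf a = 1) : b ∈ Subgroup.zpowers a := by
  obtain ⟨α, β, v, hv, h1, h2⟩ := exists_common_eigenvector (hc.map ρ)
  exact hρ.mem_zpowers_of_eigen hv h1 h2 hab

end FixedPointFreeRep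

/-! ### Groups in which commuting elements of compatible orders generate cyclic groups -/

/-- If `a` and `b` commute and `b ^ orderOf a = 1`, then `b` is a power of `a`. -/
def CommutingCyclic (P : Type*) [Group P] : Prop :=
  ∀ a b : P, Commute a b → b ^ orderOf a = 1 → b ∈ Subgroup.zpowers a

theorem CommutingCyclic.subgroup {P : Type*} [Group P] (h : CommutingCyclic P) (M : Subgroup P) :
    CommutingCyclic M := by
  intro a b hab hb
  have h1 : (b : P) ∈ Subgroup.zpowers (a : P) := by
    refine h a b (congrArg Subtype.val hab) ?_
    rw [Subgroup.orderOf_coe, ← Subgroup.coe_pow, hb, Subgroup.coe_one]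
  obtain ⟨i, hi⟩ := Subgroup.mem_zpowers_iff.1 h1
  exact Subgroup.mem_zpowers_iff.2 ⟨i, Subtype.ext (by rw [Subgroup.coe_zpow, hi])⟩

theorem CommutingCyclic.isCyclic_of_commute {P : Type*} [Group P] [Finite P]
    (h : CommutingCyclic P) (hc : ∀ a b : P, Commute a b) : IsCyclic P := by
  let _ : CommGroup P := { (inferInstance : Group P) with mul_comm := hc }
  obtain ⟨g, hg⟩ := Monoid.exists_orderOf_eq_exponent (G := P) Monoid.ExponentExists.of_finite
  exact ⟨g, fun b => h g b (hc g b) (by rw [hg]; exact Monoid.pow_exponent_eq_one b)⟩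

/-- A proper subgroup of a finite `q`-group lies in a normal subgroup of index `q`. -/
theorem IsPGroup.exists_normal_index_eq {P : Type*} [Group P] [Finite P] {q : ℕ} [Fact q.Prime]
    (hP : IsPGroup q P) {L : Subgroup P} (hL : L ≠ ⊤) :
    ∃ M : Subgroup P, M.Normal ∧ M.index = q ∧ L ≤ M := by
  have hq : q.Prime := Fact.out
  obtain ⟨n, hn⟩ := IsPGroup.iff_card.1 hP
  obtain ⟨m, hm⟩ := IsPGroup.iff_card.1 (hP.to_subgroup L)
  have hlt : m < n := by
    have h1 : Nat.card L ≤ Nat.card P := Subgroup.card_le_card_group L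
    have h2 : Nat.card L ≠ Nat.card P := fun h => hL ((Subgroup.card_eq_iff_eq_top L).1 h)
    have h3 : q ^ m < q ^ n := by rw [← hm, ← hn]; omega
    exact (Nat.pow_lt_pow_iff_right hq.one_lt).1 h3
  obtain ⟨M, hM, hLM⟩ := Sylow.exists_subgroup_card_pow_prime_le q (n := m) (m := n - 1)
    (by rw [hn]; exact pow_dvd_pow _ (by omega)) L hm (by omega)
  have hidx : M.index = q := by
    have h1 := M.card_mul_index
    rw [hM, hn] at h1
    have h2 : q ^ n = q ^ (n - 1) * q := by rw [← pow_succ]; congr 1; omega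
    rw [h2] at h1
    exact Nat.eq_of_mul_eq_mul_left (pow_pos hq.pos _) h1
  refine ⟨M, Subgroup.normal_of_index_eq_minFac_card ?_, hidx, hLM⟩
  rw [hidx, hn, hq.pow_minFac (by omega)]

theorem Subgroup.inv_mul_swap_mem_of_index_prime {P : Type*} [Group P] {M : Subgroup P} [M.Normal]
    (hM : M.index.Prime) (g h : P) : (g * h)⁻¹ * (h * g) ∈ M := by
  have : Fact M.index.Prime := ⟨hM⟩
  have : IsCyclic (P ⧸ M) := isCyclic_of_prime_card (p := M.index) rfl
  rw [← QuotientGroup.eq, QuotientGroup.mk_mul, QuotientGroup.mk_mul]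
  exact mul_comm' _ _

theorem mul_pow_of_central {P : Type*} [Group P] {y w t : P} (hwy : w * y = y * w * t)
    (ht : ∀ g, Commute t g) (n : ℕ) : (y * w) ^ n = y ^ n * w ^ n * t ^ (n * (n - 1) / 2) := by
  have h1 : ∀ n : ℕ, w ^ n * y = y * w ^ n * t ^ n := by
    intro n
    induction n with
    | zero => simp
    | succ n ih =>
      calc w ^ (n + 1) * y = w ^ n * (w * y) := by rw [pow_succ, mul_assoc]
        _ = (w ^ n * y) * w * t := by rw [hwy]; simp only [mul_assoc]
        _ = y * w ^ n * (t ^ n * w) * t := by rw [ih]; simp only [mul_assoc]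
        _ = y * w ^ (n + 1) * t ^ (n + 1) := by
          rw [((ht w).pow_left n).eq, pow_succ, pow_succ]; simp only [mul_assoc]
  have h2 : ∀ n : ℕ, (y * w) ^ n = y ^ n * w ^ n * t ^ (∑ i ∈ Finset.range n, i) := by
    intro n
    induction n with
    | zero => simp
    | succ n ih =>
      set s := ∑ i ∈ Finset.range n, i with hs
      calc (y * w) ^ (n + 1) = y ^ n * w ^ n * (t ^ s * (y * w)) := by
            rw [pow_succ, ih, mul_assoc]
        _ = y ^ n * (w ^ n * y) * w * t ^ s := by
          rw [((ht (y * w)).pow_left s).eq]; simp only [mul_assoc]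
        _ = y ^ (n + 1) * w ^ n * (t ^ n * w) * t ^ s := by
          rw [h1, pow_succ]; simp only [mul_assoc]
        _ = y ^ (n + 1) * w ^ (n + 1) * t ^ (∑ i ∈ Finset.range (n + 1), i) := by
          rw [((ht w).pow_left n).eq, Finset.sum_range_succ, ← hs, add_comm s n, pow_add t,
            pow_succ w]; simp only [mul_assoc]
  rw [h2, Finset.sum_range_id]

/-- A finite `q`-group with this property and a suitable central element is cyclic. -/
theorem CommutingCyclic.isCyclic_of_central.{u} {q : ℕ} [Fact q.Prime] (n : ℕ) :
    ∀ (P : Type u) [Group P] [Finite P], Nat.card P = n → IsPGroup q P → CommutingCyclic P →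
      ∀ c : P, (∀ g, Commute c g) → (Odd q ∧ orderOf c = q ∨ q = 2 ∧ orderOf c = 4) →
        IsCyclic P := by
  have hq : q.Prime := Fact.out
  induction n using Nat.strong_induction_on with
  | _ n ih =>
  intro P _ _ hn hP hZ c hc hord
  by_cases hcomm : ∀ a b : P, Commute a b
  · exact hZ.isCyclic_of_commute hcomm
  exfalso
  have hsub : ∀ M : Subgroup P, c ∈ M → M ≠ ⊤ → IsCyclic M := by
    intro M hcM hM
    have hlt : Nat.card M < n := by
      have h1 : Nat.card M ≤ Nat.card P := Subgroup.card_le_card_group M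
      have h2 : Nat.card M ≠ Nat.card P := fun h => hM ((Subgroup.card_eq_iff_eq_top M).1 h)
      omega
    refine ih _ hlt M rfl (hP.to_subgroup M) (hZ.subgroup M) ⟨c, hcM⟩
      (fun g => Subtype.ext (hc g)) ?_
    simpa [Subgroup.orderOf_mk] using hord
  have hne : ∀ M : Subgroup P, M.index = q → M ≠ ⊤ := by
    rintro M hM rfl
    rw [Subgroup.index_top] at hM
    exact hq.one_lt.ne hM
  have h1 : Subgroup.zpowers c ≠ ⊤ := by
    intro h
    refine hcomm fun a b => ?_
    obtain ⟨i, hi⟩ := Subgroup.mem_zpowers_iff.1 (h ▸ Subgroup.mem_top a : a ∈ Subgroup.zpowers c)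
    rw [← hi]
    exact (hc b).zpow_left i
  obtain ⟨M₁, hN₁, hI₁, hle₁⟩ := hP.exists_normal_index_eq h1
  have hc₁ : c ∈ M₁ := hle₁ (Subgroup.mem_zpowers c)
  obtain ⟨y, hy⟩ : ∃ y, y ∉ M₁ := by
    by_contra hcon
    push Not at hcon
    exact hne M₁ hI₁ ((Subgroup.eq_top_iff' M₁).2 hcon)
  have h2 : Subgroup.closure {y, c} ≠ ⊤ := by
    intro h
    have hcc : ∀ a ∈ ({y, c} : Set P), ∀ b ∈ ({y, c} : Set P), a * b = b * a := by
      rintro a (rfl | rfl) b (rfl | rfl)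
      · rfl
      · exact (hc a).symm
      · exact hc b
      · rfl
    have := Subgroup.isMulCommutative_closure hcc
    refine hcomm fun a b => ?_
    have h3 := mul_comm' (⟨a, h ▸ Subgroup.mem_top a⟩ : Subgroup.closure {y, c})
      ⟨b, h ▸ Subgroup.mem_top b⟩
    exact congrArg Subtype.val h3
  obtain ⟨M₂, hN₂, hI₂, hle₂⟩ := hP.exists_normal_index_eq h2
  have hc₂ : c ∈ M₂ := hle₂ (Subgroup.subset_closure (by simp))
  have hy₂ : y ∈ M₂ := hle₂ (Subgroup.subset_closure (by simp))
  have hC₁ := hsub M₁ hc₁ (hne M₁ hI₁)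
  have hC₂ := hsub M₂ hc₂ (hne M₂ hI₂)
  have hcom : ∀ (M : Subgroup P), IsCyclic M → ∀ a ∈ M, ∀ b ∈ M, a * b = b * a := by
    intro M hM a ha b hb
    exact congrArg Subtype.val (mul_comm' (⟨a, ha⟩ : M) ⟨b, hb⟩)
  have hcard : Nat.card M₁ = Nat.card M₂ := by
    have e1 := M₁.card_mul_index
    have e2 := M₂.card_mul_index
    rw [hI₁] at e1
    rw [hI₂, ← e1] at e2
    exact (Nat.eq_of_mul_eq_mul_right hq.pos e2).symm
  obtain ⟨⟨x, hx⟩, hgen⟩ := hC₁.exists_generator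
  have hgen' : ∀ g ∈ M₁, ∃ i : ℤ, x ^ i = g := by
    intro g hg
    obtain ⟨i, hi⟩ := Subgroup.mem_zpowers_iff.1 (hgen ⟨g, hg⟩)
    exact ⟨i, congrArg Subtype.val hi⟩
  have hx₂ : x ∉ M₂ := by
    intro hx₂
    have hle : M₁ ≤ M₂ := by
      intro g hg
      obtain ⟨i, rfl⟩ := hgen' g hg
      exact M₂.zpow_mem hx₂ i
    exact hy ((Subgroup.eq_of_le_of_card_ge hle hcard.ge) ▸ hy₂)
  have hcentral : ∀ g, g ∈ M₁ → g ∈ M₂ → ∀ w, Commute g w := by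
    intro g hg₁ hg₂
    have hle : M₁ ⊔ Subgroup.zpowers y ≤ Subgroup.centralizer {g} := by
      rw [sup_le_iff]
      constructor
      · intro w hw
        exact Subgroup.mem_centralizer_singleton_iff.2 (hcom M₁ hC₁ w hw g hg₁)
      · rw [Subgroup.zpowers_le]
        exact Subgroup.mem_centralizer_singleton_iff.2 (hcom M₂ hC₂ y hy₂ g hg₂)
    have htop : M₁ ⊔ Subgroup.zpowers y = ⊤ := by
      have hd : (M₁ ⊔ Subgroup.zpowers y).index ∣ q := by
        rw [← hI₁]; exact Subgroup.index_dvd_of_le le_sup_left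
      rcases (Nat.dvd_prime hq).1 hd with h | h
      · exact Subgroup.index_eq_one.1 h
      · exfalso
        have hh : M₁ = M₁ ⊔ Subgroup.zpowers y := by
          have e1 := M₁.card_mul_index
          have e2 := (M₁ ⊔ Subgroup.zpowers y).card_mul_index
          rw [hI₁] at e1
          rw [h, ← e1] at e2
          exact Subgroup.eq_of_le_of_card_ge le_sup_left (Nat.eq_of_mul_eq_mul_right hq.pos e2).le
        exact hy (hh ▸ (le_sup_right : _ ≤ M₁ ⊔ Subgroup.zpowers y) (Subgroup.mem_zpowers y))
    intro w
    have := hle (htop ▸ Subgroup.mem_top w)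
    exact (Subgroup.mem_centralizer_singleton_iff.1 this).symm
  have hyq : y ^ q ∈ M₁ := by rw [← hI₁]; exact M₁.pow_index_mem y
  have hyq₂ : y ^ q ∈ M₂ := M₂.pow_mem hy₂ q
  obtain ⟨i, hi⟩ := hgen' _ hyq
  obtain ⟨j, rfl⟩ : (q : ℤ) ∣ i := by
    by_contra hqi
    have hqx : x ^ (q : ℤ) ∈ M₂ := by
      rw [zpow_natCast, ← hI₂]; exact M₂.pow_index_mem x
    have hcop : IsCoprime (q : ℤ) i := (Nat.prime_iff_prime_int.1 hq).coprime_iff_not_dvd.2 hqi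
    obtain ⟨s, t, hst⟩ := hcop
    apply hx₂
    have : x = (x ^ (q : ℤ)) ^ s * (x ^ i) ^ t := by
      rw [← zpow_mul, ← zpow_mul, ← zpow_add, mul_comm _ s, mul_comm _ t, hst, zpow_one]
    rw [this, hi]
    exact M₂.mul_mem (M₂.zpow_mem hqx _) (M₂.zpow_mem hyq₂ _)
  set w := x ^ (-j) with hw
  have hwq : y ^ q * w ^ q = 1 := by
    rw [← hi, hw, ← zpow_natCast, ← zpow_mul, ← zpow_add]; simp [mul_comm]
  set t := (y * w)⁻¹ * (w * y) with ht
  have hwy : w * y = y * w * t := by rw [ht]; group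
  have htc : ∀ g, Commute t g := hcentral t
    (Subgroup.inv_mul_swap_mem_of_index_prime (hI₁.symm ▸ hq) y w)
    (Subgroup.inv_mul_swap_mem_of_index_prime (hI₂.symm ▸ hq) y w)
  have htq : t ^ q = 1 := by
    have h3 : ∀ m : ℕ, w * y ^ m = y ^ m * w * t ^ m := by
      intro m
      induction m with
      | zero => simp
      | succ m ihm =>
        calc w * y ^ (m + 1) = (w * y ^ m) * y := by rw [pow_succ, mul_assoc]
          _ = y ^ m * w * (t ^ m * y) := by rw [ihm, mul_assoc]
          _ = y ^ m * (w * y) * t ^ m := by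
            rw [((htc y).pow_left m).eq]; simp only [mul_assoc]
          _ = y ^ (m + 1) * w * t ^ (m + 1) := by
            rw [hwy, pow_succ, pow_succ']; simp only [mul_assoc]
    have h4 := h3 q
    rw [((hcentral _ hyq hyq₂ w).eq).symm] at h4
    exact (mul_eq_left.1 h4.symm)
  have hfin : (y * w) ^ orderOf c = 1 := by
    rcases hord with ⟨hodd, ho⟩ | ⟨h2, ho⟩
    · rw [ho, mul_pow_of_central hwy htc, hwq, one_mul]
      obtain ⟨m, hm⟩ := hodd
      have : q * (q - 1) / 2 = q * m := by
        rw [show q - 1 = 2 * m by omega, show q * (2 * m) = 2 * (q * m) by ring]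
        omega
      rw [this, pow_mul, htq, one_pow]
    · have h5 : (y * w) ^ 2 = t := by
        rw [mul_pow_of_central hwy htc, ← h2, hwq, one_mul, h2]; simp
      rw [ho, show 4 = 2 * 2 from rfl, pow_mul, h5, ← h2, htq]
  have hmem : y * w ∈ M₁ := hle₁ (hZ c (y * w) (hc _) hfin)
  exact hy ((M₁.mul_mem_cancel_right (M₁.zpow_mem hx _)).1 hmem)

/-! ### Fusion of elements of order four -/

theorem mul_mul_inv_inv {R : Type*} [Group R] (f y : R) : f * y⁻¹ * f⁻¹ = (f * y * f⁻¹)⁻¹ := by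
  group

/-- `f` conjugates `a` to `b` or to its inverse. -/
def ConjUpToInv {R : Type*} [Group R] (f a b : R) : Prop :=
  f * a * f⁻¹ = b ∨ f * a * f⁻¹ = b⁻¹

namespace ConjUpToInv

variable {R : Type*} [Group R] {f g a b c : R}

theorem mul (hg : ConjUpToInv g b c) (hf : ConjUpToInv f a b) : ConjUpToInv (g * f) a c := by
  have h : g * f * a * (g * f)⁻¹ = g * (f * a * f⁻¹) * g⁻¹ := by group
  unfold ConjUpToInv at *
  rw [h]
  rcases hf with hf | hf <;> rcases hg with hg | hg <;> rw [hf] <;>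
    simp [mul_mul_inv_inv, hg]

theorem pow_two_commute (h : ConjUpToInv f a a) : Commute (f ^ 2) a := by
  have h1 : f ^ 2 * a * (f ^ 2)⁻¹ = f * (f * a * f⁻¹) * f⁻¹ := by
    rw [pow_two]; group
  have h2 : f ^ 2 * a * (f ^ 2)⁻¹ = a := by
    rw [h1]
    rcases h with h | h <;> simp [h, mul_mul_inv_inv]
  exact mul_inv_eq_iff_eq_mul.1 h2

theorem symm (h : ConjUpToInv f a b) : ConjUpToInv f⁻¹ b a := by
  rcases h with h | h
  · left; rw [← h]; group
  · right; rw [eq_inv_iff_mul_eq_one, ← inv_eq_iff_eq_inv.2 h]; group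

theorem inv_right (h : ConjUpToInv f a b) : ConjUpToInv f a b⁻¹ := by
  rcases h with h | h
  · right; rw [h, inv_inv]
  · left; exact h

/-- An element permuting three cyclic groups in a cycle has order divisible by three. -/
theorem three_dvd_orderOf (hab : ConjUpToInv f a b) (hbc : ConjUpToInv f b c)
    (hca : ConjUpToInv f c a) (hc : c ≠ a) (hc' : c⁻¹ ≠ a) : 3 ∣ orderOf f := by
  by_contra h3
  have hcop : Nat.Coprime 3 (orderOf f) := (Nat.Prime.coprime_iff_not_dvd Nat.prime_three).2 h3
  have h6 : Commute ((f ^ 3) ^ 2) a := by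
    refine pow_two_commute ?_
    rw [pow_succ, pow_two]
    have := hca.mul (hbc.mul hab)
    rwa [← mul_assoc] at this
  have h2 : Commute (f ^ 2) a := by
    obtain ⟨m, hm⟩ := exists_pow_eq_self_of_coprime (hcop) 
    have : f ^ 2 = ((f ^ 3) ^ 2) ^ m := by
      conv_lhs => rw [← hm]
      rw [← pow_mul, ← pow_mul, ← pow_mul, ← pow_mul]; congr 1; ring
    rw [this]
    exact h6.pow_left m
  have h7 : ConjUpToInv (f ^ 2) a c := by rw [pow_two]; exact hbc.mul hab
  have h8 : f ^ 2 * a * (f ^ 2)⁻¹ = a := by rw [h2.eq]; group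
  rcases h7 with h | h
  · exact hc (h8 ▸ h).symm
  · exact hc' (h8 ▸ h).symm

end ConjUpToInv

/-- Abstract fusion argument in a Sylow `2`-subgroup `Q` with cyclic subgroup `T` of index two. -/
theorem exists_three_dvd_orderOf {R : Type*} [Group R] (Q T : Subgroup R) {u z y : R}
    (hTQ : T ≤ Q) (huT : u ∈ T) (hu : u * u = z) (hzz : z * z = 1) (hz1 : z ≠ 1)
    (hinv : ∀ y ∈ Q, y ∉ T → ∀ x ∈ T, y * x * y⁻¹ = x⁻¹)
    (hTc : ∀ x ∈ T, ∀ w ∈ T, x * w = w * x)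
    (hidx : ∀ y ∈ Q, y ∉ T → ∀ w ∈ Q, w ∉ T → y⁻¹ * w ∈ T)
    (hsq : ∀ y ∈ Q, y ∉ T → y * y = z)
    (hfus : ∀ y ∈ Q, y ∉ T → ∃ f, ConjUpToInv f y u ∧ f * u * f⁻¹ ∈ Q)
    (hyQ : y ∈ Q) (hyT : y ∉ T)
    (hT : (∃ x ∈ T, x * x = u) ∨ ∀ t ∈ T, t = 1 ∨ t = u ∨ t = z ∨ t = u⁻¹) :
    ∃ f : R, 3 ∣ orderOf f := by
  have hzT : z ∈ T := hu ▸ T.mul_mem huT huT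
  have hzc : ∀ w ∈ Q, w * z = z * w := by
    intro w hw
    by_cases hwT : w ∈ T
    · exact hTc w hwT z hzT
    · rw [← hsq w hw hwT]; group
  have hzinv : z⁻¹ = z := inv_eq_of_mul_eq_one_right hzz
  have huinv : u⁻¹ = u * z := by
    rw [← hzinv, ← hu]; group
  have hyinv : ∀ y ∈ Q, y ∉ T → y⁻¹ = y * z := by
    intro y h1 h2
    rw [← hzinv, ← hsq y h1 h2]; group
  have huy : u * y ∈ Q := Q.mul_mem (hTQ huT) hyQ
  have huyT : u * y ∉ T := fun h => hyT ((T.mul_mem_cancel_left huT).1 h)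
  have hyu : y * u * y⁻¹ = u⁻¹ := hinv y hyQ hyT u huT
  have hyu' : y * u = u⁻¹ * y := mul_inv_eq_iff_eq_mul.1 hyu
  -- conjugation of products
  have hne1 : ∀ {w : R}, w ∈ Q → w ∉ T → w ≠ u ∧ w⁻¹ ≠ u :=
    fun _ h2 => ⟨fun h => h2 (h ▸ huT), fun h => h2 ((T.inv_mem_iff).1 (h ▸ huT))⟩
  have hneuy : u * y ≠ y ∧ (u * y)⁻¹ ≠ y := by
    constructor
    · intro h
      have : u = 1 := by simpa using h
      exact hz1 (by rw [← hu, this, one_mul])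
    · intro h
      have h1 : y * (u * y) = 1 := mul_eq_one_iff_eq_inv.2 h.symm
      have h2 : y * (u * y) = u⁻¹ * z := by
        rw [← mul_assoc, hyu', mul_assoc, hsq y hyQ hyT]
      rw [h2, huinv, mul_assoc, hzz, mul_one] at h1
      exact hz1 (by rw [← hu, h1, one_mul])
  -- the two transpositions generate a three-cycle
  have hcomp : ∀ g h : R, ConjUpToInv g u y → ConjUpToInv g y u → ConjUpToInv g (u * y) (u * y) →
      ConjUpToInv h u (u * y) → ConjUpToInv h (u * y) u → ConjUpToInv h y y →
      ∃ f : R, 3 ∣ orderOf f := by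
    intro g h g1 g2 g3 h1 h2 h3
    refine ⟨h * g, ConjUpToInv.three_dvd_orderOf (a := u) (b := y) (c := u * y) (h3.mul g1)
      (h1.mul g2) (h2.mul g3) ?_ ?_⟩
    · exact (hne1 huy huyT).1
    · exact (hne1 huy huyT).2
  have hprod : ∀ {f a b c d : R}, ConjUpToInv f a c → ConjUpToInv f b d → c⁻¹ = c * z →
      d⁻¹ = d * z → d * z = z * d → (c * d)⁻¹ = c * d * z → ConjUpToInv f (a * b) (c * d) := by
    intro f a b c d h1 h2 hc hd hdz hcd
    have hm : f * (a * b) * f⁻¹ = (f * a * f⁻¹) * (f * b * f⁻¹) := by group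
    unfold ConjUpToInv
    rw [hm, hcd]
    rcases h1 with h1 | h1 <;> rcases h2 with h2 | h2 <;> rw [h1, h2]
    · exact Or.inl rfl
    · right; rw [hd, mul_assoc]
    · right; rw [hc, mul_assoc, mul_assoc, hdz]
    · left; rw [hc, hd, mul_assoc, hdz, ← mul_assoc z, hzz, one_mul]
  have hyuuy : y * u = u * y * z := by
    rw [hyu', huinv, mul_assoc, mul_assoc, hzc y hyQ]
  have hflip : ∀ {f a : R}, ConjUpToInv f a (y * u) → ConjUpToInv f a (u * y) := by
    intro f a h
    have : y * u = (u * y)⁻¹ := by rw [hyinv _ huy huyT, hyuuy]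
    rw [this] at h
    simpa using h.inv_right
  have hyuinv : (y * u)⁻¹ = y * u * z := by
    rw [hyuuy, mul_inv_rev, hzinv, hyinv _ huy huyT, ← mul_assoc, ← hzc _ huy]
  rcases hT with ⟨x, hxT, hx⟩ | hT
  · -- a square root of `u` in `T`
    have hroot : ∀ x w v : R, x * x = w → v * x * v⁻¹ = x⁻¹ → x * v * x⁻¹ = v * w⁻¹ := by
      intro x w v h1 h2
      have h3 : v⁻¹ * x * v = x⁻¹ := by
        have h4 : x = v⁻¹ * x⁻¹ * v := by rw [← h2]; group
        calc v⁻¹ * x * v = (v⁻¹ * x⁻¹ * v)⁻¹ := by group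
          _ = x⁻¹ := by rw [← h4]
      calc x * v * x⁻¹ = v * (v⁻¹ * x * v) * x⁻¹ := by group
        _ = v * w⁻¹ := by rw [h3, ← h1]; group
    have hx1 : x * y * x⁻¹ = y * u⁻¹ := hroot x u y hx (hinv y hyQ hyT x hxT)
    have k1 : ConjUpToInv x y (u * y) := by
      left; rw [hx1]
      calc y * u⁻¹ = y * u⁻¹ * y⁻¹ * y := by group
        _ = u * y := by rw [mul_mul_inv_inv, hyu, inv_inv]
    have k2 : ConjUpToInv x u u := by
      left; rw [hTc x hxT u huT]; group
    have k3 : ConjUpToInv x (u * y) y := by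
      rcases k1 with k1 | k1
      · right
        rw [show x * (u * y) * x⁻¹ = (x * u * x⁻¹) * (x * y * x⁻¹) by group, k1,
          show x * u * x⁻¹ = u by rw [hTc x hxT u huT]; group, ← mul_assoc, hu,
          hyinv y hyQ hyT, hzc y hyQ]
      · left
        rw [show x * (u * y) * x⁻¹ = (x * u * x⁻¹) * (x * y * x⁻¹) by group, k1,
          show x * u * x⁻¹ = u by rw [hTc x hxT u huT]; group, hyinv _ huy huyT, ← mul_assoc,
          ← mul_assoc, hu, mul_assoc, hzc y hyQ, ← mul_assoc, hzz, one_mul]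
    obtain ⟨f, hf, hfu⟩ := hfus y hyQ hyT
    set x₁ := f⁻¹ * x * f with hx₁
    have hfuT : f * u * f⁻¹ ∉ T := by
      intro h
      have h1 := hTc _ h u huT
      have h2 : Commute u y := by
        have h3 : Commute (f * u * f⁻¹) (f * y * f⁻¹) := by
          rcases hf with hf | hf <;> rw [hf]
          · exact h1
          · exact (show Commute (f * u * f⁻¹) u from h1).inv_right
        exact Commute.conj_iff f |>.1 h3
      rw [h2.symm.eq] at hyu'
      have h4 : u = u⁻¹ := mul_right_cancel hyu'
      exact hz1 (by rw [← hu]; nth_rewrite 2 [h4]; group)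
    have hux₁ : u * x₁ * u⁻¹ = x₁⁻¹ := by
      have := hinv _ hfu hfuT x hxT
      rw [hx₁]
      calc u * (f⁻¹ * x * f) * u⁻¹ = f⁻¹ * ((f * u * f⁻¹) * x * (f * u * f⁻¹)⁻¹) * f := by group
        _ = (f⁻¹ * x * f)⁻¹ := by rw [this]; group
    have hx₁sq : x₁ * x₁ = f⁻¹ * u * f := by rw [hx₁, ← hx]; group
    have hpm : x₁ * x₁ = y ∨ x₁ * x₁ = y⁻¹ := by
      rw [hx₁sq]
      have := hf.symm
      rcases this with h | h <;> rw [inv_inv] at h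
      · exact Or.inl h
      · exact Or.inr h
    have m1 : ConjUpToInv x₁ u (u * y) := by
      have := hroot x₁ _ u rfl hux₁
      rcases hpm with h | h <;> rw [h] at this
      · right; rw [this, hyinv y hyQ hyT, hyinv _ huy huyT, mul_assoc]
      · left; rw [this, inv_inv]
    have m2 : ConjUpToInv x₁ y y := by
      have h1 : Commute x₁ y := by
        rcases hpm with h | h
        · rw [← h]; exact (Commute.refl x₁).mul_right (Commute.refl x₁)
        · rw [← inv_inv y, ← h]; exact ((Commute.refl x₁).mul_right (Commute.refl x₁)).inv_right
      left; rw [h1.eq]; group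
    have m3 : ConjUpToInv x₁ (u * y) u := by
      have h1 := hprod (f := x₁) m1 m2 (hyinv _ huy huyT) (hyinv y hyQ hyT) (hzc y hyQ) (by
        rw [mul_assoc, hsq y hyQ hyT, mul_assoc, hzz, mul_one, mul_inv_rev, hzinv, huinv, ← mul_assoc,
          ← hzc u (hTQ huT), mul_assoc, hzz, mul_one])
      rw [mul_assoc, hsq y hyQ hyT, ← huinv] at h1
      simpa using h1.inv_right
    refine ⟨x * x₁, ConjUpToInv.three_dvd_orderOf (a := u) (b := y) (c := u * y) (k3.mul m1)
      (k1.mul m2) (k2.mul m3) (hne1 huy huyT).1 (hne1 huy huyT).2⟩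
  · -- `T` has order four
    have hout : ∀ w ∈ Q, w ∉ T → (w = y ∨ w = y⁻¹) ∨ (w = u * y ∨ w = (u * y)⁻¹) := by
      intro w hw hwT
      have h1 := hT _ (hidx y hyQ hyT w hw hwT)
      have h2 : w = y * (y⁻¹ * w) := by group
      rcases h1 with h | h | h | h <;> rw [h] at h2
      · left; left; rw [h2, mul_one]
      · right; right; rw [h2, hyinv _ huy huyT, hyuuy]
      · left; right; rw [h2, hyinv y hyQ hyT]
      · right; left; rw [h2]
        calc y * u⁻¹ = y * u⁻¹ * y⁻¹ * y := by group
          _ = u * y := by rw [mul_mul_inv_inv, hyu, inv_inv]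
    have hnot : ∀ (f w : R), w ∈ Q → w ∉ T → ConjUpToInv f w u → f * u * f⁻¹ ∉ T := by
      intro f w hw hwT hf h
      have h1 := hTc _ h u huT
      have h2 : Commute u w := by
        have h3 : Commute (f * u * f⁻¹) (f * w * f⁻¹) := by
          rcases hf with hf | hf <;> rw [hf]
          · exact h1
          · exact (show Commute (f * u * f⁻¹) u from h1).inv_right
        exact Commute.conj_iff f |>.1 h3
      have h3 := mul_inv_eq_iff_eq_mul.1 (hinv w hw hwT u huT)
      rw [h2.symm.eq] at h3
      have h4 : u = u⁻¹ := mul_right_cancel h3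
      exact hz1 (by rw [← hu]; nth_rewrite 2 [h4]; group)
    obtain ⟨f, hf, hfQ⟩ := hfus y hyQ hyT
    obtain ⟨g, hg, hgQ⟩ := hfus (u * y) huy huyT
    rcases hout _ hfQ (hnot f y hyQ hyT hf) with hf' | hf'
    · rcases hout _ hgQ (hnot g _ huy huyT hg) with hg' | hg'
      · -- three-cycle `u * y → u → y → u * y`
        have h1 : ConjUpToInv g u y := hg'
        have h2 : ConjUpToInv g (u * (u * y)) (y * u) := hprod h1 hg (hyinv y hyQ hyT) huinv
          (hzc u (hTQ huT)) hyuinv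
        have h3 : ConjUpToInv g y (u * y) := by
          rw [← mul_assoc, hu] at h2
          have : z * y = y⁻¹ := by rw [hyinv y hyQ hyT, hzc y hyQ]
          rw [this] at h2
          have h4 := hflip h2
          unfold ConjUpToInv at h4 ⊢
          rw [mul_mul_inv_inv, inv_inj, inv_eq_iff_eq_inv] at h4
          exact h4.symm
        exact ⟨g, ConjUpToInv.three_dvd_orderOf h1 h3 hg (hne1 huy huyT).1 (hne1 huy huyT).2⟩
      · have h1 : ConjUpToInv f u y := hf'
        have h2 : ConjUpToInv g u (u * y) := hg'
        have h3 : ConjUpToInv f (u * y) (u * y) :=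
          hflip (hprod h1 hf (hyinv y hyQ hyT) huinv (hzc u (hTQ huT)) hyuinv)
        have e1 : (u * y) * u = y := by
          rw [mul_assoc, hyu', ← mul_assoc, mul_inv_cancel, one_mul]
        have h4 : ConjUpToInv g (u * (u * y)) ((u * y) * u) := hprod h2 hg (hyinv _ huy huyT) huinv
          (hzc u (hTQ huT)) (by rw [e1]; exact hyinv y hyQ hyT)
        have h5 : ConjUpToInv g y y := by
          rw [← mul_assoc, hu, e1] at h4
          have : z * y = y⁻¹ := by rw [hyinv y hyQ hyT, hzc y hyQ]
          rw [this] at h4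
          unfold ConjUpToInv at h4 ⊢
          rw [mul_mul_inv_inv, inv_inj, inv_eq_iff_eq_inv] at h4
          exact h4.symm
        exact hcomp f g h1 hf h3 h2 hg h5
    · -- three-cycle `y → u → u * y → y`
      have h1 : ConjUpToInv f u (u * y) := hf'
      have e1 : (u * y) * u = y := by
        rw [mul_assoc, hyu', ← mul_assoc, mul_inv_cancel, one_mul]
      have h2 : ConjUpToInv f (u * y) ((u * y) * u) := hprod h1 hf (hyinv _ huy huyT) huinv
          (hzc u (hTQ huT)) (by rw [e1]; exact hyinv y hyQ hyT)
      rw [e1] at h2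
      exact ⟨f, ConjUpToInv.three_dvd_orderOf hf h1 h2 hneuy.1 hneuy.2⟩

theorem IsPGroup.exists_central_orderOf_eq {P : Type*} [Group P] [Finite P] [Nontrivial P] {q : ℕ}
    [Fact q.Prime] (hP : IsPGroup q P) : ∃ c : P, (∀ g, Commute c g) ∧ orderOf c = q := by
  have h1 := hP.center_nontrivial
  obtain ⟨n, hn⟩ := IsPGroup.iff_card.1 (hP.to_subgroup (Subgroup.center P))
  have hn0 : n ≠ 0 := by
    rintro rfl
    rw [pow_zero] at hn
    exact (Finite.one_lt_card (α := Subgroup.center P)).ne' hn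
  obtain ⟨c, hc⟩ := exists_prime_orderOf_dvd_card' (G := Subgroup.center P) q
    (hn ▸ dvd_pow_self q hn0)
  exact ⟨c, fun g => (Subgroup.mem_center_iff.1 c.2 g).symm, by rw [Subgroup.orderOf_coe, hc]⟩

/-- Structure of a noncyclic finite `2`-group with a unique involution in which commuting elements
of compatible orders generate cyclic groups: it is generalized quaternion. -/
theorem CommutingCyclic.exists_index_two {Q : Type*} [Group Q] [Finite Q] (hQ : IsPGroup 2 Q)
    (hZ : CommutingCyclic Q)
    (hinv : ∀ y z : Q, orderOf y = 2 → orderOf z = 2 → y = z) (hnc : ¬ IsCyclic Q) :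
    ∃ (T : Subgroup Q) (u z : Q), IsCyclic T ∧ T.index = 2 ∧ u ∈ T ∧ orderOf u = 4 ∧
      orderOf z = 2 ∧ u * u = z ∧
      (∀ y ∉ T, y * y = z) ∧ (∀ y ∉ T, ∀ x ∈ T, y * x * y⁻¹ = x⁻¹) := by
  have : Nontrivial Q := by
    by_contra h
    rw [not_nontrivial_iff_subsingleton] at h
    exact hnc inferInstance
  obtain ⟨z, hzc, hz⟩ := hQ.exists_central_orderOf_eq
  have hz1 : z ≠ 1 := by rintro rfl; simp at hz
  have hzz : z * z = 1 := by rw [← pow_two, ← hz, pow_orderOf_eq_one]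
  have hord2 : ∀ y : Q, y * y = 1 → y = 1 ∨ y = z := by
    intro y hy
    by_cases h : y = 1
    · exact Or.inl h
    · exact Or.inr (hinv y z (orderOf_eq_prime (by rwa [pow_two]) h) hz)
  have hNn : (Subgroup.zpowers z).Normal := by
    refine ⟨fun n hn g => ?_⟩
    obtain ⟨i, rfl⟩ := Subgroup.mem_zpowers_iff.1 hn
    have := (((hzc g).zpow_left i).eq).symm
    rw [this, mul_inv_cancel_right]
    exact hn
  have hmem : ∀ g ∈ Subgroup.zpowers z, g = 1 ∨ g = z := by
    intro g hg
    obtain ⟨i, rfl⟩ := Subgroup.mem_zpowers_iff.1 hg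
    refine hord2 _ ?_
    rw [← (Commute.refl z).mul_zpow, hzz, one_zpow]
  have hqn : Nontrivial (Q ⧸ Subgroup.zpowers z) := by
    refine QuotientGroup.nontrivial_iff.2 fun h => hnc ⟨z, fun g => ?_⟩
    exact (h ▸ Subgroup.mem_top g : g ∈ Subgroup.zpowers z)
  obtain ⟨u', hu'c, hu'⟩ := (hQ.to_quotient (Subgroup.zpowers z)).exists_central_orderOf_eq
  obtain ⟨u, rfl⟩ := QuotientGroup.mk_surjective u'
  have huN : u ∉ Subgroup.zpowers z := by
    intro h
    rw [(QuotientGroup.eq_one_iff u).2 h] at hu'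
    simp at hu'
  have huu : u * u = z := by
    have h1 : u * u ∈ Subgroup.zpowers z := by
      rw [← QuotientGroup.eq_one_iff, QuotientGroup.mk_mul, ← pow_two, ← hu', pow_orderOf_eq_one]
    rcases hmem _ h1 with h | h
    · rcases hord2 u h with h | h
      · exact absurd (h ▸ Subgroup.one_mem _) huN
      · exact absurd (h ▸ Subgroup.mem_zpowers z) huN
    · exact h
  have hu4 : orderOf u = 4 := by
    refine orderOf_eq_prime_pow (p := 2) (n := 1) ?_ ?_
    · simpa [pow_two, huu] using hz1
    · rw [show 2 ^ (1 + 1) = 2 * 2 by norm_num, pow_mul, pow_two, pow_two, huu, hzz]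
  have huinv : u⁻¹ = u * z := by
    rw [inv_eq_iff_mul_eq_one, ← mul_assoc, huu, hzz]
  have hconj : ∀ y : Q, y * u * y⁻¹ = u ∨ y * u * y⁻¹ = u⁻¹ := by
    intro y
    have h1 : u⁻¹ * (y * u * y⁻¹) ∈ Subgroup.zpowers z := by
      rw [← QuotientGroup.eq]
      rw [QuotientGroup.mk_mul, QuotientGroup.mk_mul, ← (hu'c y).eq, QuotientGroup.mk_inv]
      group
    have h2 : y * u * y⁻¹ = u * (u⁻¹ * (y * u * y⁻¹)) := by group
    rcases hmem _ h1 with h | h <;> rw [h] at h2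
    · left; rw [h2, mul_one]
    · right; rw [h2, huinv]
  set T := Subgroup.centralizer {u} with hT
  have hTmem : ∀ g, g ∈ T ↔ g * u * g⁻¹ = u := by
    intro g
    rw [hT, Subgroup.mem_centralizer_singleton_iff, mul_inv_eq_iff_eq_mul]
  have huT : u ∈ T := by rw [hTmem]; group
  have hTcyc : IsCyclic T := by
    refine CommutingCyclic.isCyclic_of_central (q := 2) _ T rfl (hQ.to_subgroup T) (hZ.subgroup T)
      ⟨u, huT⟩ (fun g => Subtype.ext ?_) (Or.inr ⟨rfl, by simpa [Subgroup.orderOf_mk] using hu4⟩)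
    exact (mul_inv_eq_iff_eq_mul.1 ((hTmem g).1 g.2)).symm
  have hyinv : ∀ y ∉ T, y * u * y⁻¹ = u⁻¹ := fun y hy => (hconj y).resolve_left (by rwa [← hTmem])
  have hprod : ∀ y ∉ T, ∀ w ∉ T, y * w ∈ T := by
    intro y hy w hw
    rw [hTmem]
    calc y * w * u * (y * w)⁻¹ = y * (w * u * w⁻¹) * y⁻¹ := by group
      _ = u := by rw [hyinv w hw, mul_mul_inv_inv, hyinv y hy, inv_inv]
  have hTtop : T ≠ ⊤ := by
    intro h
    rw [h] at hTcyc
    exact hnc (isCyclic_of_surjective (Subgroup.topEquiv (G := Q)) Subgroup.topEquiv.surjective)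
  obtain ⟨y₀, hy₀⟩ : ∃ y, y ∉ T := by
    by_contra hcon
    push Not at hcon
    exact hTtop ((Subgroup.eq_top_iff' T).2 hcon)
  have hidx : T.index = 2 := by
    rw [Subgroup.index_eq_two_iff]
    refine ⟨y₀, fun b => ?_⟩
    by_cases hb : b ∈ T
    · exact Or.inr ⟨hb, fun h => hy₀ ((T.mul_mem_cancel_left hb).1 h)⟩
    · exact Or.inl ⟨hprod b hb y₀ hy₀, hb⟩
  have hsq : ∀ y ∉ T, y * y = z := by
    intro y hy
    have hyy : y * y ∈ T := hprod y hy y hy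
    have hz' : z ∈ T := by rw [← huu]; exact T.mul_mem huT huT
    have h4 : (y * y) * (y * y) = 1 := by
      by_contra h4
      obtain ⟨n, hn⟩ := (IsPGroup.iff_orderOf.1 hQ) (y * y)
      have hn2 : 2 ≤ n := by
        by_contra hlt
        apply h4
        rw [← pow_two, ← orderOf_dvd_iff_pow_eq_one, hn]
        exact pow_dvd_pow 2 (by omega : n ≤ 1)
      have h5 : u ∈ Subgroup.zpowers (y * y) := by
        refine hZ _ _ ((Subgroup.mem_centralizer_singleton_iff.1 hyy)) ?_
        rw [hn, ← orderOf_dvd_iff_pow_eq_one, hu4]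
        exact pow_dvd_pow 2 hn2
      obtain ⟨i, hi⟩ := Subgroup.mem_zpowers_iff.1 h5
      apply hy
      rw [hTmem, ← hi]
      have : Commute y ((y * y) ^ i) := ((Commute.refl y).mul_right (Commute.refl y)).zpow_right i
      rw [this.eq]; group
    rcases hord2 _ h4 with h | h
    · exfalso
      rcases hord2 y h with h | h
      · exact hy (h ▸ T.one_mem)
      · exact hy (h ▸ hz')
    · exact h
  refine ⟨T, u, z, hTcyc, hidx, huT, hu4, hz, huu, hsq, ?_⟩
  intro y hy x hx
  have h1 : y * x ∉ T := fun h => hy ((T.mul_mem_cancel_right hx).1 h)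
  have h2 : (y * x) * (y * x) = y * y := by rw [hsq _ h1, hsq y hy]
  have h3 : x * (y * x) = y := mul_left_cancel (by rw [← h2]; group : y * (x * (y * x)) = y * y)
  exact mul_inv_eq_iff_eq_mul.2 (eq_inv_mul_iff_mul_eq.2 h3)

/-! ### Perfect groups -/

theorem monoidHom_eq_one_of_perfect {R A : Type*} [Group R] [CommGroup A]
    (hR : commutator R = ⊤) (f : R →* A) (g : R) : f g = 1 := by
  have := Abelianization.commutator_subset_ker f
  rw [hR] at this
  exact this (Subgroup.mem_top g)

/-- Thompson's transfer argument. -/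
theorem exists_conj_mem_of_perfect {R : Type*} [Group R] [Finite R] (hR : commutator R = ⊤)
    (T : Subgroup R) (hT : T.index % 4 = 2) {y : R} (hyT : y * y ∈ T)
    (hyc : ∀ g, Commute (y * y) g) : ∃ g, g⁻¹ * y * g ∈ T := by
  classical
  have : Fintype (R ⧸ T) := Fintype.ofFinite _
  set σ := MulAction.toPermHom R (R ⧸ T) y with hσ
  have hσ2 : σ ^ 2 = 1 := by
    rw [hσ, ← map_pow, pow_two]
    ext x
    obtain ⟨g, rfl⟩ := QuotientGroup.mk_surjective x
    rw [MulAction.toPermHom_apply, MulAction.toPerm_apply, Equiv.Perm.one_apply,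
      MulAction.Quotient.smul_mk, smul_eq_mul, (hyc g).eq]
    exact QuotientGroup.eq.2 (by simpa [mul_assoc] using T.inv_mem hyT)
  have hsign := monoidHom_eq_one_of_perfect hR
    (Equiv.Perm.sign.comp (MulAction.toPermHom R (R ⧸ T))) y
  rw [MonoidHom.comp_apply, ← hσ, Equiv.Perm.sign_of_pow_two_eq_one hσ2] at hsign
  have hcard : Fintype.card (R ⧸ T) % 4 = 2 := by
    rw [← Nat.card_eq_fintype_card]; exact hT
  have hne : Fintype.card (Function.fixedPoints σ) ≠ 0 := by
    intro h0
    rw [h0, Nat.sub_zero, Odd.neg_one_pow (by rw [Nat.odd_iff]; omega)] at hsign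
    exact absurd hsign (by decide)
  obtain ⟨⟨x, hx⟩⟩ := Fintype.card_pos_iff.1 (Nat.pos_of_ne_zero hne)
  obtain ⟨g, rfl⟩ := QuotientGroup.mk_surjective x
  refine ⟨g, ?_⟩
  have h1 : ((y * g : R) : R ⧸ T) = (g : R ⧸ T) := hx
  have h2 := QuotientGroup.eq.1 h1.symm
  rwa [← mul_assoc] at h2

theorem CommutingCyclic.sylow_isCyclic {R : Type*} [Group R] [Finite R] (hZ : CommutingCyclic R)
    {q : ℕ} [Fact q.Prime] (hq : q ≠ 2) (P : Sylow q R) : IsCyclic P := by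
  have hqp : q.Prime := Fact.out
  by_cases hP : Nontrivial P
  · obtain ⟨c, hc, ho⟩ := P.2.exists_central_orderOf_eq
    exact CommutingCyclic.isCyclic_of_central (q := q) _ P rfl P.2 (hZ.subgroup P) c hc
      (Or.inl ⟨hqp.odd_of_ne_two hq, ho⟩)
  · rw [not_nontrivial_iff_subsingleton] at hP
    infer_instance

theorem CommutingCyclic.not_central_of_perfect {R : Type*} [Group R] [Finite R]
    (hZ : CommutingCyclic R) (hR : commutator R = ⊤) {a : R} (ha : orderOf a = 3) :
    ∃ g, ¬ Commute a g := by
  by_contra hcon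
  push Not at hcon
  have : Fact (Nat.Prime 3) := ⟨Nat.prime_three⟩
  have hpa : IsPGroup 3 (Subgroup.zpowers a) :=
    IsPGroup.of_card (n := 1) (by rw [Nat.card_zpowers, ha, pow_one])
  obtain ⟨P, hP⟩ := hpa.exists_le_sylow
  have hPc : IsCyclic P := hZ.sylow_isCyclic (by norm_num) P
  let _ : CommGroup P := IsCyclic.commGroup
  have h1 := MonoidHom.transfer_eq_pow (MonoidHom.id P) a (fun k g₀ _ => by
    rw [mul_assoc, ((hcon g₀).pow_left k).eq, inv_mul_cancel_left])
  rw [monoidHom_eq_one_of_perfect hR] at h1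
  have h2 : a ^ P.index = 1 := (congrArg Subtype.val h1).symm
  rw [← orderOf_dvd_iff_pow_eq_one, ha] at h2
  exact P.not_dvd_index h2

theorem CommutingCyclic.perfect_facts {R : Type*} [Group R] [Finite R] [Nontrivial R]
    (hZ : CommutingCyclic R) (hR : commutator R = ⊤)
    (hinv : ∀ y z : R, orderOf y = 2 → orderOf z = 2 → y = z) :
    8 ∣ Nat.card R ∧ ∃ a : R, orderOf a = 3 := by
  have h2 : Fact (Nat.Prime 2) := ⟨Nat.prime_two⟩
  obtain ⟨Q, hQ⟩ : ∃ Q : Sylow 2 R, ¬ IsCyclic Q := by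
    by_contra hcon
    push Not at hcon
    have hZG : IsZGroup R := by
      refine ⟨fun p hp P => ?_⟩
      have : Fact p.Prime := ⟨hp⟩
      by_cases h : p = 2
      · subst h; exact hcon P
      · exact hZ.sylow_isCyclic h P
    exact (IsZGroup.commutator_lt (G := R)).ne hR
  obtain ⟨T₀, u₀, z₀, hcyc, hidx, hu₀T, hu₀, hz₀, huu₀, hsq₀, hinv₀⟩ :=
    CommutingCyclic.exists_index_two Q.2 (hZ.subgroup Q)
      (fun y z hy hz => Subtype.ext (hinv y z (by rwa [Subgroup.orderOf_coe])
        (by rwa [Subgroup.orderOf_coe]))) hQ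
  set T : Subgroup R := T₀.map (Q : Subgroup R).subtype with hT
  have hTQ : T ≤ Q := by rw [hT]; exact Subgroup.map_subtype_le T₀
  have hmemT : ∀ y : Q, (y : R) ∈ T ↔ y ∈ T₀ := by
    intro y
    rw [hT, Subgroup.mem_map]
    constructor
    · rintro ⟨x, hx, hxy⟩
      exact (Subtype.ext hxy : x = y) ▸ hx
    · exact fun h => ⟨y, h, rfl⟩
  set u : R := u₀.1 with hu_def
  set z : R := z₀.1 with hz_def
  have huT : u ∈ T := (hmemT u₀).2 hu₀T
  have hu4 : orderOf u = 4 := by rw [hu_def, Subgroup.orderOf_coe, hu₀]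
  have hz2 : orderOf z = 2 := by rw [hz_def, Subgroup.orderOf_coe, hz₀]
  have huz : u * u = z := congrArg Subtype.val huu₀
  have hsq : ∀ y ∈ Q, y ∉ T → y * y = z := fun y hy hyT =>
    congrArg Subtype.val (hsq₀ ⟨y, hy⟩ (fun h => hyT ((hmemT ⟨y, hy⟩).2 h)))
  have hconj : ∀ y ∈ Q, y ∉ T → ∀ x ∈ T, y * x * y⁻¹ = x⁻¹ := fun y hy hyT x hx =>
    congrArg Subtype.val (hinv₀ ⟨y, hy⟩ (fun h => hyT ((hmemT ⟨y, hy⟩).2 h))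
      ⟨x, hTQ hx⟩ ((hmemT ⟨x, hTQ hx⟩).1 hx))
  have hTc : ∀ x ∈ T, ∀ w ∈ T, x * w = w * x := by
    intro x hx w hw
    have := mul_comm' (⟨⟨x, hTQ hx⟩, (hmemT ⟨x, hTQ hx⟩).1 hx⟩ : T₀)
      ⟨⟨w, hTQ hw⟩, (hmemT ⟨w, hTQ hw⟩).1 hw⟩
    exact congrArg (fun t : T₀ => ((t : Q) : R)) this
  have hz1 : z ≠ 1 := by intro h; rw [h] at hz2; simp at hz2
  have hzz : z * z = 1 := by rw [← pow_two, ← hz2, pow_orderOf_eq_one]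
  have hzc : ∀ g, Commute z g := by
    intro g
    have h1 : g * z * g⁻¹ = z := by
      refine hinv _ _ ?_ hz2
      rw [show g * z * g⁻¹ = MulAut.conj g z from rfl, MulEquiv.orderOf_eq, hz2]
    exact (mul_inv_eq_iff_eq_mul.1 h1).symm
  have hidx' : ∀ y ∈ Q, y ∉ T → ∀ w ∈ Q, w ∉ T → y⁻¹ * w ∈ T := by
    intro y hy hyT w hw hwT
    have h1 := (Subgroup.mul_mem_iff_of_index_two hidx (a := (⟨y, hy⟩ : Q)⁻¹) (b := ⟨w, hw⟩)).2 (by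
      rw [Subgroup.inv_mem_iff, ← hmemT, ← hmemT]
      exact iff_of_false hyT hwT)
    exact (hmemT _).2 h1
  obtain ⟨y₀, hy₀⟩ : ∃ y, y ∉ T₀ := by
    by_contra hcon
    push Not at hcon
    rw [(Subgroup.eq_top_iff' T₀).2 hcon, Subgroup.index_top] at hidx
    norm_num at hidx
  have hTidx : T.index % 4 = 2 := by
    have h1 : T.index = T₀.index * (Q : Subgroup R).index := by
      rw [hT, Subgroup.index_map, Subgroup.ker_subtype, sup_bot_eq, Subgroup.range_subtype]
    have h2 := Q.not_dvd_index
    rw [h1, hidx]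
    omega
  have h4T : 4 ∣ Nat.card T := by
    rw [← hu4, ← Subgroup.orderOf_mk u huT]; exact orderOf_dvd_natCard _
  constructor
  · have h1 := T.card_mul_index
    rw [← h1]
    obtain ⟨m, hm⟩ := h4T
    have : 2 ∣ T.index := by omega
    rw [hm]
    obtain ⟨j, hj⟩ := this
    rw [hj]
    exact ⟨m * j, by ring⟩
  -- the stabilizer of `{u, u⁻¹}`
  let N : Subgroup R :=
    { carrier := {n | ConjUpToInv n u u}
      mul_mem' := fun h1 h2 => ConjUpToInv.mul h1 h2
      one_mem' := Or.inl (by simp)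
      inv_mem' := fun h => ConjUpToInv.symm h }
  have hNmem : ∀ n, n ∈ N ↔ ConjUpToInv n u u := fun n => Iff.rfl
  have hQN : (Q : Subgroup R) ≤ N := by
    intro y hy
    rw [hNmem]
    by_cases hyT : y ∈ T
    · left; rw [hTc y hyT u huT]; group
    · right; exact hconj y hy hyT u huT
  have hfus : ∀ y ∈ (Q : Subgroup R), y ∉ T → ∃ f, ConjUpToInv f y u ∧
      f * u * f⁻¹ ∈ (Q : Subgroup R) := by
    intro y hy hyT
    obtain ⟨g, hg⟩ := exists_conj_mem_of_perfect hR T hTidx (y := y)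
      (by rw [hsq y hy hyT, ← huz]; exact T.mul_mem huT huT) (by rw [hsq y hy hyT]; exact hzc)
    have hgz : (g⁻¹ * y * g) * (g⁻¹ * y * g) = z := by
      rw [show (g⁻¹ * y * g) * (g⁻¹ * y * g) = g⁻¹ * (y * y) * g by group, hsq y hy hyT,
        mul_assoc, (hzc g).eq, inv_mul_cancel_left]
    have hg4 : (g⁻¹ * y * g) ^ orderOf u = 1 := by
      rw [hu4, show 4 = 2 * 2 from rfl, pow_mul, pow_two, pow_two, hgz, hzz]
    have hf0 : ConjUpToInv g⁻¹ y u := by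
      have h1 := hZ u _ (hTc u huT _ hg) hg4
      obtain ⟨i, hi⟩ := Subgroup.mem_zpowers_iff.1 h1
      unfold ConjUpToInv
      rw [inv_inv, ← hi]
      have hmod : u ^ i = u ^ (i % 4) := by
        conv_lhs => rw [← Int.emod_add_mul_ediv i 4]
        rw [zpow_add, zpow_mul, show u ^ (4 : ℤ) = 1 by
          rw [show (4 : ℤ) = ((4 : ℕ) : ℤ) from rfl, zpow_natCast, ← hu4, pow_orderOf_eq_one]]
        simp
      have hsqi : u ^ i * u ^ i = z := by
        rw [hi, hgz]
      rw [hmod] at hsqi ⊢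
      have h3 : i % 4 = 0 ∨ i % 4 = 1 ∨ i % 4 = 2 ∨ i % 4 = 3 := by omega
      rcases h3 with h | h | h | h <;> rw [h] at hsqi ⊢
      · exact absurd hsqi.symm (by simpa using hz1)
      · left; simp
      · exfalso
        rw [← zpow_add, show (2 : ℤ) + 2 = ((4 : ℕ) : ℤ) from rfl, zpow_natCast, ← hu4,
          pow_orderOf_eq_one] at hsqi
        exact hz1 hsqi.symm
      · right
        rw [eq_inv_iff_mul_eq_one, ← zpow_add_one, show (3 : ℤ) + 1 = ((4 : ℕ) : ℤ) from rfl,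
          zpow_natCast, ← hu4, pow_orderOf_eq_one]
    set u₁ := g⁻¹ * u * g⁻¹⁻¹ with hu₁
    have huy : ConjUpToInv u y y := by
      right
      have h1 := hconj y hy hyT u huT
      have h2 : y⁻¹ = z * y := by
        rw [inv_eq_iff_mul_eq_one, ← mul_assoc, ← (hzc y).eq, mul_assoc, hsq y hy hyT, hzz]
      rw [h2]
      have h3 : y * u⁻¹ * y⁻¹ = u := by rw [mul_mul_inv_inv, h1, inv_inv]
      calc u * y * u⁻¹ = u * (y * u⁻¹ * y⁻¹) * y := by group
        _ = z * y := by rw [h3, huz]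
    have hu₁N : u₁ ∈ N := by
      rw [hNmem]
      exact (hf0.mul huy).mul hf0.symm
    have hp₁ : IsPGroup 2 (Subgroup.zpowers (⟨u₁, hu₁N⟩ : N)) := by
      refine IsPGroup.of_card (n := 2) ?_
      rw [Nat.card_zpowers, Subgroup.orderOf_mk, hu₁,
        show g⁻¹ * u * g⁻¹⁻¹ = MulAut.conj g⁻¹ u from rfl, MulEquiv.orderOf_eq, hu4]
      norm_num
    obtain ⟨S, hS⟩ := hp₁.exists_le_sylow
    obtain ⟨n, hn⟩ := MulAction.exists_smul_eq N (Q.subtype hQN) S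
    have h4 : (⟨u₁, hu₁N⟩ : N) ∈ n • (Q.subtype hQN) := by
      rw [hn]; exact hS (Subgroup.mem_zpowers _)
    have h5 : n⁻¹ * (⟨u₁, hu₁N⟩ : N) * n ∈ Q.subtype hQN := by
      have : (⟨u₁, hu₁N⟩ : N) ∈ ((n • (Q.subtype hQN) : Sylow 2 N) : Subgroup N) := h4
      rw [Sylow.coe_subgroup_smul, Subgroup.mem_pointwise_smul_iff_inv_smul_mem] at this
      have h7 : n⁻¹ * (⟨u₁, hu₁N⟩ : N) * n ∈ (Q : Subgroup R).subgroupOf N := by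
        simpa [MulAut.smul_def, MulAut.conj_inv_apply] using this
      exact h7
    have h6 : (n : R)⁻¹ * u₁ * n ∈ (Q : Subgroup R) := h5
    refine ⟨(n : R)⁻¹ * g⁻¹, ((hNmem n).1 n.2).symm.mul hf0, ?_⟩
    convert h6 using 1
    rw [hu₁]; group
  have hTalt : (∃ x ∈ T, x * x = u) ∨ ∀ t ∈ T, t = 1 ∨ t = u ∨ t = z ∨ t = u⁻¹ := by
    obtain ⟨x₀, hx₀⟩ := hcyc.exists_generator
    set x : R := x₀.1.1 with hx_def
    have hxT : x ∈ T := (hmemT x₀).2 x₀.2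
    have hgen : ∀ t ∈ T, ∃ i : ℤ, x ^ i = t := by
      intro t ht
      obtain ⟨i, hi⟩ := Subgroup.mem_zpowers_iff.1
        (hx₀ ⟨⟨t, hTQ ht⟩, (hmemT ⟨t, hTQ ht⟩).1 ht⟩)
      exact ⟨i, congrArg (fun t : T₀ => ((t : Q) : R)) hi⟩
    obtain ⟨i, hi⟩ := hgen u huT
    rcases Int.even_or_odd' i with ⟨j, rfl | rfl⟩
    · left
      refine ⟨x ^ j, T.zpow_mem hxT j, ?_⟩
      rw [← zpow_add, ← hi]; congr 1; ring
    · right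
      have hx4 : x ^ 4 = 1 := by
        by_contra h4
        have hPT : IsPGroup 2 T := Q.2.to_le hTQ
        obtain ⟨n, hn⟩ := (IsPGroup.iff_orderOf.1 hPT) ⟨x, hxT⟩
        rw [Subgroup.orderOf_mk] at hn
        have h5 : orderOf (x ^ (2 * j + 1)) = orderOf x := by
          have hcop : Nat.Coprime (orderOf x) (2 * j + 1).natAbs := by
            rw [hn]
            refine Nat.Coprime.pow_left _ ?_
            rw [Nat.coprime_two_left, Int.natAbs_odd]
            exact ⟨j, rfl⟩
          have : ∀ m : ℤ, orderOf (x ^ m) = orderOf (x ^ m.natAbs) := by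
            intro m
            rcases Int.natAbs_eq m with h | h
            · rw [h, zpow_natCast, Int.natAbs_natCast]
            · rw [h, zpow_neg, orderOf_inv, zpow_natCast, Int.natAbs_neg, Int.natAbs_natCast]
          rw [this, Nat.Coprime.orderOf_pow hcop]
        rw [hi, hu4] at h5
        exact h4 (by rw [h5, pow_orderOf_eq_one])
      intro t ht
      obtain ⟨k, rfl⟩ := hgen t ht
      have h6 : x ^ k ∈ Subgroup.zpowers u := by
        refine hZ u _ (hTc u huT _ (T.zpow_mem hxT k)) ?_
        rw [hu4, ← zpow_natCast, ← zpow_mul, mul_comm, zpow_mul, zpow_natCast, hx4, one_zpow]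
      obtain ⟨l, hl⟩ := Subgroup.mem_zpowers_iff.1 h6
      rw [← hl]
      have hu44 : u ^ ((4 : ℕ) : ℤ) = 1 := by rw [zpow_natCast, ← hu4, pow_orderOf_eq_one]
      have hmod : u ^ l = u ^ (l % 4) := by
        conv_lhs => rw [← Int.emod_add_mul_ediv l 4]
        rw [zpow_add, zpow_mul, show u ^ (4 : ℤ) = 1 from hu44]
        simp
      rw [hmod]
      have h3 : l % 4 = 0 ∨ l % 4 = 1 ∨ l % 4 = 2 ∨ l % 4 = 3 := by omega
      rcases h3 with h | h | h | h <;> rw [h]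
      · simp
      · simp
      · right; right; left; rw [← huz]; exact zpow_two u
      · right; right; right
        rw [eq_inv_iff_mul_eq_one, ← zpow_add_one, show (3 : ℤ) + 1 = ((4 : ℕ) : ℤ) from rfl, hu44]
  obtain ⟨f, hf⟩ := exists_three_dvd_orderOf (Q : Subgroup R) T hTQ huT huz hzz hz1 hconj hTc
    hidx' hsq hfus y₀.2 (fun h => hy₀ ((hmemT y₀).1 h)) hTalt
  obtain ⟨m, hm⟩ := hf
  exact ⟨f ^ m, by
    rw [orderOf_pow_of_dvd _ ⟨3, by rw [hm, mul_comm]⟩, hm]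
    · exact Nat.mul_div_cancel _ (by have := orderOf_pos f; rw [hm] at this; omega)
    · rintro rfl; have := orderOf_pos f; omega⟩

theorem three_orbits_arith {n f₁ f₂ f₃ e₁ e₂ e₃ : ℕ} (hn : 0 < n)
    (h₁ : f₁ * e₁ = n) (h₂ : f₂ * e₂ = n) (h₃ : f₃ * e₃ = n) (g₁ : 2 ≤ e₁) (h12 : e₁ ≤ e₂)
    (h23 : e₂ ≤ e₃) (hs : f₁ + f₂ + f₃ = n + 2) :
    (e₁ = 2 ∧ e₂ = 2 ∧ f₃ = 2) ∨ (e₁ = 2 ∧ e₂ = 3 ∧ (e₃ = 3 ∨ e₃ = 4 ∨ e₃ = 5)) := by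
  have a1 : f₁ * 2 ≤ n := by nlinarith
  have hf₁ : 0 < f₁ := Nat.pos_of_ne_zero (by rintro rfl; omega)
  have hf₂ : 0 < f₂ := Nat.pos_of_ne_zero (by rintro rfl; omega)
  have hf₃ : 0 < f₃ := Nat.pos_of_ne_zero (by rintro rfl; omega)
  have b1 : e₁ = 2 := by
    by_contra h
    have : 3 ≤ e₁ := by omega
    have : f₁ * 3 ≤ n := h₁ ▸ Nat.mul_le_mul_left _ (by omega)
    have : f₂ * 3 ≤ n := h₂ ▸ Nat.mul_le_mul_left _ (by omega)
    have : f₃ * 3 ≤ n := h₃ ▸ Nat.mul_le_mul_left _ (by omega)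
    omega
  subst b1
  have b2 : e₂ ≤ 3 := by
    by_contra h
    have : f₂ * 4 ≤ n := h₂ ▸ Nat.mul_le_mul_left _ (by omega)
    have : f₃ * 4 ≤ n := h₃ ▸ Nat.mul_le_mul_left _ (by omega)
    omega
  interval_cases e₂
  · left; omega
  · right
    refine ⟨rfl, rfl, ?_⟩
    have : e₃ ≤ 5 := by
      by_contra h
      have : f₃ * 6 ≤ n := h₃ ▸ Nat.mul_le_mul_left _ (by omega)
      omega
    omega

section FixedPointCount

open MulAction

variable {P X : Type*} [Group P] [MulAction P X]

theorem pow_card_stabilizer_of_smul_eq {g : P} {x : X} (h : g • x = x) :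
    g ^ Nat.card (stabilizer P x) = 1 := by
  have := pow_card_eq_one' (x := (⟨g, h⟩ : stabilizer P x))
  simpa [Subtype.ext_iff] using this

variable [Finite P] [Finite X]

/-- Orbit data of an action in which the only elements fixing everything are `1` and the
involution `z`, and every other element has exactly two fixed points. -/
theorem exists_orbit_data {z : P} (hz1 : z ≠ 1) (hz2 : z ^ 2 = 1) (hz : ∀ x : X, z • x = x)
    (hfix : ∀ g : P, g ≠ 1 → g ≠ z → Nat.card (fixedBy X g) = 2)
    (hstab : ∀ x : X, ∃ g : P, g ≠ 1 ∧ g ≠ z ∧ g • x = x) [Nonempty X] :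
    ∃ (n : ℕ) (e : orbitRel.Quotient P X → ℕ), 0 < n ∧ (∀ ω, 2 ≤ e ω) ∧
      (∀ ω, Nat.card ω.orbit * e ω = n) ∧
      (∀ x : X, Nat.card (stabilizer P x) = 2 * e (Quotient.mk'' x)) ∧
      Nat.card X + 2 * n = Nat.card (orbitRel.Quotient P X) * n + 2 := by
  classical
  have := Fintype.ofFinite P
  have := Fintype.ofFinite X
  have hstabcard : ∀ x : X, ∃ e, 2 ≤ e ∧ Nat.card (stabilizer P x) = 2 * e := by
    intro x
    have ho : orderOf (⟨z, hz x⟩ : stabilizer P x) = 2 := by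
      rw [← Subgroup.orderOf_coe]
      exact orderOf_eq_prime hz2 hz1
    have hdvd : 2 ∣ Nat.card (stabilizer P x) := ho ▸ orderOf_dvd_natCard _
    obtain ⟨e, he⟩ := hdvd
    refine ⟨e, ?_, he⟩
    by_contra hlt
    obtain ⟨g, hg1, hgz, hgx⟩ := hstab x
    have h3 : 3 ≤ Nat.card (stabilizer P x) := by
      rw [Nat.card_eq_fintype_card, ← Finset.card_univ]
      have : ({1, ⟨z, hz x⟩, ⟨g, hgx⟩} : Finset (stabilizer P x)).card = 3 := by
        rw [Finset.card_eq_three]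
        refine ⟨_, _, _, ?_, ?_, ?_, rfl⟩
        · simpa [Subtype.ext_iff] using hz1.symm
        · simpa [Subtype.ext_iff] using hg1.symm
        · simpa [Subtype.ext_iff] using hgz.symm
      rw [← this]
      exact Finset.card_le_univ _
    omega
  choose e he2 he using hstabcard
  have horb : ∀ x : X, Nat.card (orbit P x) * (2 * e x) = Nat.card P := by
    intro x
    rw [← he, Nat.card_eq_fintype_card, Nat.card_eq_fintype_card, Nat.card_eq_fintype_card,
      card_orbit_mul_card_stabilizer_eq_card_group]
  obtain ⟨x₀⟩ := ‹Nonempty X›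
  set n := Nat.card (orbit P x₀) * e x₀ with hn
  have hcard : Nat.card P = 2 * n := by rw [← horb x₀, hn]; ring
  have hPpos : 0 < Nat.card P := Nat.card_pos
  have hmul : ∀ x, Nat.card (orbit P x) * e x = n := by
    intro x
    have := horb x
    rw [hcard, mul_left_comm] at this
    omega
  have hpos : ∀ x : X, 0 < Nat.card (orbit P x) := fun x =>
    have : Nonempty (orbit P x) := ⟨⟨x, mem_orbit_self x⟩⟩
    Nat.card_pos
  refine ⟨n, fun ω => e ω.out, by omega, fun ω => he2 _, ?_, ?_, ?_⟩
  · intro ω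
    rw [orbitRel.Quotient.orbit_eq_orbit_out ω Quotient.out_eq']
    exact hmul _
  · intro x
    have h1 : orbit P (Quotient.mk'' x : orbitRel.Quotient P X).out = orbit P x := by
      rw [← orbitRel.Quotient.orbit_eq_orbit_out _ Quotient.out_eq']
      rfl
    have h2 := hmul x
    have h3 := hmul (Quotient.mk'' x : orbitRel.Quotient P X).out
    rw [h1] at h3
    rw [he x]
    congr 1
    exact Nat.eq_of_mul_eq_mul_left (hpos x) (h2.trans h3.symm)
  · have hB := sum_card_fixedBy_eq_card_orbits_mul_card_group P X
    have e1 : Fintype.card (fixedBy X (1 : P)) = Nat.card X := by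
      rw [Fintype.card_eq_nat_card, fixedBy_one_eq_univ]; simp
    have e2 : Fintype.card (fixedBy X z) = Nat.card X := by
      have : fixedBy X z = Set.univ := by ext x; simp [hz x]
      rw [Fintype.card_eq_nat_card, this]; simp
    rw [← Finset.add_sum_erase _ _ (Finset.mem_univ (1 : P)),
      ← Finset.add_sum_erase _ _ (Finset.mem_erase.2 ⟨hz1, Finset.mem_univ z⟩), e1, e2,
      Finset.sum_congr rfl (g := fun _ => 2), Finset.sum_const, Finset.card_erase_of_mem,
      Finset.card_erase_of_mem (Finset.mem_univ _), Finset.card_univ, ← Nat.card_eq_fintype_card,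
      ← Nat.card_eq_fintype_card, hcard] at hB
    · simp only [smul_eq_mul] at hB
      have : Nat.card (Quotient (orbitRel P X)) * (2 * n)
        = 2 * (Nat.card (orbitRel.Quotient P X) * n) := by
        rw [mul_left_comm]
      omega
    · exact Finset.mem_erase.2 ⟨hz1, Finset.mem_univ z⟩
    · intro g hg
      simp only [Finset.mem_erase, Finset.mem_univ, and_true] at hg
      rw [← Nat.card_eq_fintype_card]
      exact hfix g hg.2 hg.1

/-- The orbit count behind the classification of finite subgroups of `SL₂`. -/
theorem common_fixed_or_exponents {z : P} (hz1 : z ≠ 1) (hz2 : z ^ 2 = 1)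
    (hz : ∀ x : X, z • x = x)
    (hfix : ∀ g : P, g ≠ 1 → g ≠ z → Nat.card (fixedBy X g) = 2)
    (hstab : ∀ x : X, ∃ g : P, g ≠ 1 ∧ g ≠ z ∧ g • x = x)
    {D E : P} (hD1 : D ≠ 1) (hD3 : D ^ 3 = 1) (hE1 : E ≠ 1) (hE3 : E ^ 3 = 1) :
    (∃ x : X, D • x = x ∧ E • x = x) ∨
      ∃ c, (c = 3 ∨ c = 4 ∨ c = 5) ∧ ∀ g : P, g ^ (2 * 2) = 1 ∨ g ^ (2 * 3) = 1 ∨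
        g ^ (2 * c) = 1 := by
  classical
  have := Fintype.ofFinite X
  have hcube : ∀ {D : P}, D ^ 3 = 1 → D ≠ 1 → D ≠ z := by
    rintro _ h1 h2 rfl
    rw [pow_succ, hz2, one_mul] at h1
    exact h2 h1
  have hDz := hcube hD3 hD1
  have hEz := hcube hE3 hE1
  have hexfix : ∀ g : P, g ≠ 1 → g ≠ z → ∃ x : X, g • x = x := by
    intro g h1 h2
    have : 0 < Nat.card (fixedBy X g) := by rw [hfix g h1 h2]; norm_num
    obtain ⟨x, hx⟩ := (Nat.card_pos_iff.1 this).1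
    exact ⟨x, hx⟩
  obtain ⟨x₀, hx₀⟩ := hexfix D hD1 hDz
  have : Nonempty X := ⟨x₀⟩
  obtain ⟨n, e, hn, he2, hfe, hst, hcount⟩ := exists_orbit_data hz1 hz2 hz hfix hstab
  have := Fintype.ofFinite (orbitRel.Quotient P X)
  have hX : Nat.card X = ∑ ω : orbitRel.Quotient P X, Nat.card ω.orbit := by
    rw [Nat.card_congr (selfEquivSigmaOrbits' P X), Nat.card_sigma]
  have hX2 : 2 * Nat.card X ≤ Nat.card (orbitRel.Quotient P X) * n := by
    rw [hX, Finset.mul_sum, Nat.card_eq_fintype_card, ← Finset.card_univ, ← smul_eq_mul,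
      ← Finset.sum_const]
    refine Finset.sum_le_sum fun ω _ => ?_
    rw [← hfe ω, mul_comm]
    exact Nat.mul_le_mul_left _ (he2 ω)
  have hXpos : 0 < Nat.card X := Nat.card_pos
  have hfixle : ∀ {S : Set X}, Nat.card S = 2 → (∀ x, D • x = x → x ∈ S) →
      (∀ x, E • x = x → x ∈ S) → ∃ x : X, D • x = x ∧ E • x = x := by
    intro S hS h1 h2
    have : fixedBy X D = S := by
      refine Set.eq_of_subset_of_ncard_le (s := fixedBy X D) (fun x hx => h1 x hx) ?_
      rw [← Nat.card_coe_set_eq, ← Nat.card_coe_set_eq, hS, hfix D hD1 hDz]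
    obtain ⟨x, hx⟩ := hexfix E hE1 hEz
    have hxS := h2 x hx
    rw [← this] at hxS
    exact ⟨x, hxS, hx⟩
  have hm : Nat.card (orbitRel.Quotient P X) < 4 := by
    by_contra h
    have := Nat.mul_le_mul_right n (not_lt.1 h)
    omega
  have hn2 : 2 ≤ n := by
    have := hfe (Quotient.mk'' x₀)
    have := Nat.le_of_dvd hn (Dvd.intro_left _ this)
    have := he2 (Quotient.mk'' x₀)
    omega
  obtain h0 | h1 | h2 | h3 : Nat.card (orbitRel.Quotient P X) = 0 ∨
      Nat.card (orbitRel.Quotient P X) = 1 ∨ Nat.card (orbitRel.Quotient P X) = 2 ∨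
      Nat.card (orbitRel.Quotient P X) = 3 := by omega
  · rw [h0] at hcount; omega
  · rw [h1] at hcount; omega
  · left
    refine hfixle (S := Set.univ) ?_ (by simp) (by simp)
    rw [h2] at hcount
    simp only [Nat.card_univ]
    omega
  · have key : ∀ ω₁ ω₂ ω₃ : orbitRel.Quotient P X, (∀ ω, ω = ω₁ ∨ ω = ω₂ ∨ ω = ω₃) →
        Nat.card ω₁.orbit + Nat.card ω₂.orbit + Nat.card ω₃.orbit = n + 2 →
        e ω₁ ≤ e ω₂ → e ω₂ ≤ e ω₃ → (∃ x : X, D • x = x ∧ E • x = x) ∨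
      ∃ c, (c = 3 ∨ c = 4 ∨ c = 5) ∧ ∀ g : P, g ^ (2 * 2) = 1 ∨ g ^ (2 * 3) = 1 ∨
        g ^ (2 * c) = 1 := by
      intro ω₁ ω₂ ω₃ hω hs h12 h23
      rcases three_orbits_arith hn (hfe ω₁) (hfe ω₂) (hfe ω₃) (he2 _) h12 h23 hs with
        ⟨a1, a2, a3⟩ | ⟨a1, a2, a3⟩
      · left
        have hmem : ∀ {F : P}, F ≠ 1 → F ^ 3 = 1 → ∀ x : X, F • x = x → x ∈ ω₃.orbit := by
          intro F hF1 hF3 x hx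
          rw [orbitRel.Quotient.mem_orbit]
          have hp := pow_card_stabilizer_of_smul_eq hx
          rw [hst] at hp
          have hno : e (Quotient.mk'' x) ≠ 2 := by
            intro h
            rw [h, show 2 * 2 = 3 + 1 by norm_num, pow_succ, hF3, one_mul] at hp
            exact hF1 hp
          rcases hω (Quotient.mk'' x) with h | h | h
          · exact absurd (h ▸ a1) hno
          · exact absurd (h ▸ a2) hno
          · exact h
        exact hfixle a3 (hmem hD1 hD3) (hmem hE1 hE3)
      · right
        refine ⟨e ω₃, a3, fun g => ?_⟩
        by_cases hg1 : g = 1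
        · simp [hg1]
        by_cases hgz : g = z
        · left; rw [hgz, pow_mul, hz2, one_pow]
        obtain ⟨x, hx⟩ := hexfix g hg1 hgz
        have hp := pow_card_stabilizer_of_smul_eq hx
        rw [hst] at hp
        rcases hω (Quotient.mk'' x) with h | h | h
        · left; rwa [h, a1] at hp
        · right; left; rwa [h, a2] at hp
        · right; right; rwa [h] at hp
    have h3' : (Finset.univ : Finset (orbitRel.Quotient P X)).card = 3 := by
      rw [Finset.card_univ, ← Nat.card_eq_fintype_card, h3]
    obtain ⟨x, y, w, hxy, hxw, hyw, huniv⟩ := Finset.card_eq_three.1 h3'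
    have hall : ∀ ω : orbitRel.Quotient P X, ω = x ∨ ω = y ∨ ω = w := by
      intro ω
      have := Finset.mem_univ ω
      rw [huniv] at this
      simpa using this
    rw [huniv, Finset.sum_insert (by simp [hxy, hxw]), Finset.sum_insert (by simp [hyw]),
      Finset.sum_singleton] at hX
    rw [h3] at hcount
    rcases le_total (e x) (e y) with k1 | k1 <;> rcases le_total (e y) (e w) with k2 | k2 <;>
      rcases le_total (e x) (e w) with k3 | k3
    · exact key x y w (fun ω => by have := hall ω; tauto) (by omega) k1 k2
    · exact key x y w (fun ω => by have := hall ω; tauto) (by omega) k1 k2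
    · exact key x w y (fun ω => by have := hall ω; tauto) (by omega) k3 k2
    · exact key w x y (fun ω => by have := hall ω; tauto) (by omega) k3 k1
    · exact key y x w (fun ω => by have := hall ω; tauto) (by omega) k1 k3
    · exact key y w x (fun ω => by have := hall ω; tauto) (by omega) k2 k3
    · exact key w y x (fun ω => by have := hall ω; tauto) (by omega) k2 k1
    · exact key w y x (fun ω => by have := hall ω; tauto) (by omega) k2 k1

end FixedPointCount

section SpecialLinear

open Matrix Projectivization MulAction
open scoped LinearAlgebra.Projectivization MatrixGroups

variable {k : Type*} [Field k]

theorem Matrix.SpecialLinearGroup.mul_self_eq_trace (g : SL(2, k)) :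
    (g : Matrix (Fin 2) (Fin 2) k) * g = (g : Matrix (Fin 2) (Fin 2) k).trace • g.1 - 1 := by
  have hd : g.1 0 0 * g.1 1 1 - g.1 0 1 * g.1 1 0 = 1 := by
    rw [← Matrix.det_fin_two]; exact g.2
  ext i j
  fin_cases i <;> fin_cases j <;>
    simp [Matrix.mul_apply, Fin.sum_univ_two, Matrix.trace_fin_two] <;>
    first | ring1 | linear_combination -hd

theorem Matrix.SpecialLinearGroup.coe_inv_eq_trace_sub (g : SL(2, k)) :
    ((g⁻¹ : SL(2, k)) : Matrix (Fin 2) (Fin 2) k) =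
      (g : Matrix (Fin 2) (Fin 2) k).trace • 1 - g.1 := by
  rw [Matrix.SpecialLinearGroup.coe_inv]
  ext i j
  fin_cases i <;> fin_cases j <;> simp [Matrix.adjugate_fin_two, Matrix.trace_fin_two]

theorem Matrix.SpecialLinearGroup.smul_mk_eq_iff (g : SL(2, k)) {v : Fin 2 → k} (hv : v ≠ 0) :
    g • mk k v hv = mk k v hv ↔ ∃ c : k, g.1 *ᵥ v = c • v := by
  rw [smul_mk, mk_eq_mk_iff']
  exact ⟨fun ⟨c, hc⟩ => ⟨c, hc.symm⟩, fun ⟨c, hc⟩ => ⟨c, hc.symm⟩⟩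

theorem Matrix.SpecialLinearGroup.root_of_eigen (g : SL(2, k)) {v : Fin 2 → k} (hv : v ≠ 0)
    {c : k} (h : g.1 *ᵥ v = c • v) : c * c - g.1.trace * c + 1 = 0 := by
  have h1 : (g.1 * g.1) *ᵥ v = (c * c) • v := by
    rw [← Matrix.mulVec_mulVec, h, Matrix.mulVec_smul, h, smul_smul]
  rw [g.mul_self_eq_trace, Matrix.sub_mulVec, Matrix.smul_mulVec, h, smul_smul,
    Matrix.one_mulVec] at h1
  have h2 : (c * c - g.1.trace * c + 1) • v = 0 := by
    rw [add_smul, sub_smul, ← h1, one_smul]; abel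
  exact (smul_eq_zero.1 h2).resolve_right hv

theorem Matrix.SpecialLinearGroup.exists_eigen_of_root (g : SL(2, k)) {c : k}
    (h : c * c - g.1.trace * c + 1 = 0) : ∃ v : Fin 2 → k, v ≠ 0 ∧ g.1 *ᵥ v = c • v := by
  have hd : g.1 0 0 * g.1 1 1 - g.1 0 1 * g.1 1 0 = 1 := by
    rw [← Matrix.det_fin_two]; exact g.2
  have : (g.1 - c • 1).det = 0 := by
    rw [Matrix.det_fin_two]
    rw [Matrix.trace_fin_two] at h
    simp
    linear_combination h + hd
  obtain ⟨v, hv, h0⟩ := Matrix.exists_mulVec_eq_zero_iff.2 this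
  refine ⟨v, hv, ?_⟩
  rw [Matrix.sub_mulVec, Matrix.smul_mulVec, Matrix.one_mulVec, sub_eq_zero] at h0
  exact h0

theorem Matrix.SpecialLinearGroup.exists_smul_of_eigen (g : SL(2, k)) (h2 : g.1.trace ≠ 2)
    (h2' : g.1.trace ≠ -2) {v w : Fin 2 → k} (hv : v ≠ 0) {c : k}
    (h : g.1 *ᵥ v = c • v) (h' : g.1 *ᵥ w = c • w) : ∃ a : k, a • v = w := by
  have hd : g.1 0 0 * g.1 1 1 - g.1 0 1 * g.1 1 0 = 1 := by
    rw [← Matrix.det_fin_two]; exact g.2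
  have e0 := congrFun h 0
  have e1 := congrFun h 1
  have f0 := congrFun h' 0
  have f1 := congrFun h' 1
  simp [Matrix.mulVec, dotProduct, Fin.sum_univ_two] at e0 e1 f0 f1
  rw [Matrix.trace_fin_two] at h2 h2'
  have hdet : v 0 * w 1 - v 1 * w 0 = 0 := by
    by_contra hne
    have a1 : g.1 0 0 - c = 0 := by
      refine (mul_eq_zero.1 ?_).resolve_right hne
      linear_combination w 1 * e0 - v 1 * f0
    have a2 : g.1 0 1 = 0 := by
      refine (mul_eq_zero.1 ?_).resolve_right hne
      linear_combination -w 0 * e0 + v 0 * f0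
    have a3 : g.1 1 1 - c = 0 := by
      refine (mul_eq_zero.1 ?_).resolve_right hne
      linear_combination -w 0 * e1 + v 0 * f1
    have a4 : (c - 1) * (c + 1) = 0 := by
      linear_combination hd - g.1 1 1 * a1 - c * a3 + g.1 1 0 * a2
    rcases mul_eq_zero.1 a4 with h | h
    · exact h2 (by linear_combination a1 + a3 + 2 * h)
    · exact h2' (by linear_combination a1 + a3 + 2 * h)
  by_cases hv0 : v 0 = 0
  · have hv1 : v 1 ≠ 0 := fun h1 => hv (by ext i; fin_cases i <;> simp [hv0, h1])
    refine ⟨w 1 / v 1, ?_⟩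
    ext i
    fin_cases i
    · simp [hv0]
      rw [hv0, zero_mul, zero_sub, neg_eq_zero] at hdet
      exact ((mul_eq_zero.1 hdet).resolve_left hv1).symm
    · simp [hv1]
  · refine ⟨w 0 / v 0, ?_⟩
    ext i
    fin_cases i
    · simp [hv0]
    · simp
      field_simp
      linear_combination -hdet

theorem Matrix.SpecialLinearGroup.exists_fixed_pair [IsAlgClosed k] (hk : (2 : k) ≠ 0)
    (g : SL(2, k)) (h2 : g.1.trace ≠ 2) (h2' : g.1.trace ≠ -2) :
    ∃ x y : ℙ k (Fin 2 → k), x ≠ y ∧ ∀ w, g • w = w ↔ w = x ∨ w = y := by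
  obtain ⟨s, hs⟩ := IsAlgClosed.exists_eq_mul_self (g.1.trace ^ 2 - 4)
  set t := g.1.trace
  have hs0 : s ≠ 0 := by
    rintro rfl
    have : (t - 2) * (t + 2) = 0 := by linear_combination hs
    rcases mul_eq_zero.1 this with h | h
    · exact h2 (by linear_combination h)
    · exact h2' (by linear_combination h)
  have ha : ((t + s) / 2) * ((t + s) / 2) - t * ((t + s) / 2) + 1 = 0 := by
    field_simp; linear_combination -hs
  have hb : ((t - s) / 2) * ((t - s) / 2) - t * ((t - s) / 2) + 1 = 0 := by
    field_simp; linear_combination -hs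
  have hab : (t + s) / 2 ≠ (t - s) / 2 := by
    intro h
    field_simp at h
    exact hs0 ((mul_eq_zero.1 (by linear_combination h : (2 : k) * s = 0)).resolve_left hk)
  obtain ⟨v, hv, hgv⟩ := g.exists_eigen_of_root ha
  obtain ⟨w, hw, hgw⟩ := g.exists_eigen_of_root hb
  refine ⟨mk k v hv, mk k w hw, ?_, ?_⟩
  · rw [Ne, mk_eq_mk_iff']
    rintro ⟨c, rfl⟩
    rw [Matrix.mulVec_smul, hgw, smul_comm] at hgv
    rw [← sub_eq_zero, ← sub_smul, smul_eq_zero] at hgv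
    exact hab (sub_eq_zero.1 (hgv.resolve_right hv)).symm
  · intro x
    constructor
    · induction x using Projectivization.ind with
      | h u hu =>
        intro hx
        obtain ⟨c, hc⟩ := (g.smul_mk_eq_iff hu).1 hx
        have hr := g.root_of_eigen hu hc
        have : (c - (t + s) / 2) * (c - (t - s) / 2) = 0 := by
          rw [← hr]; field_simp; linear_combination hs
        rcases mul_eq_zero.1 this with h | h
        · left
          rw [sub_eq_zero.1 h] at hc
          rw [mk_eq_mk_iff']
          exact g.exists_smul_of_eigen h2 h2' hv hgv hc
        · right
          rw [sub_eq_zero.1 h] at hc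
          rw [mk_eq_mk_iff']
          exact g.exists_smul_of_eigen h2 h2' hw hgw hc
    · rintro (rfl | rfl)
      · exact (g.smul_mk_eq_iff hv).2 ⟨_, hgv⟩
      · exact (g.smul_mk_eq_iff hw).2 ⟨_, hgw⟩

theorem Matrix.SpecialLinearGroup.trace_commutator_of_common_fixed (g h : SL(2, k))
    {x : ℙ k (Fin 2 → k)} (hg : g • x = x) (hh : h • x = x) :
    (g * h * g⁻¹ * h⁻¹).1.trace = 2 := by
  have key : ∀ g' : SL(2, k), g' • x = x → ∃ c : k, g'.1 *ᵥ x.rep = c • x.rep := by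
    intro g' h'
    rw [← x.mk_rep] at h'
    exact (g'.smul_mk_eq_iff x.rep_nonzero).1 h'
  obtain ⟨a, ha⟩ := key g hg
  obtain ⟨b, hb⟩ := key h hh
  have hinv : ∀ (g' : SL(2, k)) {c : k}, g'.1 *ᵥ x.rep = c • x.rep →
      c ≠ 0 ∧ (g'⁻¹).1 *ᵥ x.rep = c⁻¹ • x.rep := by
    intro g' c hc
    have hc0 : c ≠ 0 := by
      rintro rfl
      have := g'.root_of_eigen x.rep_nonzero hc
      simp at this
    refine ⟨hc0, ?_⟩
    have h1 : (g'⁻¹).1 *ᵥ (g'.1 *ᵥ x.rep) = x.rep := by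
      rw [Matrix.mulVec_mulVec, ← Matrix.SpecialLinearGroup.coe_mul, inv_mul_cancel]; simp
    rw [hc, Matrix.mulVec_smul] at h1
    conv_rhs => rw [← h1]
    rw [smul_smul, inv_mul_cancel₀ hc0, one_smul]
  obtain ⟨ha0, ha'⟩ := hinv g ha
  obtain ⟨hb0, hb'⟩ := hinv h hb
  have h1 : (g * h * g⁻¹ * h⁻¹).1 *ᵥ x.rep = (1 : k) • x.rep := by
    rw [Matrix.SpecialLinearGroup.coe_mul, Matrix.SpecialLinearGroup.coe_mul,
      Matrix.SpecialLinearGroup.coe_mul, ← Matrix.mulVec_mulVec, ← Matrix.mulVec_mulVec,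
      ← Matrix.mulVec_mulVec, hb', Matrix.mulVec_smul, ha', smul_smul, Matrix.mulVec_smul, hb,
      smul_smul, Matrix.mulVec_smul, ha, smul_smul]
    congr 1
    field_simp
  have := Matrix.SpecialLinearGroup.root_of_eigen _ x.rep_nonzero h1
  linear_combination -this

/-- Two noncommuting elements of order three in a finite group of unimodular matrices without
nontrivial unipotent elements bound the exponents occurring in that group. -/
theorem Matrix.SpecialLinearGroup.exists_exponents [IsAlgClosed k] (hk : (2 : k) ≠ 0)
    (P : Subgroup SL(2, k)) [Finite P] (hneg : -1 ∈ P)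
    (htr : ∀ g ∈ P, g.1.trace = 2 → g = 1) {D E : SL(2, k)} (hD : D ∈ P) (hE : E ∈ P)
    (hD3 : D ^ 3 = 1) (hE3 : E ^ 3 = 1) (hDE : D * E ≠ E * D) :
    ∃ c, (c = 3 ∨ c = 4 ∨ c = 5) ∧ ∀ g ∈ P, g ^ (2 * 2) = 1 ∨ g ^ (2 * 3) = 1 ∨
        g ^ (2 * c) = 1 := by
  classical
  have htr' : ∀ g ∈ P, g.1.trace = -2 → g = -1 := by
    intro g hg h
    have := htr (g * -1) (P.mul_mem hg hneg) (by simp [h])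
    rw [mul_neg, mul_one] at this
    rw [← this, neg_neg]
  have hpair : ∀ g : P, g ≠ 1 → g ≠ ⟨-1, hneg⟩ →
      ∃ x y : ℙ k (Fin 2 → k), x ≠ y ∧ ∀ w, g • w = w ↔ w = x ∨ w = y := by
    intro g h1 h2
    exact Matrix.SpecialLinearGroup.exists_fixed_pair hk g.1
      (fun h => h1 (Subtype.ext (htr g g.2 h))) (fun h => h2 (Subtype.ext (htr' g g.2 h)))
  have hzcomm : ∀ g : P, g * ⟨-1, hneg⟩ * g⁻¹ = ⟨-1, hneg⟩ := by
    intro g; apply Subtype.ext; simp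
  let X : SubMulAction P (ℙ k (Fin 2 → k)) :=
    { carrier := {x | ∃ g : P, g ≠ 1 ∧ g ≠ ⟨-1, hneg⟩ ∧ g • x = x}
      smul_mem' := by
        rintro c x ⟨g, h1, h2, h3⟩
        refine ⟨c * g * c⁻¹, ?_, ?_, ?_⟩
        · simpa using h1
        · rw [← hzcomm c]; simpa using h2
        · rw [mul_smul, inv_smul_smul, mul_smul, h3] }
  have hXfin : Finite X := by
    have : (X : Set (ℙ k (Fin 2 → k))) ⊆
        ⋃ g ∈ {g : P | g ≠ 1 ∧ g ≠ ⟨-1, hneg⟩}, fixedBy (ℙ k (Fin 2 → k)) g := by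
      rintro x ⟨g, h1, h2, h3⟩
      simp only [Set.mem_iUnion]
      exact ⟨g, ⟨h1, h2⟩, h3⟩
    refine Set.Finite.subset (Set.Finite.biUnion (Set.toFinite _) ?_) this
    rintro g ⟨h1, h2⟩
    obtain ⟨x, y, -, h⟩ := hpair g h1 h2
    refine Set.Finite.subset (Set.toFinite {x, y}) fun w hw => ?_
    simpa using (h w).1 hw
  have hfix : ∀ g : P, g ≠ 1 → g ≠ ⟨-1, hneg⟩ → Nat.card (fixedBy X g) = 2 := by
    intro g h1 h2
    obtain ⟨x, y, hxy, h⟩ := hpair g h1 h2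
    have hx : g • x = x := (h x).2 (Or.inl rfl)
    have hy : g • y = y := (h y).2 (Or.inr rfl)
    have : fixedBy X g = {⟨x, g, h1, h2, hx⟩, ⟨y, g, h1, h2, hy⟩} := by
      ext w
      rw [mem_fixedBy, Subtype.ext_iff, SubMulAction.val_smul, h]
      simp [Subtype.ext_iff]
    rw [this, Nat.card_coe_set_eq, Set.ncard_pair (by simpa [Subtype.ext_iff] using hxy)]
  have hnegne : (⟨-1, hneg⟩ : P) ≠ 1 := by
    intro h
    have h1 := congrArg (fun g : P => g.1.1 0 0) h
    simp at h1
    exact hk (by linear_combination -h1)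
  have hDE1 : D ≠ 1 := by rintro rfl; simp at hDE
  have hED1 : E ≠ 1 := by rintro rfl; simp at hDE
  rcases common_fixed_or_exponents (P := P) (X := X) (z := ⟨-1, hneg⟩) hnegne
    (Subtype.ext (by simp)) (by
      intro x
      apply Subtype.ext
      rw [SubMulAction.val_smul]
      have := (Matrix.SpecialLinearGroup.smul_mk_eq_iff (-1 : SL(2, k)) x.1.rep_nonzero).2
        ⟨-1, by ext i; fin_cases i <;> simp⟩
      rwa [mk_rep] at this) hfix
    (fun x => by
      obtain ⟨g, h1, h2, h3⟩ := x.2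
      exact ⟨g, h1, h2, Subtype.ext h3⟩) (D := ⟨D, hD⟩) (E := ⟨E, hE⟩)
    (by simpa [Subtype.ext_iff] using hDE1) (Subtype.ext hD3)
    (by simpa [Subtype.ext_iff] using hED1) (Subtype.ext hE3) with ⟨x, h1, h2⟩ | ⟨c, hc, h⟩
  · exfalso
    have := htr _ (P.mul_mem (P.mul_mem (P.mul_mem hD hE) (P.inv_mem hD)) (P.inv_mem hE))
      (Matrix.SpecialLinearGroup.trace_commutator_of_common_fixed D E
        (congrArg Subtype.val h1) (congrArg Subtype.val h2))
    apply hDE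
    rw [mul_inv_eq_one, mul_inv_eq_iff_eq_mul] at this
    exact this
  · exact ⟨c, hc, fun g hg => by simpa [Subtype.ext_iff] using h ⟨g, hg⟩⟩

end SpecialLinear

section SpecialLinearTrace

open Matrix
open scoped MatrixGroups

variable {k : Type*} [Field k]

theorem Matrix.SpecialLinearGroup.coe_pow_add_two (g : SL(2, k)) (n : ℕ) :
    (g ^ (n + 2)).1 = g.1.trace • (g ^ (n + 1)).1 - (g ^ n).1 := by
  rw [pow_add, pow_two, Matrix.SpecialLinearGroup.coe_mul, Matrix.SpecialLinearGroup.coe_mul,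
    g.mul_self_eq_trace, mul_sub, mul_one, Matrix.mul_smul, pow_succ,
    Matrix.SpecialLinearGroup.coe_mul]

theorem Matrix.SpecialLinearGroup.trace_pow_add_two (g : SL(2, k)) (n : ℕ) :
    (g ^ (n + 2)).1.trace = g.1.trace * (g ^ (n + 1)).1.trace - (g ^ n).1.trace := by
  rw [g.coe_pow_add_two, Matrix.trace_sub, Matrix.trace_smul, smul_eq_mul]

/-- The possible traces of an element of given even exponent. -/
theorem Matrix.SpecialLinearGroup.trace_of_pow_eq_one (g : SL(2, k)) (h2 : g.1.trace ≠ 2)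
    (h2' : g.1.trace ≠ -2) {e : ℕ} (he : e = 2 ∨ e = 3 ∨ e = 4 ∨ e = 5) (hg : g ^ (2 * e) = 1) :
    let t := g.1.trace
    t = 0 ∨ (e = 3 ∧ (t = 1 ∨ t = -1)) ∨ (e = 4 ∧ t ^ 2 = 2) ∨
      (e = 5 ∧ (t ^ 2 + t = 1 ∨ t ^ 2 - t = 1)) := by
  intro t
  have hpow : (g ^ e).1.trace = 2 ∨ (g ^ e).1.trace = -2 := by
    have h1 := congrArg Matrix.trace (g ^ e).mul_self_eq_trace
    have h3 : (g ^ e).1 * (g ^ e).1 = 1 := by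
      rw [← Matrix.SpecialLinearGroup.coe_mul, ← pow_add, ← two_mul, hg,
        Matrix.SpecialLinearGroup.coe_one]
    rw [h3, Matrix.trace_sub, Matrix.trace_smul, Matrix.trace_one, smul_eq_mul] at h1
    simp at h1
    have : ((g ^ e).1.trace - 2) * ((g ^ e).1.trace + 2) = 0 := by
      have : (g.1 ^ e).trace = (g ^ e).1.trace := by rw [Matrix.SpecialLinearGroup.coe_pow]
      rw [this] at h1
      linear_combination -h1
    rcases mul_eq_zero.1 this with h | h
    · left; linear_combination h
    · right; linear_combination h
  have t0 : (g ^ 0).1.trace = 2 := by simp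
  have t1 : (g ^ 1).1.trace = t := by simp [t]
  have t2 : (g ^ 2).1.trace = t ^ 2 - 2 := by
    rw [g.trace_pow_add_two, t0, t1]; ring
  have t3 : (g ^ 3).1.trace = t ^ 3 - 3 * t := by
    rw [g.trace_pow_add_two, t2, t1]; ring
  have t4 : (g ^ 4).1.trace = t ^ 4 - 4 * t ^ 2 + 2 := by
    rw [g.trace_pow_add_two, t3, t2]; ring
  have t5 : (g ^ 5).1.trace = t ^ 5 - 5 * t ^ 3 + 5 * t := by
    rw [g.trace_pow_add_two, t4, t3]; ring
  have n2 : t - 2 ≠ 0 := sub_ne_zero.2 h2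
  have n2' : t + 2 ≠ 0 := fun h => h2' (by linear_combination h)
  have sq : ∀ {x : k}, x ^ 2 = 0 → x = 0 := fun h => pow_eq_zero_iff (two_ne_zero) |>.1 h
  rcases he with rfl | rfl | rfl | rfl
  · left
    rw [t2] at hpow
    rcases hpow with h | h
    · have : (t - 2) * (t + 2) = 0 := by linear_combination h
      simp [n2, n2'] at this
    · exact sq (by linear_combination h)
  · right; left
    refine ⟨rfl, ?_⟩
    rw [t3] at hpow
    rcases hpow with h | h
    · have : (t - 2) * (t + 1) ^ 2 = 0 := by linear_combination h
      right
      linear_combination sq ((mul_eq_zero.1 this).resolve_left n2)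
    · have : (t + 2) * (t - 1) ^ 2 = 0 := by linear_combination h
      left
      linear_combination sq ((mul_eq_zero.1 this).resolve_left n2')
  · rw [t4] at hpow
    rcases hpow with h | h
    · have : (t - 2) * ((t + 2) * t ^ 2) = 0 := by linear_combination h
      left
      exact sq ((mul_eq_zero.1 ((mul_eq_zero.1 this).resolve_left n2)).resolve_left n2')
    · right; right; left
      refine ⟨rfl, ?_⟩
      have : (t ^ 2 - 2) ^ 2 = 0 := by linear_combination h
      linear_combination sq this
  · right; right; right
    refine ⟨rfl, ?_⟩
    rw [t5] at hpow
    rcases hpow with h | h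
    · have : (t - 2) * (t ^ 2 + t - 1) ^ 2 = 0 := by linear_combination h
      left
      linear_combination sq ((mul_eq_zero.1 this).resolve_left n2)
    · have : (t + 2) * (t ^ 2 - t - 1) ^ 2 = 0 := by linear_combination h
      right
      linear_combination sq ((mul_eq_zero.1 this).resolve_left n2')

theorem Matrix.SpecialLinearGroup.trace_eq_neg_one_of_pow_three (g : SL(2, k))
    (h2 : g.1.trace ≠ 2) (hg : g ^ 3 = 1) : g.1.trace = -1 := by
  have h3 := g.trace_pow_add_two 1
  have h4 := g.trace_pow_add_two 0
  rw [show 1 + 2 = 3 from rfl, hg] at h3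
  simp at h3 h4
  rw [h4] at h3
  set t := g.1.trace with ht
  have h5 : (t - 2) * (t + 1) ^ 2 = 0 := by linear_combination -h3
  have := pow_eq_zero_iff (two_ne_zero) |>.1 ((mul_eq_zero.1 h5).resolve_left (sub_ne_zero.2 h2))
  linear_combination this

theorem Matrix.SpecialLinearGroup.trace_mul_inv (g h : SL(2, k)) :
    (g * h⁻¹).1.trace = g.1.trace * h.1.trace - (g * h).1.trace := by
  rw [Matrix.SpecialLinearGroup.coe_mul, h.coe_inv_eq_trace_sub, mul_sub, Matrix.mul_smul,
    mul_one, Matrix.trace_sub, Matrix.trace_smul, smul_eq_mul,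
    Matrix.SpecialLinearGroup.coe_mul]
  ring

theorem Matrix.SpecialLinearGroup.trace_commutator (g h : SL(2, k)) :
    (g * h * g⁻¹ * h⁻¹).1.trace = g.1.trace ^ 2 + h.1.trace ^ 2 + (g * h).1.trace ^ 2 -
      g.1.trace * h.1.trace * (g * h).1.trace - 2 := by
  have hg : g.1 0 0 * g.1 1 1 - g.1 0 1 * g.1 1 0 = 1 := by
    rw [← Matrix.det_fin_two]; exact g.2
  have hh : h.1 0 0 * h.1 1 1 - h.1 0 1 * h.1 1 0 = 1 := by
    rw [← Matrix.det_fin_two]; exact h.2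
  simp only [Matrix.SpecialLinearGroup.coe_mul, Matrix.SpecialLinearGroup.coe_inv,
    Matrix.adjugate_fin_two, Matrix.trace_fin_two, Matrix.mul_apply, Fin.sum_univ_two]
  simp
  generalize g.1 0 0 = a at *
  generalize g.1 0 1 = b at *
  generalize g.1 1 0 = c at *
  generalize g.1 1 1 = d at *
  generalize h.1 0 0 = x at *
  generalize h.1 0 1 = y at *
  generalize h.1 1 0 = z at *
  generalize h.1 1 1 = w at *
  linear_combination ((x + w) ^ 2 - 2 * (x * w - y * z)) * hg + ((a + d) ^ 2 - 2) * hh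

/-- The products of two noncommuting elements of order three in a finite group of unimodular
matrices that contains `-1` and no nontrivial unipotent element. -/
theorem Matrix.SpecialLinearGroup.mul_pow_eq_neg_one [IsAlgClosed k] (hk : (2 : k) ≠ 0)
    (hk3 : (3 : k) ≠ 0) (P : Subgroup SL(2, k)) [Finite P] (hneg : -1 ∈ P)
    (htr : ∀ g ∈ P, g.1.trace = 2 → g = 1) {D E : SL(2, k)} (hD : D ∈ P) (hE : E ∈ P)
    (hD3 : D ^ 3 = 1) (hE3 : E ^ 3 = 1) (hDE : D * E ≠ E * D) :
    (D * E) ^ 2 = -1 ∨ (D * E) ^ 3 = -1 ∨ (D * E) ^ 5 = -1 := by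
  have htr' : ∀ g ∈ P, g.1.trace = -2 → g = -1 := by
    intro g hg h
    have := htr (g * -1) (P.mul_mem hg hneg) (by simp [h])
    rw [mul_neg, mul_one] at this
    rw [← this, neg_neg]
  obtain ⟨c, hc, hexp⟩ :=
    Matrix.SpecialLinearGroup.exists_exponents hk P hneg htr hD hE hD3 hE3 hDE
  have tD : D.1.trace = -1 := D.trace_eq_neg_one_of_pow_three
    (fun h => hDE (by rw [htr D hD h]; simp)) hD3
  have tE : E.1.trace = -1 := E.trace_eq_neg_one_of_pow_three
    (fun h => hDE (by rw [htr E hE h]; simp)) hE3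
  have tDE' := Matrix.SpecialLinearGroup.trace_mul_inv D E
  have tC := Matrix.SpecialLinearGroup.trace_commutator D E
  set τ := (D * E).1.trace with hτ
  rw [tD, tE] at tDE' tC
  have key : ∀ g ∈ P, g ≠ 1 → g ≠ -1 → let t := g.1.trace
      t ≠ 2 ∧ (t = 0 ∨ t = 1 ∨ t = -1 ∨ (c = 4 ∧ t ^ 2 = 2) ∨
        (c = 5 ∧ (t ^ 2 + t = 1 ∨ t ^ 2 - t = 1))) := by
    intro g hg h1 h1'
    have n2 : g.1.trace ≠ 2 := fun h => h1 (htr g hg h)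
    have n2' : g.1.trace ≠ -2 := fun h => h1' (htr' g hg h)
    refine ⟨n2, ?_⟩
    rcases hexp g hg with h | h | h
    · rcases g.trace_of_pow_eq_one n2 n2' (e := 2) (by norm_num) h with h | h | h | h
      · exact Or.inl h
      · omega
      · omega
      · omega
    · rcases g.trace_of_pow_eq_one n2 n2' (e := 3) (by norm_num) h with h | ⟨-, h | h⟩ | h | h
      · exact Or.inl h
      · exact Or.inr (Or.inl h)
      · exact Or.inr (Or.inr (Or.inl h))
      · omega
      · omega
    · rcases g.trace_of_pow_eq_one n2 n2' (e := c) (by omega) h with h | ⟨-, h | h⟩ | h | h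
      · exact Or.inl h
      · exact Or.inr (Or.inl h)
      · exact Or.inr (Or.inr (Or.inl h))
      · exact Or.inr (Or.inr (Or.inr (Or.inl h)))
      · exact Or.inr (Or.inr (Or.inr (Or.inr h)))
  have k1 := key (D * E) (P.mul_mem hD hE)
    (fun h => hDE (by rw [h, mul_eq_one_iff_eq_inv.1 h, mul_inv_cancel])) (fun h => hDE (by
      rw [h]
      have : E = -D⁻¹ := by
        rw [eq_comm, ← mul_neg_one, ← h]; simp
      rw [this]; simp))
  have k2 := key (D * E⁻¹) (P.mul_mem hD (P.inv_mem hE))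
    (fun h => hDE (by rw [mul_inv_eq_one.1 h])) (fun h => hDE (by
      have : D = -E := by
        rw [← neg_one_mul, ← h]; simp
      rw [this]; simp))
  have k3 := key (D * E * D⁻¹ * E⁻¹)
    (P.mul_mem (P.mul_mem (P.mul_mem hD hE) (P.inv_mem hD)) (P.inv_mem hE))
    (fun h => hDE (by rwa [mul_inv_eq_one, mul_inv_eq_iff_eq_mul] at h)) (fun h => by
      have h1 : D * E * D⁻¹ = -E := by
        rw [← neg_one_mul, ← h]; simp
      have h2 := congrArg (fun x : SL(2, k) => x.1.trace) h1
      simp only [Matrix.SpecialLinearGroup.coe_mul, Matrix.SpecialLinearGroup.coe_neg,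
        Matrix.trace_neg, tE] at h2
      rw [Matrix.trace_mul_comm, ← Matrix.mul_assoc, ← Matrix.SpecialLinearGroup.coe_mul,
        inv_mul_cancel, Matrix.SpecialLinearGroup.coe_one, one_mul, tE] at h2
      exact hk (by linear_combination -h2))
  simp only [← hτ, tDE', tC] at k1 k2 k3
  have hconc : τ = 0 ∨ τ = 1 ∨ τ ^ 2 - τ = 1 := by
    obtain ⟨n1, k1⟩ := k1
    obtain ⟨n2, k2⟩ := k2
    obtain ⟨n3, k3⟩ := k3
    rcases k1 with h | h | h | ⟨h4, h⟩ | ⟨h5, h | h⟩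
    · exact Or.inl h
    · exact Or.inr (Or.inl h)
    · exact absurd (by rw [h]; norm_num) n2
    · rcases k2 with i | i | i | ⟨-, i⟩ | ⟨h5, -⟩
      · right; left; linear_combination -i
      · left; linear_combination -i
      · exact absurd (by linear_combination -i) n1
      · exfalso
        have e1 : 2 * τ = 1 := by linear_combination h - i
        have e7 : (7 : k) = 0 := by linear_combination -4 * h + (2 * τ + 1) * e1
        rcases k3 with j | j | j | ⟨-, j⟩ | ⟨h5, -⟩
        · exact hk3 (by linear_combination 2 * j + e1 - 2 * h)
        · exact one_ne_zero (α := k) (by linear_combination 2 * j + e1 - 2 * h)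
        · exact one_ne_zero (α := k)
            (by linear_combination 3 * e7 - 4 * (2 * j + e1 - 2 * h))
        · have e2 : 2 * (τ ^ 2 - τ) = 3 := by linear_combination 2 * h - e1
          exact one_ne_zero (α := k)
            (by linear_combination 4 * j - (2 * (τ ^ 2 - τ) + 3) * e2)
        · omega
      · omega
    · rcases k2 with i | i | i | ⟨h4, -⟩ | ⟨-, i | i⟩
      · right; left; linear_combination -i
      · left; linear_combination -i
      · exact absurd (by linear_combination -i) n1
      · omega
      · exfalso
        have e1 : 2 * (2 * τ - 1) = 0 := by linear_combination h - i
        have e2 := (mul_eq_zero.1 e1).resolve_left hk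
        exact one_ne_zero (α := k) (by linear_combination -4 * h + (2 * τ + 3) * e2)
      · right; right; linear_combination i
    · exact Or.inr (Or.inr h)
  have r2 := (D * E).coe_pow_add_two 0
  have r3 := (D * E).coe_pow_add_two 1
  have r4 := (D * E).coe_pow_add_two 2
  have r5 := (D * E).coe_pow_add_two 3
  rw [← hτ] at r2 r3 r4 r5
  simp only [zero_add, one_add_one_eq_two, pow_zero, pow_one, Nat.reduceAdd] at r2 r3 r4 r5
  rw [Matrix.SpecialLinearGroup.coe_one] at r2
  rcases hconc with h | h | h
  · left
    apply Subtype.ext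
    rw [r2, h]; simp
  · right; left
    apply Subtype.ext
    rw [r3, r2, h]; simp
  · right; right
    apply Subtype.ext
    rw [r5, r4, r3, r2, Matrix.SpecialLinearGroup.coe_neg, Matrix.SpecialLinearGroup.coe_one]
    have h4 : τ ^ 4 - 3 * τ ^ 2 + 1 = 0 := by linear_combination (τ ^ 2 + τ - 1) * h
    have h3 : τ ^ 3 - 2 * τ = 1 := by linear_combination (τ + 1) * h
    trans (τ ^ 4 - 3 * τ ^ 2 + 1) • (D * E).1 - (τ ^ 3 - 2 * τ) • 1
    · module
    · rw [h4, h3, zero_smul, one_smul, zero_sub]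

end SpecialLinearTrace

namespace FixedPointFreeRep

open Matrix
open scoped MatrixGroups

variable {k V H : Type*} [Field k] [AddCommGroup V] [Module k V] [Group H]
  {ρ : H →* Module.End k V}

theorem two_ne_zero [Nontrivial V] (hρ : FixedPointFreeRep ρ) {z : H} (hz : orderOf z = 2) :
    (2 : k) ≠ 0 := by
  intro h
  have h1 : (-1 : k) = 1 := by linear_combination -h
  obtain ⟨v, hv⟩ := exists_ne (0 : V)
  have hzne : z ≠ 1 := by rintro rfl; simp at hz
  refine hv (hρ z hzne v ?_)
  rw [hρ.map_involution hz, LinearMap.neg_apply, Module.End.one_apply, ← neg_one_smul k, h1,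
    one_smul]

theorem sq_add_self_add_one (hρ : FixedPointFreeRep ρ) {a : H} (ha : orderOf a = 3) :
    ρ a * ρ a + ρ a + 1 = 0 := by
  have hane : a ≠ 1 := by rintro rfl; simp at ha
  have h3 : ρ a * ρ a * ρ a = 1 := by
    have ha3 : a ^ 3 = 1 := by rw [← ha, pow_orderOf_eq_one]
    rw [← map_mul, ← map_mul, ← pow_two, ← pow_succ, ha3, map_one]
  ext v
  refine hρ a hane _ ?_
  rw [← Module.End.mul_apply]
  congr 1
  rw [mul_add, mul_add, ← mul_assoc, h3, mul_one]
  abel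

theorem three_ne_zero [Nontrivial V] [IsAlgClosed k] [FiniteDimensional k V]
    (hρ : FixedPointFreeRep ρ) {a : H} (ha : orderOf a = 3) : (3 : k) ≠ 0 := by
  intro h
  have hane : a ≠ 1 := by rintro rfl; simp at ha
  obtain ⟨c, -, v, hv, hc, -⟩ := exists_common_eigenvector (Commute.refl (ρ a))
  have h1 := LinearMap.congr_fun (hρ.sq_add_self_add_one ha) v
  simp only [LinearMap.add_apply, Module.End.mul_apply, hc, map_smul, Module.End.one_apply,
    LinearMap.zero_apply] at h1
  have h2 : (c * c + c + 1) • v = 0 := by rw [← h1]; module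
  have h3 : (c - 1) ^ 2 = 0 := by
    linear_combination (smul_eq_zero.1 h2).resolve_right hv - c * h
  have h4 : c = 1 := by linear_combination pow_eq_zero_iff (_root_.two_ne_zero) |>.1 h3
  exact hv (hρ a hane v (by rw [hc, h4, one_smul]))

variable [IsAlgClosed k] [FiniteDimensional k V] [Nontrivial V] [Finite H]

/-- The product of two noncommuting elements of order three in a group with a fixed-point-free
representation has order `4`, `6` or `10`. -/
theorem mul_pow_eq_involution_of_not_commute (hρ : FixedPointFreeRep ρ) {z : H}
    (hz : orderOf z = 2) {d e : H} (hd : orderOf d = 3) (he : orderOf e = 3)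
    (hde : ¬ Commute d e) : (d * e) ^ 2 = z ∨ (d * e) ^ 3 = z ∨ (d * e) ^ 5 = z := by
  have hk2 := hρ.two_ne_zero hz
  have hk3 := hρ.three_ne_zero hd
  have dd := hρ.sq_add_self_add_one hd
  have ee := hρ.sq_add_self_add_one he
  have hd2 : ρ d * ρ d = -1 - ρ d := by linear_combination (norm := noncomm_ring) dd
  set O : Module.End k V := ρ d * ρ e + ρ e * ρ d + ρ d + ρ e + 1 with hO
  have hOe : Commute O (ρ e) := by
    change O * ρ e = ρ e * O
    rw [hO]
    linear_combination (norm := noncomm_ring) ρ d * ee - ee * ρ d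
  obtain ⟨s, l, v, hv, hOv, hev⟩ := exists_common_eigenvector hOe
  have hl : l * l + l + 1 = 0 := by
    have h1 := LinearMap.congr_fun ee v
    simp only [LinearMap.add_apply, Module.End.mul_apply, hev, map_smul, Module.End.one_apply,
      LinearMap.zero_apply] at h1
    have h2 : (l * l + l + 1) • v = 0 := by rw [← h1]; module
    exact (smul_eq_zero.1 h2).resolve_right hv
  set w := ρ d v with hw
  have hdw : ρ d w = -v - w := by
    rw [hw, ← Module.End.mul_apply, hd2]; simp
  have hew : ρ e w = (s - l - 1) • v + (-1 - l) • w := by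
    simp only [hO, LinearMap.add_apply, Module.End.mul_apply, hev, map_smul,
      Module.End.one_apply, ← hw] at hOv
    rw [sub_smul, sub_smul, ← hOv]
    module
  have hdetE : !![l, s - l - 1; 0, -1 - l].det = 1 := by
    rw [Matrix.det_fin_two_of]; linear_combination -hl
  have hdetD : !![(0 : k), -1; 1, -1].det = 1 := by
    rw [Matrix.det_fin_two_of]; norm_num
  let D : SL(2, k) := ⟨_, hdetD⟩
  let E : SL(2, k) := ⟨_, hdetE⟩
  let ι : (Fin 2 → k) →ₗ[k] V :=
    (LinearMap.proj 0).smulRight v + (LinearMap.proj 1).smulRight w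
  have hι : ∀ x, ι x = x 0 • v + x 1 • w := fun x => rfl
  have hιinj : ∀ x, ι x = 0 → x = 0 := by
    intro x hx
    rw [hι] at hx
    have hx1 : x 1 = 0 := by
      by_contra hne
      have hwv : w = (-(x 1)⁻¹ * x 0) • v := by
        have h1 : x 1 • w = -(x 0 • v) := by rw [← sub_eq_zero, ← hx]; abel
        rw [← one_smul k w, ← inv_mul_cancel₀ hne, mul_smul, h1]
        module
      apply hde
      refine hρ.eq_of_apply_eq hv ?_
      rw [map_mul, map_mul, Module.End.mul_apply, Module.End.mul_apply, hev, map_smul, ← hw, hwv,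
        map_smul, hev, smul_comm]
    rw [hx1, zero_smul, add_zero] at hx
    ext i
    fin_cases i
    · exact (smul_eq_zero.1 hx).resolve_right hv
    · exact hx1
  have hιinj' : ∀ x y, ι x = ι y → x = y := fun x y h =>
    sub_eq_zero.1 (hιinj _ (by rw [map_sub, h, sub_self]))
  let P₀ : Subgroup (H × SL(2, k)) :=
    { carrier := {p | ∀ x, ρ p.1 (ι x) = ι (p.2.1 *ᵥ x)}
      mul_mem' := by
        intro p q hp hq x
        simp only [Prod.fst_mul, Prod.snd_mul, map_mul, Module.End.mul_apply,
          Matrix.SpecialLinearGroup.coe_mul]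
        rw [hq, hp, Matrix.mulVec_mulVec]
      one_mem' := by intro x; simp
      inv_mem' := by
        intro p hp x
        have h1 := hp ((p.2⁻¹).1 *ᵥ x)
        rw [Matrix.mulVec_mulVec, ← Matrix.SpecialLinearGroup.coe_mul, mul_inv_cancel,
          Matrix.SpecialLinearGroup.coe_one, Matrix.one_mulVec] at h1
        simp only [Prod.fst_inv, Prod.snd_inv]
        rw [← h1, ← Module.End.mul_apply, ← map_mul, inv_mul_cancel, map_one,
          Module.End.one_apply] }
  have hmem : ∀ p : H × SL(2, k), p ∈ P₀ ↔ ∀ x, ρ p.1 (ι x) = ι (p.2.1 *ᵥ x) := fun _ => Iff.rfl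
  have hone : ∀ M : SL(2, k), ((1 : H), M) ∈ P₀ → M = 1 := by
    intro M hM
    apply Subtype.ext
    rw [Matrix.SpecialLinearGroup.coe_one]
    refine Matrix.ext_of_mulVec_single fun i => hιinj' _ _ ?_
    rw [← (hmem _).1 hM]
    simp only [map_one, Module.End.one_apply, Matrix.one_mulVec]
  have hone' : ∀ g : H, (g, (1 : SL(2, k))) ∈ P₀ → g = 1 := by
    intro g hg
    refine hρ.eq_of_apply_eq hv ?_
    have := (hmem _).1 hg ![1, 0]
    simpa [hι] using this
  have hzP : (z, (-1 : SL(2, k))) ∈ P₀ := by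
    rw [hmem]
    intro x
    simp [hρ.map_involution hz, Matrix.neg_mulVec]
  have hdP : (d, D) ∈ P₀ := by
    rw [hmem]
    intro x
    simp only [hι, map_add, map_smul, ← hw, hdw, D, Matrix.mulVec, dotProduct, Fin.sum_univ_two]
    simp
    module
  have heP : (e, E) ∈ P₀ := by
    rw [hmem]
    intro x
    simp only [hι, map_add, map_smul, hev, hew, E, Matrix.mulVec, dotProduct, Fin.sum_univ_two]
    simp
    module
  have hfin : Finite P₀ := by
    refine Finite.of_injective (fun p : P₀ => p.1.1) ?_
    intro p q hpq
    have h1 := P₀.mul_mem p.2 (P₀.inv_mem q.2)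
    have h2 : p.1 * q.1⁻¹ = (1, p.1.2 * q.1.2⁻¹) := by
      ext1
      · simp only [Prod.fst_mul, Prod.fst_inv]
        exact mul_inv_eq_one.2 hpq
      · rfl
    rw [h2] at h1
    exact Subtype.ext (Prod.ext hpq (mul_inv_eq_one.1 (hone _ h1)))
  let P : Subgroup SL(2, k) := P₀.map (MonoidHom.snd H SL(2, k))
  have hPfin : Finite P :=
    Finite.of_surjective _ (MonoidHom.subgroupMap_surjective (MonoidHom.snd H SL(2, k)) P₀)
  have hPmem : ∀ {g M}, (g, M) ∈ P₀ → M ∈ P := fun {g M} h => ⟨(g, M), h, rfl⟩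
  have htr : ∀ M ∈ P, M.1.trace = 2 → M = 1 := by
    rintro _ ⟨⟨g, M⟩, hgM, rfl⟩ ht
    obtain ⟨x, hx, hMx⟩ := M.exists_eigen_of_root (c := 1) (by
      change M.1.trace = 2 at ht
      rw [ht]; norm_num)
    have hg : g = 1 := by
      refine hρ.eq_of_apply_eq (v := ι x) (fun h => hx (hιinj x h)) ?_
      rw [(hmem _).1 hgM]
      simp only
      rw [hMx]; simp
    subst hg
    exact hone M hgM
  have hcube : ∀ {g M}, orderOf g = 3 → (g, M) ∈ P₀ → M ^ 3 = 1 := by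
    intro g M hg h
    apply hone
    have := P₀.pow_mem h 3
    rwa [Prod.pow_mk, ← hg, pow_orderOf_eq_one, hg] at this
  have hDE : D * E ≠ E * D := by
    intro h
    apply hde
    have h1 := P₀.mul_mem (P₀.mul_mem hdP heP) (P₀.inv_mem (P₀.mul_mem heP hdP))
    rw [Prod.mk_mul_mk, Prod.mk_mul_mk, Prod.inv_mk, Prod.mk_mul_mk, h, mul_inv_cancel] at h1
    exact mul_inv_eq_one.1 (hone' _ h1)
  have hconc : ∀ n, (D * E) ^ n = -1 → (d * e) ^ n = z := by
    intro n hn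
    have h1 : ((d * e) ^ n * z⁻¹, (D * E) ^ n * (-1)⁻¹) ∈ P₀ :=
      P₀.mul_mem (P₀.pow_mem (P₀.mul_mem hdP heP) n) (P₀.inv_mem hzP)
    rw [hn, mul_inv_cancel] at h1
    exact mul_inv_eq_one.1 (hone' _ h1)
  exact (Matrix.SpecialLinearGroup.mul_pow_eq_neg_one hk2 hk3 P (hPmem hzP) htr (hPmem hdP)
    (hPmem heP) (hcube hd hdP) (hcube he heP) hDE).imp (hconc 2) (Or.imp (hconc 3) (hconc 5))

/-- The possible products of two elements of order three. -/
theorem mul_pow_eq_involution (hρ : FixedPointFreeRep ρ) {z : H} (hz : orderOf z = 2) {a b : H}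
    (ha : orderOf a = 3) (hb : orderOf b = 3) :
    b = a ∨ b = a⁻¹ ∨ (a * b) ^ 2 = z ∨ (a * b) ^ 3 = z ∨ (a * b) ^ 5 = z := by
  classical
  by_cases hc : Commute a b
  · have hmem := hρ.mem_zpowers_of_commute hc (by rw [ha, ← hb, pow_orderOf_eq_one])
    rw [mem_zpowers_iff_mem_range_orderOf, ha] at hmem
    have ha3 : a ^ 3 = 1 := by rw [← ha, pow_orderOf_eq_one]
    simp [Finset.range_add_one] at hmem
    rcases hmem with h | h | h
    · right; left
      rw [h, eq_inv_iff_mul_eq_one, ← pow_succ, ha3]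
    · exact Or.inl h
    · rw [h] at hb; simp at hb
  · exact Or.inr (Or.inr (hρ.mul_pow_eq_involution_of_not_commute hz ha hb hc))

end FixedPointFreeRep

/-- Twice the real part of `a * b` when `a` and `b` are cube roots of unity in a quaternion
algebra. -/
def cubeTau {E : Type*} [Ring E] (a b : E) : E := a * b + b * a + a + b + 1

/-- The conjugate `a * c * a⁻¹` when `a * a + a + 1 = 0`. -/
def cubeRot {E : Type*} [Ring E] (a c : E) : E := a * c * (-1 - a)

section CubeRoots

variable {E : Type*} [Ring E] {a b c d e : E}

theorem cubeTau_comm (a b : E) : cubeTau a b = cubeTau b a := by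
  unfold cubeTau; abel

theorem cubeTau_self (ha : a * a + a + 1 = 0) : cubeTau a a = -1 := by
  unfold cubeTau
  linear_combination (norm := (noncomm_ring; try norm_num)) 2 * ha

theorem cubeTau_neg_one_sub (a b : E) : cubeTau a (-1 - b) = 1 - cubeTau a b := by
  unfold cubeTau; noncomm_ring

theorem cubeTau_rot_rot (ha : a * a + a + 1 = 0) (b c : E) :
    cubeTau (cubeRot a b) (cubeRot a c) = a * cubeTau b c * (-1 - a) := by
  unfold cubeTau cubeRot
  linear_combination (norm := (noncomm_ring; try norm_num)) a * b * ha * c * a + a * c * ha * b *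
    a + a * b * ha * c + a * c * ha * b + ha

theorem cubeRot_three (ha : a * a + a + 1 = 0) (c : E) :
    cubeRot a (cubeRot a (cubeRot a c)) = c := by
  unfold cubeRot
  linear_combination (norm := (noncomm_ring; try norm_num)) - ha * a * c * a * a * a - 3 * ha * a
    * c * a * a + ha * c * a * a * a - 3 * ha * a * c * a +
    3 * ha * c * a * a - ha * a * c + 3 * ha * c * a - c * ha * a + ha * c - 2 * c * ha

theorem cubeRot_eq (ha : a * a + a + 1 = 0) (hac : cubeTau a c = 0) : cubeRot a c = -1 - c - a * c
:= by
  unfold cubeTau at hac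
  unfold cubeRot
  linear_combination (norm := (noncomm_ring; try norm_num)) - a * hac + ha * c + ha

theorem cubeRot_cubeRot_eq (ha : a * a + a + 1 = 0) (hac : cubeTau a c = 0) :
    cubeRot a (cubeRot a c) = a + a * c := by
  rw [cubeRot_eq ha hac]
  unfold cubeTau at hac
  unfold cubeRot
  linear_combination (norm := (noncomm_ring; try norm_num)) ha * c * a + ha * c + ha - hac

theorem cubeTau_rot (ha : a * a + a + 1 = 0) (hac : cubeTau a c = 0) : cubeTau a (cubeRot a c) = 0
:= by
  rw [cubeRot_eq ha hac]
  unfold cubeTau at *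
  linear_combination (norm := (noncomm_ring; try norm_num)) - a * hac + ha - hac

theorem cubeRot_sq (ha : a * a + a + 1 = 0) (hc : c * c + c + 1 = 0) :
    cubeRot a c * cubeRot a c + cubeRot a c + 1 = 0 := by
  unfold cubeRot
  linear_combination (norm := (noncomm_ring; try norm_num)) a * c * ha * c * a + a * c * ha * c -
    a * hc * a - a * hc + ha

theorem cubeTau_rot_self (ha : a * a + a + 1 = 0) (hc : c * c + c + 1 = 0) (hac : cubeTau a c = 0) :
    cubeTau c (cubeRot a c) = 1 := by
  rw [cubeRot_eq ha hac]
  unfold cubeTau at *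
  linear_combination (norm := (noncomm_ring; try norm_num)) - hac * c - hc

theorem cubeTau_sum (ha : a * a + a + 1 = 0) (hab : cubeTau a b = 0) (hac : cubeTau a c = 0) :
    cubeTau b c + cubeTau b (cubeRot a c) + cubeTau b (cubeRot a (cubeRot a c)) = 1 := by
  rw [cubeRot_cubeRot_eq ha hac, cubeRot_eq ha hac]
  unfold cubeTau at *
  linear_combination (norm := (noncomm_ring; try norm_num)) hab

theorem eq_zero_of_anticommute (h2 : ∀ x : E, 2 * x = 0 → x = 0) (ha : a * a + a + 1 = 0)
    (hc : c * c + c + 1 = 0) (hac : cubeTau a c = 0) {X : E} (xa : X * a + a * X + X = 0)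
    (xc : X * c + c * X + X = 0)
    (xr : X * cubeRot a c + cubeRot a c * X + X = 0) : X = 0 := by
  rw [cubeRot_eq ha hac] at xr
  unfold cubeTau at hac
  apply h2
  linear_combination (norm := (noncomm_ring; try norm_num)) xr * (2 * a * c + a + c + 1) - (- 2 *
    X * a * hac * c + 2 * X * ha * c * c - 2 * a * xc * a *
    c + 2 * a * X * hac * c - 2 * a * X * a * hc + 2 * X * ha * c - X * a * hac - X * a * hc + xa
    * a * c - a * X * hc - a * xc * a + a * X * hac - a * xc * c - 2 * xc * a * c - X * ha - 2 * X
    * hc + 2 * xa * a - a * xc - xc * a - xc * c + xa - xc)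

theorem anticommute_of_tau (x b c d : E) :
    (2 * b - c - d) * x + x * (2 * b - c - d) + (2 * b - c - d)
      = 2 * cubeTau x b - cubeTau x c - cubeTau x d := by
  unfold cubeTau; noncomm_ring

theorem anticommute_of_tau_three (x a b : E) :
    (3 * b - a + 1) * x + x * (3 * b - a + 1) + (3 * b - a + 1)
      = 3 * cubeTau x b - cubeTau x a - 1 := by
  unfold cubeTau; noncomm_ring

theorem not_tau_zero_zero (h2 : ∀ x : E, 2 * x = 0 → x = 0) [Nontrivial E]
    (ha : a * a + a + 1 = 0) (hb : b * b + b + 1 = 0)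
    (hc : c * c + c + 1 = 0) (hab : cubeTau a b = 0) (hac : cubeTau a c = 0)
    (hbc : cubeTau b c = 0) (hbr : cubeTau b (cubeRot a c) = 0) : False := by
  have hX : 2 * b - c - cubeRot a c = 0 := by
    refine eq_zero_of_anticommute h2 ha hc hac ?_ ?_ ?_
    · rw [anticommute_of_tau, hab, hac, cubeTau_rot ha hac]; noncomm_ring
    · rw [anticommute_of_tau, cubeTau_comm c b, hbc, cubeTau_self hc,
        cubeTau_rot_self ha hc hac]; noncomm_ring
    · rw [anticommute_of_tau, cubeTau_comm _ b, hbr, cubeTau_comm _ c,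
        cubeTau_rot_self ha hc hac, cubeTau_self (cubeRot_sq ha hc)]; noncomm_ring
  have h := anticommute_of_tau b b c (cubeRot a c)
  rw [hX, cubeTau_self hb, hbc, hbr] at h
  refine one_ne_zero (h2 (1 : E) ?_)
  linear_combination (norm := (noncomm_ring; try norm_num)) h

theorem not_tau_all_golden (h2 : ∀ x : E, 2 * x = 0 → x = 0) [Nontrivial E]
    (ha : a * a + a + 1 = 0) (hb : b * b + b + 1 = 0)
    (hc : c * c + c + 1 = 0) (hab : cubeTau a b = 0) (hac : cubeTau a c = 0) {s t : E}
    (hbc : cubeTau b c = s) (hbr : cubeTau b (cubeRot a c) = t) (hs : s * s = s + 1)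
    (ht : t * t = t + 1)
    (hrr : cubeTau b (cubeRot a (cubeRot a c)) * cubeTau b (cubeRot a (cubeRot a c)) =
      cubeTau b (cubeRot a (cubeRot a c)) + 1) : False := by
  have hsum : cubeTau b (cubeRot a (cubeRot a c)) = 1 - s - t := by
    rw [← hbc, ← hbr, ← cubeTau_sum ha hab hac]; abel
  rw [hsum] at hrr
  have hst : s * t + t * s + 1 = 0 := by
    linear_combination (norm := (noncomm_ring; try norm_num)) hrr - hs - ht
  have hcomm : s * t - t * s = 0 := by
    linear_combination (norm := (noncomm_ring; try norm_num)) s * hst - hst * s - hs * t + t * hs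
  have h1 : s = 1 - 2 * t := by
    linear_combination (norm := (noncomm_ring; try norm_num)) s * hst - 2 * hs * t - hst + s *
      hcomm - hcomm
  have h2' : t = 1 - 2 * s := by
    linear_combination (norm := (noncomm_ring; try norm_num)) t * hst - 2 * ht * s - hst - t *
      hcomm + hcomm
  have hX : 3 * b - a + 1 = 0 := by
    refine eq_zero_of_anticommute h2 ha hc hac ?_ ?_ ?_
    · rw [anticommute_of_tau_three, hab, cubeTau_self ha]; noncomm_ring
    · rw [anticommute_of_tau_three, cubeTau_comm c b, cubeTau_comm c a, hbc, hac]
      linear_combination (norm := (noncomm_ring; try norm_num)) -h1 + 2 * h2'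
    · rw [anticommute_of_tau_three, cubeTau_comm _ b, cubeTau_comm _ a, hbr, cubeTau_rot ha hac]
      linear_combination (norm := (noncomm_ring; try norm_num)) -h2' + 2 * h1
  have h := anticommute_of_tau_three b a b
  rw [hX, cubeTau_self hb, cubeTau_comm b a, hab] at h
  refine one_ne_zero (h2 (1 : E) (h2 _ ?_))
  linear_combination (norm := (noncomm_ring; try norm_num)) h

theorem cube_sub_eq (hc : c * c + c + 1 = 0) (hbc : cubeTau b c = 0) :
    (-1 - c) * b * (-1 - c) = b - c := by
  unfold cubeTau at hbc
  linear_combination (norm := (noncomm_ring; try norm_num)) hbc * c - b * hc + hbc - hc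

theorem cube_sub_sq (hb : b * b + b + 1 = 0) (hc : c * c + c + 1 = 0) (hbc : cubeTau b c = 0) :
    (b - c) * (b - c) = -1 := by
  unfold cubeTau at hbc
  linear_combination (norm := (noncomm_ring; try norm_num)) hb - hbc + hc

theorem cube_sub_mul_sub_sq (hb : b * b + b + 1 = 0) (hc : c * c + c + 1 = 0)
    (hd : d * d + d + 1 = 0) (hbc : cubeTau b c = 0) (hbd : cubeTau b d = 0)
    (hcd : cubeTau c d = 0) :
    -((b - c) * (c - d)) * -((b - c) * (c - d)) + -((b - c) * (c - d)) + 1 = 0 := by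
  have h1 := cube_sub_sq hb hc hbc
  have h2 := cube_sub_sq hc hd hcd
  have h3 : (b - c) * (c - d) + (c - d) * (b - c) = 1 := by
    unfold cubeTau at *
    linear_combination (norm := (noncomm_ring; try norm_num)) hbc - 2 * hc - hbd + hcd
  set p := b - c
  set q := c - d
  linear_combination (norm := (noncomm_ring; try norm_num)) p * h3 * q - h1 * q * q + h2

theorem not_four_adjacent (h2 : ∀ x : E, 2 * x = 0 → x = 0) (h3 : ∀ x : E, 3 * x = 0 → x = 0)
    [Nontrivial E] (ha : a * a + a + 1 = 0) (hb : b * b + b + 1 = 0) (hc : c * c + c + 1 = 0)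
    (hd : d * d + d + 1 = 0) (hab : cubeTau a b = 0) (hac : cubeTau a c = 0)
    (had : cubeTau a d = 0) (hbc : cubeTau b c = 0) (hbd : cubeTau b d = 0)
    (hcd : cubeTau c d = 0)
    (hT : -((b - c) * (c - d)) = a ∨ -((b - c) * (c - d)) = -1 - a ∨
      cubeTau a (-((b - c) * (c - d))) = 0 ∨ cubeTau a (-((b - c) * (c - d))) = 1 ∨
      cubeTau a (-((b - c) * (c - d))) * cubeTau a (-((b - c) * (c - d))) =
        cubeTau a (-((b - c) * (c - d))) + 1) : False := by
  have hv := cube_sub_mul_sub_sq hb hc hd hbc hbd hcd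
  unfold cubeTau at hab hac had hbc hbd hcd
  have hcomm : -((b - c) * (c - d)) * a - a * -((b - c) * (c - d)) = 0 := by
    linear_combination (norm := (noncomm_ring; try norm_num)) - a * hc - b * hac + hab * c + b *
      had - hab * d + hc * a - c * had + hac * d
  have hs : -((b - c) * (c - d)) * (b + c + d) - (b + c + d) * -((b - c) * (c - d)) = 0 := by
    linear_combination (norm := (noncomm_ring; try norm_num)) 2 * hb * c - 2 * hb * d - b * hbc -
      3 * b * hc + b * hbd + 2 * b * hd + hbc * c + hc * b + 3
      * hc * d - c * hbd - c * hcd - 2 * c * hd + hbd * c - hbd * d - d * hc + hcd * d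
  set v := -((b - c) * (c - d)) with hvdef
  have hsa : a * (b + c + d) - (b + c + d) * a = 0 := by
    have hτ : cubeTau a v * cubeTau a v - cubeTau a v - 2 = 0 := by
      unfold cubeTau
      linear_combination (norm := (noncomm_ring; try norm_num)) a * hcomm * v + ha * v * v + 2 * a
        * hv * a + v * ha * v + hcomm * v * a + ha * v + v * ha
        + hcomm * v + a * hv + hv * a - ha - hv
    rcases hT with h | h | h | h | h
    · rw [← h]; exact hs
    · have h' : a = -1 - v := by rw [h]; abel
      rw [h']
      linear_combination (norm := (noncomm_ring; try norm_num)) -hs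
    · rw [h] at hτ
      exact absurd (h2 (-1) (by linear_combination (norm := (noncomm_ring; try norm_num)) hτ)) (by
      simp)
    · rw [h] at hτ
      exact absurd (h2 (-1) (by linear_combination (norm := (noncomm_ring; try norm_num)) hτ)) (by
      simp)
    · rw [h] at hτ
      exact absurd (by linear_combination (norm := (noncomm_ring; try norm_num)) -hτ) (one_ne_zero
      (α := E))
  have hsum : b + c + d = a - 1 := by
    have h6 : 3 * (2 * (b + c + d - (a - 1))) = 0 := by
      linear_combination (norm := (noncomm_ring; try norm_num)) -2 * (2 * a + 1) * (hab + hac +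
        had) + (4 * ha * (b + c + d) + 4 * hsa * a + 4 * (b + c +
        d) * ha + 12 * ha + 2 * hsa)
    exact sub_eq_zero.1 (h2 _ (h3 _ h6))
  have h8 : (2 : E) * 1 = 0 := by
    linear_combination (norm := (noncomm_ring; try norm_num)) 2 * hb + hbc + hbd - hab - (b * hsum
      + hsum * b + hsum)
  exact one_ne_zero (h2 _ h8)

theorem cubeTau_commute (ha : a * c + c * a + a + c + 1 = 0)
    (hd : a * d + d * a + a + d + 1 = 0) : a * cubeTau c d - cubeTau c d * a = 0 := by
  unfold cubeTau
  linear_combination (norm := (noncomm_ring; try norm_num)) - c * hd + ha * d - d * ha + hd * c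

theorem cubeTau_commute_left (hc : c * c + c + 1 = 0) (d : E) :
    c * cubeTau c d - cubeTau c d * c = 0 := by
  unfold cubeTau
  linear_combination (norm := (noncomm_ring; try norm_num)) hc * d - d * hc

theorem not_golden_adjacent (h2 : ∀ x : E, 2 * x = 0 → x = 0)
    [Nontrivial E] (ha : a * a + a + 1 = 0) (hb : b * b + b + 1 = 0) (hc : c * c + c + 1 = 0)
    (hd : d * d + d + 1 = 0) (hab : cubeTau a b = 0) (hac : cubeTau a c = 0)
    (had : cubeTau a d = 0) (hbc : cubeTau b c = 0) (hbd : cubeTau b d = 0)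
    (htt : cubeTau c d * cubeTau c d = cubeTau c d + 1)
    (hcr : cubeTau c (cubeRot a d) = 0) : False := by
  rw [cubeRot_eq ha had] at hcr
  have cta := cubeTau_commute hac had
  have ctb := cubeTau_commute hbc hbd
  have ctc := cubeTau_commute_left hc d
  have ctd := cubeTau_commute_left hd c
  rw [cubeTau_comm d c] at ctd
  obtain ⟨t, hcd⟩ : ∃ t, cubeTau c d = t := ⟨_, rfl⟩
  rw [hcd] at htt cta ctb ctc ctd
  unfold cubeTau at hab hac had hbc hbd hcd hcr
  obtain ⟨X, hX⟩ : ∃ X, X = (5 - 3 * t) * b - (1 - t) * a - c - d + 1 - t := ⟨_, rfl⟩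
  have xa : X * a + a * X + X = 0 := by
    rw [hX]
    linear_combination (norm := (noncomm_ring; try norm_num)) cta * a - 3 * cta * b + 2 * t * ha -
      3 * t * hab - 2 * ha - cta + 5 * hab - hac - had
  have xc : X * c + c * X + X = 0 := by
    rw [hX]
    linear_combination (norm := (noncomm_ring; try norm_num)) ctc * a - 3 * ctc * b + t * hac - 3
      * t * hbc - hac + 5 * hbc - 2 * hc - ctc - hcd
  have xd : X * d + d * X + X = 0 := by
    rw [hX]
    linear_combination (norm := (noncomm_ring; try norm_num)) ctd * a - 3 * ctd * b + t * had - 3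
      * t * hbd - had + 5 * hbd - hcd - 2 * hd - ctd
  have xt : X * t - t * X = 0 := by
    rw [hX]
    linear_combination (norm := (noncomm_ring; try norm_num)) t * cta - 3 * t * ctb - cta + 5 *
      ctb - ctc - ctd
  have hX0 : X = 0 := by
    linear_combination (norm := (noncomm_ring; try norm_num)) - (X * hcr + hcr * X) * t - (X * a *
      hcd * t - 2 * X * a * c * ctd - 2 * X * a * ctc * d + X
      * hac * d * t + a * hcd * X * t - 2 * a * c * xd * t + 2 * a * c * X * ctd + 2 * a * xc * t
      * d - 2 * a * X * ctc * d - 2 * xa * t * c * d + hac * d * X * t - X * a * ctc - X * a * ctd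
      + X * cta * t + X * hcd * t - X * c * ctd - 2 * X * ctc * d + X * t * cta + X * htt * a - xa
      * t * d + a * xc * t - a * X * ctc - xa * t * c - a * xd * t + a * X * ctd + cta * X * t +
      hcd * X * t - c * xd * t + c * X * ctd + xc * t * d + t * xa * t - t * X * cta - t * xt * a
      - htt * X * a + X * htt - xa * t + xt * a + xc * t - X * ctc - xd * t)
  have h4 : 2 * (2 * t - 3) = 0 := by
    have h5 : X * b + b * X + X = 0 := by rw [hX0]; simp
    rw [hX] at h5
    linear_combination (norm := (noncomm_ring; try norm_num)) h5 - (ctb * a - 3 * ctb * b + t *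
      hab - 6 * t * hb - hab + 10 * hb - ctb - hbc - hbd)
  have h6 := h2 _ h4
  refine one_ne_zero (α := E) ?_
  linear_combination (norm := (noncomm_ring; try norm_num)) h6 * (2 * t - 3) + 4 * h6 - 4 * htt

theorem cubeRot_of_sq (a : E) (he : e * e + e + 1 = 0) :
    cubeRot e a = e - cubeTau a e + a * e - cubeTau a e * e := by
  obtain ⟨t, hae⟩ : ∃ t, cubeTau a e = t := ⟨_, rfl⟩
  rw [hae]
  unfold cubeTau at hae
  unfold cubeRot
  linear_combination (norm := (noncomm_ring; try norm_num)) - hae * e + a * he - hae + he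

theorem cubeRot_cubeRot_of_sq (ha : a * a + a + 1 = 0) (he : e * e + e + 1 = 0) :
    cubeRot e (cubeRot e a) = -1 - a - a * e - cubeTau a e * e := by
  rw [cubeRot_of_sq a he]
  have cta := cubeTau_commute_left ha e
  have cte := cubeTau_commute_left he a
  rw [cubeTau_comm e a] at cte
  obtain ⟨t, hae⟩ : ∃ t, cubeTau a e = t := ⟨_, rfl⟩
  rw [hae] at cta cte
  rw [hae]
  unfold cubeTau at hae
  unfold cubeRot
  linear_combination (norm := (noncomm_ring; try norm_num)) - e * a * he + e * t * he - he * e +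
    cte * e + t * he + hae

theorem golden_triangle (ha : a * a + a + 1 = 0) (he : e * e + e + 1 = 0)
    (htt : cubeTau a e * cubeTau a e = cubeTau a e + 1) :
    cubeTau a (cubeRot e a) = 0 ∧ cubeTau a (cubeRot e (cubeRot e a)) = 0 ∧
      cubeTau (cubeRot e a) (cubeRot e (cubeRot e a)) = 0 := by
  rw [cubeRot_cubeRot_of_sq ha he, cubeRot_of_sq a he]
  have cta := cubeTau_commute_left ha e
  have cte := cubeTau_commute_left he a
  rw [cubeTau_comm e a] at cte
  obtain ⟨t, hae⟩ : ∃ t, cubeTau a e = t := ⟨_, rfl⟩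
  rw [hae] at cta cte htt
  rw [hae]
  unfold cubeTau at *
  refine ⟨?_, ?_, ?_⟩
  · linear_combination (norm := (noncomm_ring; try norm_num)) a * hae - cta * e - t * hae - ha +
    hae - htt
  · linear_combination (norm := (noncomm_ring; try norm_num)) - a * hae - cta * e - t * hae - ha -
    cta - htt
  · linear_combination (norm := (noncomm_ring; try norm_num)) - 2 * a * hae * e + 2 * ha * e * e +
    2 * t * cte * e + 2 * t * t * he + 2 * ha * e - a * hae
      + a * cte - hae * e - cte * e + t * hae - 2 * t * he + t * cte + ha - hae - he - htt

/-- A golden neighbour of `a` is determined by the triangle it spans with `a`. -/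
theorem golden_eq_of_triangle (ha : a * a + a + 1 = 0) (he : e * e + e + 1 = 0)
    (htt : cubeTau a e * cubeTau a e = cubeTau a e + 1) :
    -((2 * a + 1) * ((2 + (2 * a + 1) * (2 * cubeRot e a + 1 + (2 * cubeRot e (cubeRot e a) + 1)))
      * (2 * cubeRot e a + 1 - (2 * cubeRot e (cubeRot e a) + 1))
      + 4 * (2 * cubeRot e a + 1 - (2 * cubeRot e (cubeRot e a) + 1)))) = 24 * e + 12 := by
  rw [cubeRot_cubeRot_of_sq ha he, cubeRot_of_sq a he]
  have cta := cubeTau_commute_left ha e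
  have cte := cubeTau_commute_left he a
  rw [cubeTau_comm e a] at cte
  obtain ⟨t, hae⟩ : ∃ t, cubeTau a e = t := ⟨_, rfl⟩
  rw [hae] at cta cte htt
  rw [hae]
  unfold cubeTau at *
  linear_combination (norm := (noncomm_ring; try norm_num)) 64 * ha * t * e * a * e + 32 * ha * a
    * a * e - 32 * ha * e * a * e + 32 * ha * t * a * e + 32
    * ha * t * e * a + 32 * ha * t * e * e - 32 * ha * t * e * t + 16 * ha * a * a + 16 * ha * a *
    e - 16 * ha * a * t - 16 * ha * e * a - 16 * ha * e * e + 16 * ha * e * t + 16 * ha * t * a +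
    48 * ha * t * e - 16 * ha * t * t - 48 * t * hae * e + 48 * t * a * he + 16 * ha * a - 88 * ha
    * e + 16 * ha * t + 24 * hae * e - 24 * a * he - 24 * t * hae + 24 * t * he + 24 * t * cte -
    24 * htt * e - 36 * ha + 36 * cta + 12 * hae - 12 * he - 12 * cte - 12 * htt

end CubeRoots

/-- The elements of order three of a finite group acting without fixed points, viewed inside the
endomorphism ring. -/
structure IsCubeConfig {E : Type*} [Ring E] (T : Set E) : Prop where
  two_cancel : ∀ x : E, 2 * x = 0 → x = 0
  three_cancel : ∀ x : E, 3 * x = 0 → x = 0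
  sq : ∀ a ∈ T, a * a + a + 1 = 0
  inv_mem : ∀ a ∈ T, -1 - a ∈ T
  rot_mem : ∀ a ∈ T, ∀ c ∈ T, cubeRot a c ∈ T
  sub_mul_sub_mem : ∀ b ∈ T, ∀ c ∈ T, ∀ d ∈ T, cubeTau b c = 0 → cubeTau b d = 0 →
    cubeTau c d = 0 → -((b - c) * (c - d)) ∈ T
  tau_cases : ∀ a ∈ T, ∀ b ∈ T, b = a ∨ b = -1 - a ∨ cubeTau a b = 0 ∨ cubeTau a b = 1 ∨
    cubeTau a b * cubeTau a b = cubeTau a b + 1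

/-- The orbit of `c` under conjugation by `a`. -/
def cubeOrbit {E : Type*} [Ring E] (a c : E) : Set E := {c, cubeRot a c, cubeRot a (cubeRot a c)}

theorem mem_cubeOrbit {E : Type*} [Ring E] {a c x : E} :
    x ∈ cubeOrbit a c ↔ x = c ∨ x = cubeRot a c ∨ x = cubeRot a (cubeRot a c) := Iff.rfl

theorem ncard_cubeOrbit_le {E : Type*} [Ring E] (a c : E) : (cubeOrbit a c).ncard ≤ 3 := by
  unfold cubeOrbit
  refine (Set.ncard_insert_le _ _).trans ?_
  have := Set.ncard_insert_le (cubeRot a c) {cubeRot a (cubeRot a c)}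
  rw [Set.ncard_singleton] at this
  omega

theorem mem_cubeOrbit_symm {E : Type*} [Ring E] {a c x : E} (ha : a * a + a + 1 = 0)
    (h : x ∈ cubeOrbit a c) : c ∈ cubeOrbit a x := by
  rw [mem_cubeOrbit] at *
  rcases h with rfl | rfl | rfl <;> simp [cubeRot_three ha]

theorem mem_cubeOrbit_trans {E : Type*} [Ring E] {a c x y : E} (ha : a * a + a + 1 = 0)
    (h : x ∈ cubeOrbit a c) (h' : y ∈ cubeOrbit a x) : y ∈ cubeOrbit a c := by
  rw [mem_cubeOrbit] at *
  rcases h with rfl | rfl | rfl <;> rcases h' with rfl | rfl | rfl <;> simp [cubeRot_three ha]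

theorem mem_of_mem_cubeOrbit {E : Type*} [Ring E] {a c x : E} {p : E → Prop}
    (hp : ∀ y, p y → p (cubeRot a y)) (hc : p c) (h : x ∈ cubeOrbit a c) : p x := by
  rcases mem_cubeOrbit.1 h with rfl | rfl | rfl
  exacts [hc, hp _ hc, hp _ (hp _ hc)]

/-- Three elements of order three whose pairwise products have order four. -/
structure IsCubeTriangle {E : Type*} [Ring E] (T : Set E) (a b c : E) : Prop where
  mem_left : a ∈ T
  mem_mid : b ∈ T
  mem_right : c ∈ T
  tau_left_mid : cubeTau a b = 0
  tau_left_right : cubeTau a c = 0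
  tau_mid_right : cubeTau b c = 0

namespace IsCubeConfig

variable {E : Type*} [Ring E] {T : Set E} {a b c d e : E}

theorem golden_isCubeTriangle (hT : IsCubeConfig T) (ha : a ∈ T) (he : e ∈ T)
    (htt : cubeTau a e * cubeTau a e = cubeTau a e + 1) :
    IsCubeTriangle T a (cubeRot e a) (cubeRot e (cubeRot e a)) := by
  obtain ⟨h1, h2, h3⟩ := golden_triangle (hT.sq a ha) (hT.sq e he) htt
  exact ⟨ha, hT.rot_mem e he a ha, hT.rot_mem e he _ (hT.rot_mem e he a ha), h1, h2, h3⟩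

variable [Nontrivial E]

theorem tau_cases_of_adj (hT : IsCubeConfig T) (hb : b ∈ T) (hc : c ∈ T) (hab : cubeTau a b = 0)
    (hac : cubeTau a c = 0) (hne : b ≠ c) : cubeTau b c = 0 ∨ cubeTau b c = 1 ∨
      cubeTau b c * cubeTau b c = cubeTau b c + 1 := by
  rcases hT.tau_cases b hb c hc with h | h | h
  · exact absurd h.symm hne
  · rw [h, cubeTau_neg_one_sub, hab] at hac
    simp at hac
  · exact h

theorem exists_adj_mem_orbit (hT : IsCubeConfig T) (ha : a ∈ T) (hb : b ∈ T) (hc : c ∈ T)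
    (hab : cubeTau a b = 0) (hac : cubeTau a c = 0) (hne : b ∉ cubeOrbit a c) :
    ∃ x ∈ cubeOrbit a c, cubeTau b x = 0 := by
  have ha' := hT.sq a ha
  have hr := cubeTau_rot ha' hac
  have hrr := cubeTau_rot ha' hr
  simp only [mem_cubeOrbit, not_or] at hne
  have hsum := cubeTau_sum ha' hab hac
  have h0 := hT.tau_cases_of_adj hb hc hab hac hne.1
  have h1 := hT.tau_cases_of_adj hb (hT.rot_mem a ha c hc) hab hr hne.2.1
  have h2 := hT.tau_cases_of_adj hb (hT.rot_mem a ha _ (hT.rot_mem a ha c hc)) hab hrr hne.2.2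
  by_contra! hcon
  simp only [mem_cubeOrbit] at hcon
  replace h0 := h0.resolve_left (hcon _ (Or.inl rfl))
  replace h1 := h1.resolve_left (hcon _ (Or.inr (Or.inl rfl)))
  replace h2 := h2.resolve_left (hcon _ (Or.inr (Or.inr rfl)))
  have key := not_tau_all_golden hT.two_cancel ha' (hT.sq b hb) (hT.sq c hc) hab hac rfl rfl
  have hc0 := hcon _ (Or.inl rfl)
  have hc1 := hcon _ (Or.inr (Or.inl rfl))
  have two : (2 : E) ≠ 0 := fun h => one_ne_zero (hT.two_cancel (1 : E) (by rw [mul_one, h]))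
  generalize cubeTau b c = s at *
  generalize cubeTau b (cubeRot a c) = t at *
  generalize cubeTau b (cubeRot a (cubeRot a c)) = u at *
  have hu : u = 1 - s - t := by rw [← hsum]; abel
  subst hu
  have one_one_golden : ∀ x : E, x * x = x + 1 → x = -1 → False := by
    intro x hx h
    rw [h] at hx
    simp at hx
  have opp_golden : ∀ x : E, x * x = x + 1 → -x * -x = -x + 1 → x ≠ 0 → False := by
    intro x hx h hne
    refine hne (hT.two_cancel x ?_)
    linear_combination (norm := (noncomm_ring; try norm_num)) h - hx
  rcases h0 with h0 | h0 <;> rcases h1 with h1 | h1 <;> rcases h2 with h2 | h2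
  · rw [h0, h1] at h2
    exact two (by linear_combination (norm := (noncomm_ring; try norm_num)) -h2)
  · exact one_one_golden _ h2 (by rw [h0, h1]; noncomm_ring)
  · exact one_one_golden t h1
      (by linear_combination (norm := (noncomm_ring; try norm_num)) -h2 - h0)
  · have : 1 - s - t = -t := by rw [h0]; abel
    rw [this] at h2
    exact opp_golden t h1 h2 hc1
  · exact one_one_golden s h0
      (by linear_combination (norm := (noncomm_ring; try norm_num)) -h2 - h1)
  · have : 1 - s - t = -s := by rw [h1]; abel
    rw [this] at h2
    exact opp_golden s h0 h2 hc0
  · have : s = -t := by linear_combination (norm := (noncomm_ring; try norm_num)) -h2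
    rw [this] at h0
    exact opp_golden t h1 h0 hc1
  · exact key h0 h1 h2

theorem golden_of_adj (hT : IsCubeConfig T) (h : IsCubeTriangle T a b c) :
    cubeTau b (cubeRot a c) * cubeTau b (cubeRot a c) = cubeTau b (cubeRot a c) + 1 ∧
    cubeTau b (cubeRot a (cubeRot a c)) * cubeTau b (cubeRot a (cubeRot a c)) =
      cubeTau b (cubeRot a (cubeRot a c)) + 1 := by
  obtain ⟨ha, hb, hc, hab, hac, hbc⟩ := h
  have ha' := hT.sq a ha
  have hb' := hT.sq b hb
  have hc' := hT.sq c hc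
  have hr := cubeTau_rot ha' hac
  have hrr := cubeTau_rot ha' hr
  have hr' := cubeRot_sq ha' hc'
  have hcr := cubeTau_rot_self ha' hc' hac
  have hcrr : cubeTau c (cubeRot a (cubeRot a c)) = 1 := by
    have := cubeTau_rot_self ha' (cubeRot_sq ha' hr') hrr
    rwa [cubeRot_three ha', cubeTau_comm] at this
  have hsum := cubeTau_sum ha' hab hac
  have h1 := hT.tau_cases_of_adj hb (hT.rot_mem a ha c hc) hab hr (by
    rintro rfl; rw [cubeTau_comm, hcr] at hbc; exact one_ne_zero hbc)
  have h2 := hT.tau_cases_of_adj hb (hT.rot_mem a ha _ (hT.rot_mem a ha c hc)) hab hrr (by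
    rintro rfl; rw [cubeTau_comm, hcrr] at hbc; exact one_ne_zero hbc)
  have k1 := not_tau_zero_zero hT.two_cancel ha' hb' hc' hab hac hbc
  have k2 : cubeTau b (cubeRot a (cubeRot a c)) ≠ 0 := fun h0 =>
    not_tau_zero_zero hT.two_cancel ha' hb' (cubeRot_sq ha' hr') hab hrr h0
      (by rwa [cubeRot_three ha'])
  replace h1 := h1.resolve_left k1
  replace h2 := h2.resolve_left k2
  rw [hbc, zero_add] at hsum
  rcases h1 with h1 | h1
  · rw [h1] at hsum
    exact absurd (by simpa using hsum) k2
  rcases h2 with h2 | h2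
  · rw [h2] at hsum
    exact absurd (by simpa using hsum) k1
  exact ⟨h1, h2⟩

theorem eq_of_mem_orbit_of_adj (hT : IsCubeConfig T) (h : IsCubeTriangle T a b c)
    (hd : d ∈ cubeOrbit a c) (hbd : cubeTau b d = 0) : d = c := by
  obtain ⟨h1, h2⟩ := hT.golden_of_adj h
  rcases mem_cubeOrbit.1 hd with h | h | h
  · exact h
  · rw [← h, hbd] at h1; simp at h1
  · rw [← h, hbd] at h2; simp at h2

theorem not_four (hT : IsCubeConfig T) (h : IsCubeTriangle T a b c) (hd : d ∈ T)
    (had : cubeTau a d = 0) (hbd : cubeTau b d = 0) (hcd : cubeTau c d = 0) : False := by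
  obtain ⟨ha, hb, hc, hab, hac, hbc⟩ := h
  exact not_four_adjacent hT.two_cancel hT.three_cancel (hT.sq a ha) (hT.sq b hb) (hT.sq c hc)
    (hT.sq d hd) hab hac had hbc hbd hcd
    (hT.tau_cases a ha _ (hT.sub_mul_sub_mem b hb c hc d hd hbc hbd hcd))

theorem not_triangle_of_not_mem_orbit (hT : IsCubeConfig T) (h : IsCubeTriangle T a b c)
    (h' : IsCubeTriangle T a b d) (hd : c ∉ cubeOrbit a d) : False := by
  have ⟨ha, hb, hc, hab, hac, hbc⟩ := h
  have ha' := hT.sq a ha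
  have hdT := h'.mem_right
  have had := h'.tau_left_right
  have hbd := h'.tau_mid_right
  obtain ⟨x, hx, hcx⟩ := hT.exists_adj_mem_orbit ha hc hdT hac had hd
  rcases mem_cubeOrbit.1 hx with rfl | rfl | rfl
  · exact hT.not_four h hdT had hbd hcx
  · have hg : IsCubeTriangle T a c (cubeRot a d) :=
      ⟨ha, hc, hT.rot_mem a ha d hdT, hac, cubeTau_rot ha' had, hcx⟩
    have := (hT.golden_of_adj hg).2
    rw [cubeRot_three ha'] at this
    exact not_golden_adjacent hT.two_cancel ha' (hT.sq b hb) (hT.sq c hc) (hT.sq d hdT) hab hac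
      had hbc hbd this hcx
  · have hg : IsCubeTriangle T a c (cubeRot a (cubeRot a d)) :=
      ⟨ha, hc, hT.rot_mem a ha _ (hT.rot_mem a ha d hdT), hac,
        cubeTau_rot ha' (cubeTau_rot ha' had), hcx⟩
    have := (hT.golden_of_adj hg).1
    rw [cubeRot_three ha', cubeTau_comm] at this
    have hcx' : cubeTau d (cubeRot a c) = 0 := by
      have h3 := cubeTau_rot_rot ha' c (cubeRot a (cubeRot a d))
      rw [cubeRot_three ha', hcx] at h3
      rw [cubeTau_comm, h3]; simp
    exact not_golden_adjacent hT.two_cancel ha' (hT.sq b hb) (hT.sq d hdT) (hT.sq c hc) hab had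
      hac hbd hbc this hcx'

theorem adj_subset (hT : IsCubeConfig T) (h : IsCubeTriangle T a b c) (hd : d ∈ T)
    (had : cubeTau a d = 0) : d ∈ cubeOrbit a b ∪ cubeOrbit a c := by
  have ha' := hT.sq a h.mem_left
  by_cases hbd : b ∈ cubeOrbit a d
  · exact Or.inl (mem_cubeOrbit_symm ha' hbd)
  obtain ⟨x, hx, hbx⟩ :=
    hT.exists_adj_mem_orbit h.mem_left h.mem_mid hd h.tau_left_mid had hbd
  obtain ⟨hxT, hax⟩ := mem_of_mem_cubeOrbit (p := fun y => y ∈ T ∧ cubeTau a y = 0)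
    (fun y hy => ⟨hT.rot_mem a h.mem_left y hy.1, cubeTau_rot ha' hy.2⟩) ⟨hd, had⟩ hx
  by_cases hcx : c ∈ cubeOrbit a x
  · exact Or.inr (mem_cubeOrbit_trans ha' (mem_cubeOrbit_symm ha' hcx)
      (mem_cubeOrbit_symm ha' hx))
  · exact (hT.not_triangle_of_not_mem_orbit h ⟨h.mem_left, h.mem_mid, hxT, h.tau_left_mid, hax,
      hbx⟩ hcx).elim

theorem ncard_adj_le (hT : IsCubeConfig T) (h : IsCubeTriangle T a b c) :
    {d ∈ T | cubeTau a d = 0}.ncard ≤ 6 := by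
  have hfin : ∀ x, (cubeOrbit a x).Finite := fun x => by unfold cubeOrbit; exact Set.toFinite _
  refine (Set.ncard_le_ncard (fun d hd => hT.adj_subset h hd.1 hd.2)
    ((hfin b).union (hfin c))).trans ((Set.ncard_union_le _ _).trans ?_)
  have h1 := ncard_cubeOrbit_le a b
  have h2 := ncard_cubeOrbit_le a c
  omega

theorem triangle_unique (hT : IsCubeConfig T) (h : IsCubeTriangle T a b c)
    (h' : IsCubeTriangle T a b d) : d = c := by
  have ha' := hT.sq a h.mem_left
  have hb' := hT.sq b h.mem_mid
  rcases hT.adj_subset h h'.mem_right h'.tau_left_right with hd | hd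
  · have hbd := h'.tau_mid_right
    have hr := cubeTau_rot ha' h.tau_left_mid
    rcases mem_cubeOrbit.1 hd with rfl | rfl | rfl
    · rw [cubeTau_self hb'] at hbd
      simp at hbd
    · rw [cubeTau_rot_self ha' hb' h.tau_left_mid] at hbd
      simp at hbd
    · have := cubeTau_rot_self ha' (cubeRot_sq ha' (cubeRot_sq ha' hb')) (cubeTau_rot ha' hr)
      rw [cubeRot_three ha', cubeTau_comm, hbd] at this
      simp at this
  · exact hT.eq_of_mem_orbit_of_adj h hd h'.tau_mid_right

theorem golden_injective (hT : IsCubeConfig T) (ha : a ∈ T) (he : e ∈ T) (hd : d ∈ T)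
    (hte : cubeTau a e * cubeTau a e = cubeTau a e + 1)
    (htd : cubeTau a d * cubeTau a d = cubeTau a d + 1) (h : cubeRot e a = cubeRot d a) :
    e = d := by
  have h1 := hT.golden_isCubeTriangle ha he hte
  have h2 := hT.golden_isCubeTriangle ha hd htd
  rw [← h] at h2
  have h3 := hT.triangle_unique h1 h2
  have h4 := golden_eq_of_triangle (hT.sq a ha) (hT.sq e he) hte
  have h5 := golden_eq_of_triangle (hT.sq a ha) (hT.sq d hd) htd
  rw [← h, h3, h4] at h5
  refine sub_eq_zero.1 (hT.two_cancel _ (hT.two_cancel _ (hT.two_cancel _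
    (hT.three_cancel _ ?_))))
  linear_combination (norm := (noncomm_ring; try norm_num)) h5

theorem ncard_le (hT : IsCubeConfig T) (hfin : T.Finite) (h : IsCubeTriangle T a b c) :
    T.ncard ≤ 20 := by
  have hN := hT.ncard_adj_le h
  have hNfin : {d ∈ T | cubeTau a d = 0}.Finite := hfin.subset fun x hx => hx.1
  have hG : {e ∈ T | cubeTau a e * cubeTau a e = cubeTau a e + 1}.ncard ≤ 6 := by
    refine le_trans (Set.ncard_le_ncard_of_injOn (fun e => cubeRot e a) ?_ ?_ hNfin) hN
    · intro e he
      have := hT.golden_isCubeTriangle h.mem_left he.1 he.2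
      exact ⟨this.mem_mid, this.tau_left_mid⟩
    · intro e he d hd hed
      exact hT.golden_injective h.mem_left he.1 hd.1 he.2 hd.2 hed
  have hI : ((fun x => -1 - x) '' {d ∈ T | cubeTau a d = 0}).ncard ≤ 6 :=
    (Set.ncard_image_le hNfin).trans hN
  have hP : ({a, -1 - a} : Set E).ncard ≤ 2 := by
    have := Set.ncard_insert_le a {-1 - a}
    rwa [Set.ncard_singleton] at this
  have hsub : T ⊆ {a, -1 - a} ∪ {d ∈ T | cubeTau a d = 0} ∪
      ((fun x => -1 - x) '' {d ∈ T | cubeTau a d = 0}) ∪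
      {e ∈ T | cubeTau a e * cubeTau a e = cubeTau a e + 1} := by
    intro x hx
    rcases hT.tau_cases a h.mem_left x hx with h1 | h1 | h1 | h1 | h1
    · exact Or.inl (Or.inl (Or.inl (Or.inl h1)))
    · exact Or.inl (Or.inl (Or.inl (Or.inr h1)))
    · exact Or.inl (Or.inl (Or.inr ⟨hx, h1⟩))
    · refine Or.inl (Or.inr ⟨-1 - x, ⟨?_, ?_⟩, sub_sub_cancel _ _⟩)
      · exact hT.inv_mem x hx
      · rw [cubeTau_neg_one_sub, h1, sub_self]
    · exact Or.inr ⟨hx, h1⟩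
  have hfin' := (((Set.toFinite {a, -1 - a}).union hNfin).union (hNfin.image (fun x => -1 - x))).union
    (hfin.subset (fun x hx => hx.1 : {e ∈ T | cubeTau a e * cubeTau a e = cubeTau a e + 1} ⊆ T))
  have h1 := Set.ncard_le_ncard hsub hfin'
  have h2 := Set.ncard_union_le ({a, -1 - a} ∪ {d ∈ T | cubeTau a d = 0} ∪
      ((fun x => -1 - x) '' {d ∈ T | cubeTau a d = 0}))
      {e ∈ T | cubeTau a e * cubeTau a e = cubeTau a e + 1}
  have h3 := Set.ncard_union_le ({a, -1 - a} ∪ {d ∈ T | cubeTau a d = 0})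
      ((fun x => -1 - x) '' {d ∈ T | cubeTau a d = 0})
  have h4 := Set.ncard_union_le ({a, -1 - a} : Set E) {d ∈ T | cubeTau a d = 0}
  omega

theorem ncard_triangles_le (hT : IsCubeConfig T) (hfin : T.Finite) :
    {p : E × E × E | IsCubeTriangle T p.1 p.2.1 p.2.2}.ncard ≤ 120 := by
  classical
  set S := {p : E × E × E | IsCubeTriangle T p.1 p.2.1 p.2.2} with hS
  rcases S.eq_empty_or_nonempty with h0 | ⟨p₀, hp₀⟩
  · rw [h0, Set.ncard_empty]; omega
  have hSfin : S.Finite := (hfin.prod (hfin.prod hfin)).subset fun p hp =>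
    ⟨hp.mem_left, hp.mem_mid, hp.mem_right⟩
  rw [Set.ncard_eq_toFinset_card S hSfin]
  have hcard := hT.ncard_le hfin hp₀
  have h1 := Finset.card_le_mul_card_image (f := Prod.fst) hSfin.toFinset 6 (by
    intro x hx
    obtain ⟨p, hp, rfl⟩ := Finset.mem_image.1 hx
    rw [Set.Finite.mem_toFinset] at hp
    have hNfin : {d ∈ T | cubeTau p.1 d = 0}.Finite := hfin.subset fun x hx => hx.1
    refine le_trans ?_ (hT.ncard_adj_le hp)
    rw [Set.ncard_eq_toFinset_card _ hNfin]
    refine Finset.card_le_card_of_injOn (fun q => q.2.1) ?_ ?_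
    · intro q hq
      simp only [Finset.coe_filter, Set.Finite.mem_toFinset, Set.mem_ofPred_eq] at hq
      simp only [Set.Finite.coe_toFinset]
      rw [← hq.2]
      exact ⟨hq.1.mem_mid, hq.1.tau_left_mid⟩
    · rintro ⟨x, y, w⟩ hq ⟨x', y', w'⟩ hq' hy
      simp only [Finset.coe_filter, Set.Finite.mem_toFinset, Set.mem_ofPred_eq] at hq hq' hy
      obtain ⟨hq, rfl⟩ := hq
      obtain ⟨hq', rfl⟩ := hq'
      subst hy
      have hw : w = w' := hT.triangle_unique hq' hq
      rw [hw])
  refine h1.trans ?_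
  have h2 : (hSfin.toFinset.image Prod.fst).card ≤ T.ncard := by
    rw [Set.ncard_eq_toFinset_card T hfin]
    refine Finset.card_le_card fun x hx => ?_
    obtain ⟨p, hp, rfl⟩ := Finset.mem_image.1 hx
    rw [Set.Finite.mem_toFinset] at hp ⊢
    exact hp.mem_left
  omega

end IsCubeConfig

namespace FixedPointFreeRep

variable {k V H : Type*} [Field k] [AddCommGroup V] [Module k V] [Group H]
  {ρ : H →* Module.End k V}

theorem map_inv_of_order_three (hρ : FixedPointFreeRep ρ) {a : H} (ha : orderOf a = 3) :
    ρ a⁻¹ = -1 - ρ a := by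
  have h1 := hρ.sq_add_self_add_one ha
  have h2 : a⁻¹ = a * a := by
    rw [inv_eq_iff_mul_eq_one, ← mul_assoc, ← pow_three', ← ha, pow_orderOf_eq_one]
  rw [h2, map_mul]
  linear_combination (norm := noncomm_ring) h1

theorem eq_zero_of_mul_eq (hρ : FixedPointFreeRep ρ) {g : H} (hg : g ≠ 1) {X : Module.End k V}
    (h : ρ g * X = X) : X = 0 := by
  ext v
  exact hρ g hg (X v) (by rw [← Module.End.mul_apply, h])

theorem orderOf_eq_three [Nontrivial V] (hρ : FixedPointFreeRep ρ) (h3 : (3 : k) ≠ 0) {g : H}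
    (h : ρ g * ρ g + ρ g + 1 = 0) : orderOf g = 3 := by
  refine orderOf_eq_prime (hρ.injective ?_) ?_
  · rw [map_pow, map_one]
    linear_combination (norm := noncomm_ring) (ρ g - 1) * h
  · rintro rfl
    obtain ⟨v, hv⟩ := exists_ne (0 : V)
    have h1 := LinearMap.congr_fun h v
    simp only [map_one, mul_one, LinearMap.add_apply, Module.End.one_apply,
      LinearMap.zero_apply] at h1
    have h4 : (3 : k) • v = 0 := by rw [← h1]; module
    exact (smul_eq_zero.1 h4).elim h3 hv

theorem cubeTau_map (hρ : FixedPointFreeRep ρ) {a b : H} (ha : orderOf a = 3)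
    (hb : orderOf b = 3) : cubeTau (ρ a) (ρ b) = ρ (a * b) + ρ (a * b)⁻¹ := by
  rw [mul_inv_rev, map_mul, map_mul, hρ.map_inv_of_order_three ha, hρ.map_inv_of_order_three hb,
    cubeTau]
  noncomm_ring

theorem cubeRot_map (hρ : FixedPointFreeRep ρ) {a : H} (ha : orderOf a = 3) (c : H) :
    cubeRot (ρ a) (ρ c) = ρ (a * c * a⁻¹) := by
  rw [map_mul, map_mul, hρ.map_inv_of_order_three ha, cubeRot]

theorem sub_map (hρ : FixedPointFreeRep ρ) {b c : H} (hc : orderOf c = 3)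
    (hbc : cubeTau (ρ b) (ρ c) = 0) : ρ b - ρ c = ρ (c⁻¹ * b * c⁻¹) := by
  rw [map_mul, map_mul, hρ.map_inv_of_order_three hc]
  exact (cube_sub_eq (hρ.sq_add_self_add_one hc) hbc).symm

theorem natCast_cancel {n : ℕ} (hn : (n : k) ≠ 0) (x : Module.End k V)
    (hx : (n : Module.End k V) * x = 0) : x = 0 := by
  rw [← nsmul_eq_mul, ← Nat.cast_smul_eq_nsmul k] at hx
  exact (smul_eq_zero.1 hx).resolve_left hn

variable [IsAlgClosed k] [FiniteDimensional k V] [Nontrivial V] [Finite H]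

theorem tau_cases_map (hρ : FixedPointFreeRep ρ) {z a b : H} (hz : orderOf z = 2)
    (ha : orderOf a = 3) (hb : orderOf b = 3) :
    b = a ∨ b = a⁻¹ ∨ (a * b) ^ 2 = z ∧ cubeTau (ρ a) (ρ b) = 0 ∨
      (a * b) ^ 3 = z ∧ cubeTau (ρ a) (ρ b) = 1 ∨
      (a * b) ^ 5 = z ∧ cubeTau (ρ a) (ρ b) * cubeTau (ρ a) (ρ b) = cubeTau (ρ a) (ρ b) + 1 := by
  rw [hρ.cubeTau_map ha hb]
  have hz1 := hρ.map_involution hz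
  have hzne : z ≠ 1 := by rintro rfl; simp at hz
  have hzab : z * (a * b) ≠ 1 := by
    intro h
    have hz2 : z⁻¹ = z := by rw [inv_eq_iff_mul_eq_one, ← pow_two, ← hz, pow_orderOf_eq_one]
    have h1 : a * b = z := by rw [← hz2]; exact eq_inv_of_mul_eq_one_right h
    have hbz : b = z * a⁻¹ := by
      rw [(hρ.involution_commute hz _).eq, ← h1, inv_mul_cancel_left]
    have hb3 : b ^ 3 = 1 := by rw [← hb, pow_orderOf_eq_one]
    have ha3 : a⁻¹ ^ 3 = 1 := by rw [← ha, ← orderOf_inv, pow_orderOf_eq_one]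
    rw [hbz, (hρ.involution_commute hz _).mul_pow, ha3, mul_one, pow_succ, ← hz,
      pow_orderOf_eq_one, one_mul] at hb3
    exact hzne hb3
  have hinv : ρ (a * b)⁻¹ * ρ (a * b) = 1 := by rw [← map_mul, inv_mul_cancel, map_one]
  have hinv' : ρ (a * b) * ρ (a * b)⁻¹ = 1 := by rw [← map_mul, mul_inv_cancel, map_one]
  have hzg : ρ (z * (a * b)) = -ρ (a * b) := by rw [map_mul, hz1]; noncomm_ring
  rcases hρ.mul_pow_eq_involution hz ha hb with h | h | h | h | h
  · exact Or.inl h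
  · exact Or.inr (Or.inl h)
  · refine Or.inr (Or.inr (Or.inl ⟨h, ?_⟩))
    replace h := congrArg ρ h
    rw [map_pow, hz1] at h
    generalize ρ (a * b) = g at *
    generalize ρ (a * b)⁻¹ = i at *
    linear_combination (norm := noncomm_ring) i * h - hinv * g
  · refine Or.inr (Or.inr (Or.inr (Or.inl ⟨h, ?_⟩)))
    replace h := congrArg ρ h
    rw [map_pow, hz1] at h
    have hX : 1 - ρ (a * b) + ρ (a * b) ^ 2 = 0 := hρ.eq_zero_of_mul_eq hzab (by
      rw [hzg]; linear_combination (norm := noncomm_ring) -h)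
    generalize ρ (a * b) = g at *
    generalize ρ (a * b)⁻¹ = i at *
    linear_combination (norm := noncomm_ring) i * hX - hinv * g + hinv
  · refine Or.inr (Or.inr (Or.inr (Or.inr ⟨h, ?_⟩)))
    replace h := congrArg ρ h
    rw [map_pow, hz1] at h
    have hX : 1 - ρ (a * b) + ρ (a * b) ^ 2 - ρ (a * b) ^ 3 + ρ (a * b) ^ 4 = 0 :=
      hρ.eq_zero_of_mul_eq hzab (by
      rw [hzg]; linear_combination (norm := noncomm_ring) -h)
    generalize ρ (a * b) = g at *
    generalize ρ (a * b)⁻¹ = i at *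
    have h1 : i * i * g = i := by rw [mul_assoc, hinv, mul_one]
    have h2 : i * i * g * g = 1 := by rw [h1, hinv]
    linear_combination (norm := (noncomm_ring; try norm_num))
      i * i * hX + h1 - h2 + h2 * g - h2 * g * g + hinv + hinv'

/-- The elements of order three in the image of a fixed-point-free representation. -/
theorem isCubeConfig (hρ : FixedPointFreeRep ρ) {z a : H} (hz : orderOf z = 2)
    (ha : orderOf a = 3) : IsCubeConfig (ρ '' {a | orderOf a = 3}) where
  two_cancel x hx := natCast_cancel (k := k) (n := 2) (by exact_mod_cast hρ.two_ne_zero hz) x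
    (by exact_mod_cast hx)
  three_cancel x hx := natCast_cancel (k := k) (n := 3) (by exact_mod_cast hρ.three_ne_zero ha) x
    (by exact_mod_cast hx)
  sq := by
    rintro _ ⟨b, hb, rfl⟩
    exact hρ.sq_add_self_add_one hb
  inv_mem := by
    rintro _ ⟨b, hb, rfl⟩
    exact ⟨b⁻¹, by simpa using hb, hρ.map_inv_of_order_three hb⟩
  rot_mem := by
    rintro _ ⟨b, hb, rfl⟩ _ ⟨c, hc, rfl⟩
    refine ⟨b * c * b⁻¹, ?_, (hρ.cubeRot_map hb c).symm⟩
    rw [Set.mem_ofPred_eq] at hc ⊢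
    rw [← hc]
    exact orderOf_injective (MulAut.conj b).toMonoidHom (MulAut.conj b).injective c
  sub_mul_sub_mem := by
    rintro _ ⟨b, hb, rfl⟩ _ ⟨c, hc, rfl⟩ _ ⟨d, hd, rfl⟩ hbc hbd hcd
    have h := cube_sub_mul_sub_sq (hρ.sq_add_self_add_one hb) (hρ.sq_add_self_add_one hc)
      (hρ.sq_add_self_add_one hd) hbc hbd hcd
    have h1 : -((ρ b - ρ c) * (ρ c - ρ d)) = ρ (z * (c⁻¹ * b * c⁻¹ * (d⁻¹ * c * d⁻¹))) := by
      rw [hρ.sub_map hc hbc, hρ.sub_map hd hcd, map_mul ρ z, hρ.map_involution hz,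
        map_mul ρ (c⁻¹ * b * c⁻¹), neg_one_mul]
    rw [h1] at h ⊢
    exact ⟨_, hρ.orderOf_eq_three (hρ.three_ne_zero ha) h, rfl⟩
  tau_cases := by
    rintro _ ⟨b, hb, rfl⟩ _ ⟨c, hc, rfl⟩
    rw [← hρ.map_inv_of_order_three hb]
    rcases hρ.tau_cases_map hz hb hc with h | h | h | h | h
    · exact Or.inl (h ▸ rfl)
    · exact Or.inr (Or.inl (h ▸ rfl))
    · exact Or.inr (Or.inr (Or.inl h.2))
    · exact Or.inr (Or.inr (Or.inr (Or.inl h.2)))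
    · exact Or.inr (Or.inr (Or.inr (Or.inr h.2)))

end FixedPointFreeRep

theorem isSolvable_perm_of_card_le_four {α : Type*} [Finite α] (h : Nat.card α ≤ 4) :
    Group.IsSolvable (Equiv.Perm α) := by
  classical
  have : Fintype α := Fintype.ofFinite α
  rw [Nat.card_eq_fintype_card, ← Fintype.card_fin 4] at h
  obtain ⟨e⟩ := Function.Embedding.nonempty_of_card_le h
  suffices hS : Group.IsSolvable (Equiv.Perm (Fin 4)) from
    Group.isSolvable_of_isSolvable_injective (Equiv.Perm.viaEmbeddingHom_injective e)
  have h4 : Nat.card (Fin 4) = 4 := by simp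
  have hK : Group.IsSolvable (alternatingGroup.kleinFour (Fin 4)) :=
    Group.isSolvable_of_comm fun a b => by
      have := alternatingGroup.kleinFour_isKleinFour h4
      exact mul_comm_of_exponent_two this.exponent_two a b
  have hA : Group.IsSolvable (alternatingGroup (Fin 4)) :=
    Group.isSolvable_of_ker_le_range (alternatingGroup.kleinFour (Fin 4)).subtype
      (Abelianization.of (G := alternatingGroup (Fin 4)))
      (by rw [Subgroup.range_subtype, alternatingGroup.kleinFour_eq_commutator h4,
            Abelianization.ker_of])
  exact Group.isSolvable_of_ker_le_range (alternatingGroup (Fin 4)).subtype Equiv.Perm.sign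
    (by rw [Subgroup.range_subtype]; rfl)

theorem monoidHom_eq_one_of_perfect_of_isSolvable {R A : Type*} [Group R] [Group A]
    [Group.IsSolvable A] (hR : commutator R = ⊤) (f : R →* A) (g : R) : f g = 1 := by
  have : Group.IsPerfect R := ⟨hR⟩
  have h1 : Group.IsPerfect f.range := Group.IsPerfect.range f
  have h2 : Subsingleton f.range := by
    by_contra h
    rw [not_subsingleton_iff_nontrivial] at h
    exact Group.IsPerfect.not_isSolvable f.range inferInstance
  exact congrArg Subtype.val (Subsingleton.elim (⟨f g, g, rfl⟩ : f.range) 1)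

/-- A perfect group with at most four subgroups generated by conjugates of `a` centralizes `a`. -/
theorem commute_of_perfect_of_conj_mem {R : Type*} [Group R] [Finite R] (hR : commutator R = ⊤)
    {a c₁ c₂ c₃ : R}
    (h : ∀ g, Subgroup.zpowers (g * a * g⁻¹) ∈
      ({Subgroup.zpowers a, Subgroup.zpowers c₁, Subgroup.zpowers c₂, Subgroup.zpowers c₃} :
        Set (Subgroup R))) (g : R) : Commute a g := by
  classical
  let _ : MulAction R (Subgroup R) :=
    { smul := fun g P => P.map (MulAut.conj g).toMonoidHom
      one_smul := fun P => by
        change P.map (MulAut.conj 1).toMonoidHom = P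
        rw [map_one]
        exact P.map_id
      mul_smul := fun g g' P => by
        change P.map (MulAut.conj (g * g')).toMonoidHom =
          (P.map (MulAut.conj g').toMonoidHom).map (MulAut.conj g).toMonoidHom
        rw [map_mul, Subgroup.map_map]
        rfl }
  have hsmul : ∀ g : R, g • Subgroup.zpowers a = Subgroup.zpowers (g * a * g⁻¹) := by
    intro g
    exact MonoidHom.map_zpowers (MulAut.conj g).toMonoidHom a
  have hcard : Nat.card (MulAction.orbit R (Subgroup.zpowers a)) ≤ 4 := by
    rw [Nat.card_coe_set_eq]
    refine (Set.ncard_le_ncard (t := {Subgroup.zpowers a, Subgroup.zpowers c₁,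
      Subgroup.zpowers c₂, Subgroup.zpowers c₃}) ?_ (Set.toFinite _)).trans ?_
    · rintro _ ⟨g, rfl⟩
      change g • Subgroup.zpowers a ∈ _
      rw [hsmul]
      exact h g
    · refine (Set.ncard_insert_le _ _).trans (Nat.succ_le_succ ?_)
      refine (Set.ncard_insert_le _ _).trans (Nat.succ_le_succ ?_)
      refine (Set.ncard_insert_le _ _).trans (Nat.succ_le_succ ?_)
      rw [Set.ncard_singleton]
  have := isSolvable_perm_of_card_le_four hcard
  have hfix : ∀ g : R, g * a * g⁻¹ ∈ Subgroup.zpowers a := by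
    intro g
    have h1 := monoidHom_eq_one_of_perfect_of_isSolvable hR
      (MulAction.toPermHom R (MulAction.orbit R (Subgroup.zpowers a))) g
    have h2 := congrArg Subtype.val (Equiv.congr_fun h1 ⟨_, MulAction.mem_orbit_self _⟩)
    change g • Subgroup.zpowers a = Subgroup.zpowers a at h2
    rw [← h2, hsmul]
    exact Subgroup.mem_zpowers _
  have hpow : ∀ g : R, ∃ i : ℤ, ∀ j : ℤ, g * a ^ j * g⁻¹ = a ^ (i * j) := by
    intro g
    obtain ⟨i, hi⟩ := Subgroup.mem_zpowers_iff.1 (hfix g)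
    exact ⟨i, fun j => by rw [← conj_zpow, ← hi, zpow_mul]⟩
  have hle : commutator R ≤ Subgroup.centralizer {a} := by
    rw [commutator_def, Subgroup.commutator_le]
    intro g _ l _
    obtain ⟨i, hi⟩ := hpow g⁻¹
    obtain ⟨j, hj⟩ := hpow l⁻¹
    have h1 : g⁻¹ * l⁻¹ * a * (g⁻¹ * l⁻¹)⁻¹ = l⁻¹ * g⁻¹ * a * (l⁻¹ * g⁻¹)⁻¹ := by
      have e1 := hj 1
      have e2 := hi 1
      rw [zpow_one, mul_one] at e1 e2
      calc g⁻¹ * l⁻¹ * a * (g⁻¹ * l⁻¹)⁻¹ = g⁻¹ * (l⁻¹ * a * l⁻¹⁻¹) * g⁻¹⁻¹ := by group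
        _ = l⁻¹ * (g⁻¹ * a * g⁻¹⁻¹) * l⁻¹⁻¹ := by rw [e1, e2, hi, hj, mul_comm]
        _ = _ := by group
    rw [Subgroup.mem_centralizer_singleton_iff, commutatorElement_def]
    have h2 : g⁻¹ * l⁻¹ * a = l⁻¹ * g⁻¹ * a * (l⁻¹ * g⁻¹)⁻¹ * (g⁻¹ * l⁻¹) := by
      rw [← h1]; group
    calc g * l * g⁻¹ * l⁻¹ * a = g * l * (g⁻¹ * l⁻¹ * a) := by group
      _ = _ := by rw [h2]; group
  rw [hR] at hle
  have h3 := hle (Subgroup.mem_top g)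
  rw [Subgroup.mem_centralizer_singleton_iff] at h3
  exact h3.symm

namespace FixedPointFreeRep

variable {k V R : Type*} [Field k] [AddCommGroup V] [Module k V] [Group R]
  {ρ : R →* Module.End k V} [IsAlgClosed k] [FiniteDimensional k V] [Nontrivial V] [Finite R]

theorem commutingCyclic (hρ : FixedPointFreeRep ρ) : CommutingCyclic R :=
  fun _ _ => hρ.mem_zpowers_of_commute

theorem exists_isCubeTriangle [Nontrivial R] (hρ : FixedPointFreeRep ρ)
    (hR : commutator R = ⊤) {z : R} (hz : orderOf z = 2) :
    ∃ a b c : R, IsCubeTriangle (ρ '' {a | orderOf a = 3}) (ρ a) (ρ b) (ρ c) := by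
  obtain ⟨-, a, ha⟩ := hρ.commutingCyclic.perfect_facts hR
    fun y z hy hz => hρ.involution_unique hz hy
  have hT := hρ.isCubeConfig hz ha
  have haT : ρ a ∈ ρ '' {a | orderOf a = 3} := ⟨a, ha, rfl⟩
  by_contra hno
  have hno' : ∀ a b c, ¬ IsCubeTriangle (ρ '' {a | orderOf a = 3}) a b c := by
    intro a b c h
    obtain ⟨a, -, rfl⟩ := h.mem_left
    obtain ⟨b, -, rfl⟩ := h.mem_mid
    obtain ⟨c, -, rfl⟩ := h.mem_right
    exact hno ⟨a, b, c, h⟩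
  have horb : ∃ c : R, ∀ b : R, orderOf b = 3 → cubeTau (ρ a) (ρ b) = 0 →
      ρ b ∈ cubeOrbit (ρ a) (ρ c) := by
    by_cases hex : ∃ c : R, orderOf c = 3 ∧ cubeTau (ρ a) (ρ c) = 0
    · obtain ⟨c, hc, hac⟩ := hex
      refine ⟨c, fun b hb hab => ?_⟩
      by_contra hne
      obtain ⟨x, hx, hbx⟩ := hT.exists_adj_mem_orbit haT ⟨b, hb, rfl⟩ ⟨c, hc, rfl⟩ hab hac hne
      refine hno' (ρ a) (ρ b) x ⟨haT, ⟨b, hb, rfl⟩, ?_, hab, ?_, hbx⟩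
      · exact mem_of_mem_cubeOrbit (p := (· ∈ ρ '' {a | orderOf a = 3})) (hT.rot_mem _ haT)
          ⟨c, hc, rfl⟩ hx
      · exact mem_of_mem_cubeOrbit (p := fun y => cubeTau (ρ a) y = 0)
          (fun y => cubeTau_rot (hT.sq _ haT)) hac hx
    · push Not at hex
      exact ⟨a, fun b hb hab => absurd hab (hex b hb)⟩
  obtain ⟨c, hc⟩ := horb
  have hc' : ∀ b : R, orderOf b = 3 → cubeTau (ρ a) (ρ b) = 0 →
      b = c ∨ b = a * c * a⁻¹ ∨ b = a * (a * c * a⁻¹) * a⁻¹ := by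
    intro b hb hab
    have := mem_cubeOrbit.1 (hc b hb hab)
    rwa [hρ.cubeRot_map ha, hρ.cubeRot_map ha, hρ.injective.eq_iff, hρ.injective.eq_iff,
      hρ.injective.eq_iff] at this
  obtain ⟨g, hg⟩ := hρ.commutingCyclic.not_central_of_perfect hR ha
  refine hg (commute_of_perfect_of_conj_mem hR (c₁ := c) (c₂ := a * c * a⁻¹)
    (c₃ := a * (a * c * a⁻¹) * a⁻¹) (fun g => ?_) g)
  have hb : orderOf (g * a * g⁻¹) = 3 := by
    rw [← ha]; exact orderOf_injective (MulAut.conj g).toMonoidHom (MulAut.conj g).injective a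
  generalize g * a * g⁻¹ = b at hb
  rcases hρ.tau_cases_map hz ha hb with h | h | h | h | h
  · simp [h]
  · simp [h]
  · rcases hc' b hb h.2 with h | h | h <;> simp [h]
  · have h1 : cubeTau (ρ a) (ρ b⁻¹) = 0 := by
      rw [hρ.map_inv_of_order_three hb, cubeTau_neg_one_sub, h.2, sub_self]
    rw [← Subgroup.zpowers_inv (g := b)]
    rcases hc' b⁻¹ (by simpa using hb) h1 with h | h | h <;> simp only [h] <;> simp
  · exact absurd (hT.golden_isCubeTriangle haT ⟨b, hb, rfl⟩ h.2) (hno' _ _ _)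

end FixedPointFreeRep

/-! ### Counting elements of a given order -/

theorem exists_modEq_one_and_zero {m n : ℕ} (h : m.Coprime n) :
    ∃ u : ℕ, n * u ≡ 1 [MOD m] ∧ u.Coprime m := by
  obtain ⟨e, he1, he2⟩ := Nat.chineseRemainder h 1 0
  obtain ⟨u, rfl⟩ := (Nat.modEq_zero_iff_dvd).1 he2
  refine ⟨u, he1, ?_⟩
  have h1 : (n * u).gcd m = (1).gcd m := he1.gcd_eq
  rw [Nat.gcd_one_left] at h1
  exact Nat.Coprime.coprime_mul_left (k := n) h1

theorem orderCount_mul {G : Type*} [Group G] {m n : ℕ} (hm : 0 < m) (hn : 0 < n)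
    (hmn : m.Coprime n)
    (hcomm : ∀ x y : G, orderOf x = m → orderOf y = n → Commute x y) :
    orderCount G (m * n) = orderCount G m * orderCount G n := by
  unfold orderCount
  rw [← Nat.card_prod]
  obtain ⟨u, hu, hum⟩ := exists_modEq_one_and_zero hmn
  obtain ⟨v, hv, hvn⟩ := exists_modEq_one_and_zero hmn.symm
  let f : {x : G // orderOf x = m} × {y : G // orderOf y = n} → {g : G // orderOf g = m * n} :=
    fun p => ⟨p.1.1 * p.2.1, by
      rw [(hcomm _ _ p.1.2 p.2.2).orderOf_mul_eq_mul_orderOf_of_coprime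
        (by rw [p.1.2, p.2.2]; exact hmn), p.1.2, p.2.2]⟩
  refine (Nat.card_congr (Equiv.ofBijective f ⟨?_, ?_⟩)).symm
  · have key : ∀ p : {x : G // orderOf x = m} × {y : G // orderOf y = n},
        (f p).1 ^ (n * u) = p.1.1 := by
      intro p
      change (p.1.1 * p.2.1) ^ (n * u) = p.1.1
      have h1 : p.1.1 ^ (n * u) = p.1.1 := by
        conv_rhs => rw [← pow_one p.1.1]
        rw [pow_eq_pow_iff_modEq, p.1.2]
        exact hu
      have h2 : p.2.1 ^ (n * u) = 1 := by
        rw [← orderOf_dvd_iff_pow_eq_one, p.2.2]; exact dvd_mul_right n u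
      rw [(hcomm _ _ p.1.2 p.2.2).mul_pow, h1, h2, mul_one]
    intro p q hpq
    have h1 : p.1.1 = q.1.1 := by rw [← key p, ← key q, hpq]
    have h2 : p.1.1 * p.2.1 = q.1.1 * q.2.1 := congrArg Subtype.val hpq
    rw [h1] at h2
    exact Prod.ext (Subtype.ext h1) (Subtype.ext (mul_left_cancel h2))
  · rintro ⟨g, hg⟩
    have h1 : orderOf (g ^ n) = m := by
      rw [orderOf_pow_of_dvd hn.ne' (by rw [hg]; exact dvd_mul_left n m), hg,
        Nat.mul_div_cancel _ hn]
    have h2 : orderOf (g ^ m) = n := by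
      rw [orderOf_pow_of_dvd hm.ne' (by rw [hg]; exact dvd_mul_right m n), hg,
        Nat.mul_div_cancel_left _ hm]
    refine ⟨⟨⟨g ^ (n * u), ?_⟩, ⟨g ^ (m * v), ?_⟩⟩, Subtype.ext ?_⟩
    · rw [pow_mul, Nat.Coprime.orderOf_pow (by rw [h1]; exact hum.symm), h1]
    · rw [pow_mul, Nat.Coprime.orderOf_pow (by rw [h2]; exact hvn.symm), h2]
    · change g ^ (n * u) * g ^ (m * v) = g
      conv_rhs => rw [← pow_one g]
      rw [← pow_add, pow_eq_pow_iff_modEq, hg]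
      refine (Nat.modEq_and_modEq_iff_modEq_mul hmn).1 ⟨?_, ?_⟩
      · simpa using hu.add ((Nat.modEq_zero_iff_dvd).2 (dvd_mul_right m v))
      · simpa using ((Nat.modEq_zero_iff_dvd).2 (dvd_mul_right n u)).add hv

theorem orderCount_prime {G : Type*} [Group G] [Finite G] {q : ℕ} (hq : q.Prime) :
    orderCount G q = Nat.card {P : Subgroup G // Nat.card P = q} * (q - 1) := by
  have hne : ∀ x : G, orderOf x = q → x ≠ 1 := by
    rintro x hx rfl
    rw [orderOf_one] at hx
    exact hq.one_lt.ne hx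
  let f : (Σ P : {P : Subgroup G // Nat.card P = q}, {x : P.1 // x ≠ 1}) →
      {x : G // orderOf x = q} := fun s => ⟨s.2.1.1, by
        have h1 : orderOf s.2.1 ∣ q := by
          have := orderOf_dvd_natCard s.2.1
          rwa [s.1.2] at this
        rw [Subgroup.orderOf_coe]
        refine (hq.eq_one_or_self_of_dvd _ h1).resolve_left fun h => s.2.2 (orderOf_eq_one_iff.1 h)⟩
  have hz : ∀ s, s.1.1 = Subgroup.zpowers (f s).1 := by
    intro s
    symm
    refine Subgroup.eq_of_le_of_card_ge ?_ ?_
    · rw [Subgroup.zpowers_le]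
      exact s.2.1.2
    · rw [s.1.2, Nat.card_zpowers, (f s).2]
  have hf : Function.Bijective f := by
    constructor
    · rintro ⟨⟨P, hP⟩, ⟨⟨x, hx⟩, hx1⟩⟩ ⟨⟨Q, hQ⟩, ⟨⟨y, hy⟩, hy1⟩⟩ h
      have h1 := hz ⟨⟨P, hP⟩, ⟨⟨x, hx⟩, hx1⟩⟩
      have h2 := hz ⟨⟨Q, hQ⟩, ⟨⟨y, hy⟩, hy1⟩⟩
      rw [← h, ← h1] at h2
      change Q = P at h2
      subst h2
      have h3 : x = y := congrArg Subtype.val h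
      subst h3
      rfl
    · rintro ⟨x, hx⟩
      exact ⟨⟨⟨Subgroup.zpowers x, by rw [Nat.card_zpowers, hx]⟩,
        ⟨⟨x, Subgroup.mem_zpowers x⟩, fun h => hne x hx (congrArg Subtype.val h)⟩⟩, rfl⟩
  unfold orderCount
  have hcard : ∀ P : {P : Subgroup G // Nat.card P = q}, Nat.card {x : P.1 // x ≠ 1} = q - 1 := by
    rintro ⟨P, hP⟩
    classical
    have := Fintype.ofFinite P
    change Nat.card {x : P // x ≠ 1} = q - 1
    rw [← hP, Nat.card_eq_fintype_card, Nat.card_eq_fintype_card, Fintype.card_subtype_compl,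
      Fintype.card_subtype_eq]
  have := Fintype.ofFinite {P : Subgroup G // Nat.card P = q}
  rw [← Nat.card_congr (Equiv.ofBijective f hf), Nat.card_sigma]
  simp only [hcard, Finset.sum_const, Finset.card_univ, smul_eq_mul, Nat.card_eq_fintype_card]

/-! ### Dimension parity -/

theorem even_finrank_of_anticommute {k W : Type*} [Field k] [AddCommGroup W] [Module k W]
    [FiniteDimensional k W] (h2 : (2 : k) ≠ 0) {X Y : Module.End k W}
    (hX : LinearMap.ker X = ⊥) (hY : LinearMap.ker Y = ⊥) (h : X * Y = -(Y * X)) :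
    Even (Module.finrank k W) := by
  have hX' : LinearMap.det X ≠ 0 := fun h0 => (LinearMap.bot_lt_ker_of_det_eq_zero h0).ne' hX
  have hY' : LinearMap.det Y ≠ 0 := fun h0 => (LinearMap.bot_lt_ker_of_det_eq_zero h0).ne' hY
  have h1 := congrArg LinearMap.det h
  rw [← neg_one_smul k (Y * X), LinearMap.det_smul, map_mul, map_mul] at h1
  by_contra hodd
  rw [Nat.not_even_iff_odd] at hodd
  rw [hodd.neg_one_pow] at h1
  have h3 : 2 * (LinearMap.det X * LinearMap.det Y) = 0 := by linear_combination h1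
  exact mul_ne_zero h2 (mul_ne_zero hX' hY') h3

theorem four_dvd_finrank {k V : Type*} [Field k] [AddCommGroup V] [Module k V]
    [FiniteDimensional k V] (h2 : (2 : k) ≠ 0) {s : k} (hs : s ≠ 0) {t g X Y : Module.End k V}
    (ht : ∀ v, t (t v) = (s * s) • v) (hg : LinearMap.ker g = ⊥) (hgt : g * t = -(t * g))
    (hX : LinearMap.ker X = ⊥) (hY : LinearMap.ker Y = ⊥) (hXt : Commute X t)
    (hYt : Commute Y t) (h : X * Y = -(Y * X)) : 4 ∣ Module.finrank k V := by
  have hgt' : ∀ v, g (t v) = -(t (g v)) := fun v => LinearMap.congr_fun hgt v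
  have hcompl : IsCompl (t.eigenspace s) (t.eigenspace (-s)) := by
    constructor
    · rw [Submodule.disjoint_def]
      intro v hv hv'
      rw [Module.End.mem_eigenspace_iff] at hv hv'
      have h1 : (2 * s) • v = 0 := by
        rw [mul_smul, two_smul]
        nth_rw 1 [← hv]
        rw [hv', neg_smul, neg_add_cancel]
      exact (smul_eq_zero.1 h1).resolve_left (mul_ne_zero h2 hs)
    · rw [codisjoint_iff, eq_top_iff]
      intro v _
      have h1 : v = (2 * s)⁻¹ • (t v + s • v) + (2 * s)⁻¹ • (s • v - t v) := by
        rw [← smul_add]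
        have : t v + s • v + (s • v - t v) = (2 * s) • v := by module
        rw [this, inv_smul_smul₀ (mul_ne_zero h2 hs)]
      rw [h1]
      refine Submodule.add_mem_sup (Submodule.smul_mem _ _ ?_) (Submodule.smul_mem _ _ ?_) <;>
      · rw [Module.End.mem_eigenspace_iff]
        simp only [map_add, map_sub, map_smul, ht]
        module
  have hswap : ∀ x : k,
      Module.finrank k (t.eigenspace x) ≤ Module.finrank k (t.eigenspace (-x)) := by
    intro x
    have hmaps : ∀ v ∈ t.eigenspace x, g v ∈ t.eigenspace (-x) := by
      intro v hv
      rw [Module.End.mem_eigenspace_iff] at hv ⊢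
      have h1 := hgt' v
      rw [hv, map_smul] at h1
      rw [neg_smul, h1, neg_neg]
    refine LinearMap.finrank_le_finrank_of_injective (f := g.restrict hmaps) ?_
    intro v w hvw
    exact Subtype.ext (LinearMap.ker_eq_bot.1 hg (congrArg Subtype.val hvw))
  have heq : Module.finrank k (t.eigenspace (-s)) = Module.finrank k (t.eigenspace s) :=
    le_antisymm (by have h1 := hswap (-s); rwa [neg_neg] at h1) (hswap s)
  have hev : Even (Module.finrank k (t.eigenspace s)) := by
    have hres : ∀ Z : Module.End k V, Commute Z t → ∀ v ∈ t.eigenspace s, Z v ∈ t.eigenspace s := by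
      intro Z hZ v hv
      rw [Module.End.mem_eigenspace_iff] at hv ⊢
      have h1 : Z (t v) = t (Z v) := LinearMap.congr_fun hZ v
      rw [← h1, hv, map_smul]
    have hinj : ∀ (Z : Module.End k V) (hZ : Commute Z t), LinearMap.ker Z = ⊥ →
        LinearMap.ker (Z.restrict (hres Z hZ)) = ⊥ := by
      intro Z hZ hker
      rw [LinearMap.ker_eq_bot] at hker ⊢
      intro v w hvw
      exact Subtype.ext (hker (congrArg Subtype.val hvw))
    refine even_finrank_of_anticommute h2 (hinj X hXt hX) (hinj Y hYt hY) ?_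
    ext v
    exact LinearMap.congr_fun h v.1
  rw [← Submodule.finrank_add_eq_of_isCompl hcompl, heq]
  obtain ⟨w, hw⟩ := hev
  exact ⟨w, by omega⟩

theorem LinearMap.ker_eq_bot_of_mul_self {k V : Type*} [Field k] [AddCommGroup V] [Module k V]
    {X : Module.End k V} {s : k} (hs : s ≠ 0) (h : X * X = s • 1) : LinearMap.ker X = ⊥ := by
  rw [LinearMap.ker_eq_bot']
  intro v hv
  have h1 := LinearMap.congr_fun h v
  rw [Module.End.mul_apply, hv, map_zero, LinearMap.smul_apply, Module.End.one_apply] at h1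
  exact (smul_eq_zero.1 h1.symm).resolve_left hs

/-- The trivector of three generators of a Clifford algebra separates the space into two halves,
which are exchanged by an operator swapping two of the generators. -/
theorem four_dvd_finrank_of_swap {k V : Type*} [Field k] [IsAlgClosed k] [AddCommGroup V]
    [Module k V] [FiniteDimensional k V] (h2 : (2 : k) ≠ 0) (h3 : (3 : k) ≠ 0) (h5 : (5 : k) ≠ 0)
    {A B C g : Module.End k V} (hA : A * A + 3 = 0) (hB : B * B + 3 = 0) (hC : C * C + 3 = 0)
    (hAB : A * B + B * A + 2 = 0) (hAC : A * C + C * A + 2 = 0) (hBC : B * C + C * B + 2 = 0)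
    (hg : LinearMap.ker g = ⊥) (hgA : g * A = B * g) (hgB : g * B = A * g)
    (hgC : g * C = C * g) : 4 ∣ Module.finrank k V := by
  obtain ⟨s, hs⟩ := IsAlgClosed.exists_pow_nat_eq (320 : k) (n := 2) (by norm_num)
  have h320 : (320 : k) ≠ 0 := by
    have : (320 : k) = 2 ^ 6 * 5 := by norm_num
    rw [this]
    exact mul_ne_zero (pow_ne_zero _ h2) h5
  have hs0 : s ≠ 0 := by
    rintro rfl
    exact h320 (by rw [← hs]; norm_num)
  set t : Module.End k V := 4 * (A * B * C) + 4 * A - 4 * B + 4 * C with ht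
  have htt : t * t = 320 := by
    rw [ht]
    linear_combination (norm := (noncomm_ring; try norm_num))
      16 * A * B * hAC * B * C - 16 * A * hAB * C * B * C + 16 * hA * B * C * B * C
      + 32 * hA * B * C + 16 * A * B * hAC - 16 * A * hAB * C - 16 * A * B * hBC
      + 16 * A * hBC * C - 16 * hAB * B * C - 48 * B * hBC * C + 48 * hB * C * C
      + 16 * hAC * B * C + 16 * hA - 16 * hAB + 16 * hB + 16 * hAC - 16 * hBC - 128 * hC
  have hAt : Commute A t := by
    change A * t = t * A
    rw [ht]
    linear_combination (norm := (noncomm_ring; try norm_num))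
      - 4 * A * B * hAC + 4 * A * hAB * C + 4 * hAB - 4 * hAC
  have hBt : Commute B t := by
    change B * t = t * B
    rw [ht]
    linear_combination (norm := (noncomm_ring; try norm_num))
      - 4 * A * B * hBC + 4 * hAB * B * C + 4 * hAB - 4 * hBC
  have hCt : Commute C t := by
    change C * t = t * C
    rw [ht]
    linear_combination (norm := (noncomm_ring; try norm_num))
      4 * hAC * B * C - 4 * A * hBC * C + 4 * hAC - 4 * hBC
  refine four_dvd_finrank h2 hs0 (t := t) (g := g) (X := A - B) (Y := C) ?_ hg ?_ ?_ ?_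
    (hAt.sub_left hBt) hCt ?_
  · intro v
    have h1 := LinearMap.congr_fun htt v
    have h320' : (320 : Module.End k V) = (320 : k) • 1 := by
      rw [← Algebra.algebraMap_eq_smul_one, map_ofNat]
    rw [Module.End.mul_apply, h320', LinearMap.smul_apply, Module.End.one_apply] at h1
    rw [h1, ← hs, pow_two]
  · rw [ht]
    linear_combination (norm := (noncomm_ring; try norm_num))
      4 * (hgA * B * C + B * hgB * C + B * A * hgC) + 4 * hgA - 4 * hgB + 4 * hgC + 4 * hAB * C * g
  · refine LinearMap.ker_eq_bot_of_mul_self (s := -4) ?_ ?_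
    · have : (-4 : k) = -(2 * 2) := by norm_num
      rw [this]
      exact neg_ne_zero.2 (mul_ne_zero h2 h2)
    · have : (-4 : k) • (1 : Module.End k V) = -4 := by
        rw [← Algebra.algebraMap_eq_smul_one, map_neg, map_ofNat]
      rw [this]
      linear_combination (norm := (noncomm_ring; try norm_num)) hA - hAB + hB
  · refine LinearMap.ker_eq_bot_of_mul_self (s := -3) (neg_ne_zero.2 h3) ?_
    have : (-3 : k) • (1 : Module.End k V) = -3 := by
      rw [← Algebra.algebraMap_eq_smul_one, map_neg, map_ofNat]
    rw [this]
    linear_combination (norm := (noncomm_ring; try norm_num)) hC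
  · linear_combination (norm := (noncomm_ring; try norm_num)) hAC - hBC

/-- The centralizer of all elements of order three. -/
def cubeCentralizer (H : Type*) [Group H] : Subgroup H :=
  Subgroup.centralizer {x | orderOf x = 3}

theorem mem_cubeCentralizer {H : Type*} [Group H] {g : H} :
    g ∈ cubeCentralizer H ↔ ∀ x : H, orderOf x = 3 → Commute g x := by
  rw [cubeCentralizer, Subgroup.mem_centralizer_iff]
  exact ⟨fun h x hx => (h x hx).symm, fun h x hx => (h x hx).symm⟩

theorem orderOf_conj_eq {H : Type*} [Group H] (g x : H) : orderOf (g * x * g⁻¹) = orderOf x :=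
  orderOf_injective (MulAut.conj g).toMonoidHom (MulAut.conj g).injective x

theorem Commute.conj_eq_self {H : Type*} [Group H] {g x : H} (h : Commute g x) :
    g * x * g⁻¹ = x := by rw [h.eq, mul_inv_cancel_right]

instance cubeCentralizer_normal (H : Type*) [Group H] : (cubeCentralizer H).Normal where
  conj_mem n hn g := by
    rw [mem_cubeCentralizer] at hn ⊢
    intro x hx
    have h1 := hn (g⁻¹ * x * g) (by
      rw [← hx]; simpa using orderOf_conj_eq g⁻¹ x)
    have h2 := congrArg (fun y => g * y * g⁻¹) h1.eq
    change g * n * g⁻¹ * x = x * (g * n * g⁻¹)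
    simpa [mul_assoc] using h2

theorem not_commute_of_mul_pow {H : Type*} [Group H] {z x y : H} (hz : orderOf z = 2)
    (hx : orderOf x = 3) (hy : orderOf y = 3) {n : ℕ} (h : (x * y) ^ n = z) : ¬ Commute x y := by
  intro hc
  have h1 : (x * y) ^ 3 = 1 := by
    rw [hc.mul_pow, ← hx, pow_orderOf_eq_one, hx, ← hy, pow_orderOf_eq_one, mul_one]
  have h2 : z ^ 3 = 1 := by rw [← h, ← pow_mul, mul_comm, pow_mul, h1, one_pow]
  have h3 := orderOf_dvd_of_pow_eq_one h2
  rw [hz] at h3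
  omega

namespace FixedPointFreeRep

variable {k V H : Type*} [Field k] [AddCommGroup V] [Module k V] [Group H]
  {ρ : H →* Module.End k V}

theorem cubeTau_conj (g x y : H) : cubeTau (ρ (g * x * g⁻¹)) (ρ (g * y * g⁻¹)) =
    ρ g * cubeTau (ρ x) (ρ y) * ρ g⁻¹ := by
  have h1 : ρ g⁻¹ * ρ g = 1 := by rw [← map_mul, inv_mul_cancel, map_one]
  have h2 : ρ g * ρ g⁻¹ = 1 := by rw [← map_mul, mul_inv_cancel, map_one]
  simp only [map_mul, cubeTau]
  linear_combination (norm := noncomm_ring) ρ g * ρ x * h1 * ρ y * ρ g⁻¹ +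
    ρ g * ρ y * h1 * ρ x * ρ g⁻¹ - h2

variable [IsAlgClosed k] [FiniteDimensional k V] [Nontrivial V] [Finite H]

theorem mul_sq_of_cubeTau (hρ : FixedPointFreeRep ρ) {z x y : H} (hz : orderOf z = 2)
    (hx : orderOf x = 3) (hy : orderOf y = 3) (h : cubeTau (ρ x) (ρ y) = 0) :
    (x * y) ^ 2 = z := by
  rcases hρ.tau_cases_map hz hx hy with h1 | h1 | h1 | h1 | h1
  · rw [h1, cubeTau_self (hρ.sq_add_self_add_one hx)] at h
    simp at h
  · rw [h1, hρ.map_inv_of_order_three hx, cubeTau_neg_one_sub,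
      cubeTau_self (hρ.sq_add_self_add_one hx)] at h
    have h2 := natCast_cancel (k := k) (n := 2) (by exact_mod_cast hρ.two_ne_zero hz)
      (1 : Module.End k V) (by rw [← h]; push_cast; noncomm_ring; try norm_num)
    simp at h2
  · exact h1.1
  · rw [h1.2] at h; simp at h
  · rw [h] at h1; simp at h1

theorem mul_pow_five_of_cubeTau (hρ : FixedPointFreeRep ρ) {z x y : H} (hz : orderOf z = 2)
    (hx : orderOf x = 3) (hy : orderOf y = 3)
    (h : cubeTau (ρ x) (ρ y) * cubeTau (ρ x) (ρ y) = cubeTau (ρ x) (ρ y) + 1) :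
    (x * y) ^ 5 = z := by
  rcases hρ.tau_cases_map hz hx hy with h1 | h1 | h1 | h1 | h1
  · rw [h1, cubeTau_self (hρ.sq_add_self_add_one hx)] at h
    simp at h
  · rw [h1, hρ.map_inv_of_order_three hx, cubeTau_neg_one_sub,
      cubeTau_self (hρ.sq_add_self_add_one hx)] at h
    have h2 : (1 : Module.End k V) = 0 := by
      linear_combination (norm := (noncomm_ring; try norm_num)) h
    simp at h2
  · rw [h1.2] at h; simp at h
  · rw [h1.2] at h; simp at h
  · exact h1.1

theorem mem_cubeCentralizer_of_triangle (hρ : FixedPointFreeRep ρ) {z a b c : H}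
    (hz : orderOf z = 2) (htri : IsCubeTriangle (ρ '' {a | orderOf a = 3}) (ρ a) (ρ b) (ρ c))
    {g : H} (ha : orderOf a = 3) (hga : Commute g a) (hgb : Commute g b) (hgc : Commute g c) :
    g ∈ cubeCentralizer H := by
  have hT := hρ.isCubeConfig hz ha
  have hinj : ∀ {x : H}, Commute (ρ g) (ρ x) → Commute g x := fun h =>
    hρ.injective (by rw [map_mul, map_mul]; exact h)
  have hadj : ∀ d : H, orderOf d = 3 → cubeTau (ρ a) (ρ d) = 0 → Commute g d := by
    intro d hd had
    have hrot : ∀ y, Commute (ρ g) y → Commute (ρ g) (cubeRot (ρ a) y) := by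
      intro y hy
      rw [cubeRot, ← hρ.map_inv_of_order_three ha]
      exact ((hga.map ρ).mul_right hy).mul_right ((hga.inv_right).map ρ)
    rcases hT.adj_subset htri ⟨d, hd, rfl⟩ had with h | h
    · exact hinj (mem_of_mem_cubeOrbit hrot (hgb.map ρ) h)
    · exact hinj (mem_of_mem_cubeOrbit hrot (hgc.map ρ) h)
  rw [mem_cubeCentralizer]
  intro d hd
  rcases hρ.tau_cases_map hz ha hd with h | h | h | h | h
  · rwa [h]
  · rw [h]; exact hga.inv_right
  · exact hadj d hd h.2
  · have h1 := hadj d⁻¹ (by simpa using hd)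
      (by rw [hρ.map_inv_of_order_three hd, cubeTau_neg_one_sub, h.2, sub_self])
    simpa using h1.inv_right
  · have h1 := (hT.golden_isCubeTriangle ⟨a, ha, rfl⟩ ⟨d, hd, rfl⟩ h.2).tau_left_mid
    rw [hρ.cubeRot_map hd] at h1
    have h2 := hadj (d * a * d⁻¹) (by rw [orderOf_conj_eq, ha]) h1
    have hd' : orderOf (g * d * g⁻¹) = 3 := by rw [orderOf_conj_eq, hd]
    have h3 : cubeTau (ρ a) (ρ (g * d * g⁻¹)) = ρ g * cubeTau (ρ a) (ρ d) * ρ g⁻¹ := by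
      rw [← cubeTau_conj, hga.conj_eq_self]
    have h4 : cubeTau (ρ a) (ρ (g * d * g⁻¹)) * cubeTau (ρ a) (ρ (g * d * g⁻¹)) =
        cubeTau (ρ a) (ρ (g * d * g⁻¹)) + 1 := by
      have e1 : ρ g⁻¹ * ρ g = 1 := by rw [← map_mul, inv_mul_cancel, map_one]
      have e2 : ρ g * ρ g⁻¹ = 1 := by rw [← map_mul, mul_inv_cancel, map_one]
      rw [h3]
      linear_combination (norm := noncomm_ring)
        ρ g * cubeTau (ρ a) (ρ d) * e1 * cubeTau (ρ a) (ρ d) * ρ g⁻¹ + ρ g * h.2 * ρ g⁻¹ + e2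
    have h5 := hT.golden_injective ⟨a, ha, rfl⟩ ⟨d, hd, rfl⟩ ⟨g * d * g⁻¹, hd', rfl⟩ h.2 h4 (by
      rw [hρ.cubeRot_map hd, hρ.cubeRot_map hd']
      congr 1
      calc d * a * d⁻¹ = g * (d * a * d⁻¹) * g⁻¹ := h2.conj_eq_self.symm
        _ = (g * d * g⁻¹) * (g * a * g⁻¹) * (g * d * g⁻¹)⁻¹ := by group
        _ = _ := by rw [hga.conj_eq_self])
    exact (eq_mul_inv_iff_mul_eq.1 (hρ.injective h5)).symm

theorem cubeCentralizer_index (hρ : FixedPointFreeRep ρ) {z a b c : H}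
    (hz : orderOf z = 2) (htri : IsCubeTriangle (ρ '' {a | orderOf a = 3}) (ρ a) (ρ b) (ρ c))
    (ha : orderOf a = 3) (hb : orderOf b = 3) (hc : orderOf c = 3) :
    (cubeCentralizer H).index ≤ 120 ∧ ((cubeCentralizer H).index = 120 →
      ∃ g : H, g * a = b * g ∧ g * b = a * g ∧ g * c = c * g) := by
  have hT := hρ.isCubeConfig hz ha
  have hfin : (ρ '' {a | orderOf a = 3}).Finite := (Set.toFinite _).image ρ
  set S := {p : Module.End k V × Module.End k V × Module.End k V |
    IsCubeTriangle (ρ '' {a | orderOf a = 3}) p.1 p.2.1 p.2.2} with hS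
  have hSfin : S.Finite := (hfin.prod (hfin.prod hfin)).subset fun p hp =>
    ⟨hp.mem_left, hp.mem_mid, hp.mem_right⟩
  have hScard : S.ncard ≤ 120 := hT.ncard_triangles_le hfin
  let f₀ : H → Module.End k V × Module.End k V × Module.End k V := fun g =>
    (ρ (g * a * g⁻¹), ρ (g * b * g⁻¹), ρ (g * c * g⁻¹))
  have hiff : ∀ g g' : H, f₀ g = f₀ g' ↔ g⁻¹ * g' ∈ cubeCentralizer H := by
    intro g g'
    have key : ∀ x : H, ρ (g * x * g⁻¹) = ρ (g' * x * g'⁻¹) ↔ Commute (g⁻¹ * g') x := by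
      intro x
      rw [hρ.injective.eq_iff]
      change _ ↔ g⁻¹ * g' * x = x * (g⁻¹ * g')
      constructor
      · intro h
        calc g⁻¹ * g' * x = g⁻¹ * (g' * x * g'⁻¹) * g' := by group
          _ = x * (g⁻¹ * g') := by rw [← h]; group
      · intro h
        calc g * x * g⁻¹ = g * (x * (g⁻¹ * g')) * g'⁻¹ := by group
          _ = _ := by rw [← h]; group
    simp only [f₀, Prod.mk.injEq, key]
    refine ⟨fun h => hρ.mem_cubeCentralizer_of_triangle hz htri ha h.1 h.2.1 h.2.2, fun h => ?_⟩
    rw [mem_cubeCentralizer] at h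
    exact ⟨h a ha, h b hb, h c hc⟩
  let f : H ⧸ cubeCentralizer H → Module.End k V × Module.End k V × Module.End k V :=
    Quotient.lift f₀ fun g g' h => (hiff g g').2 (QuotientGroup.leftRel_apply.1 h)
  have hfinj : Function.Injective f := by
    rintro ⟨g⟩ ⟨g'⟩ h
    exact QuotientGroup.eq.2 ((hiff g g').1 h)
  have hfS : Set.range f ⊆ S := by
    rintro _ ⟨⟨g⟩, rfl⟩
    have hτ : ∀ x y : H, cubeTau (ρ x) (ρ y) = 0 →
        cubeTau (ρ (g * x * g⁻¹)) (ρ (g * y * g⁻¹)) = 0 := by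
      intro x y h
      rw [cubeTau_conj, h, mul_zero, zero_mul]
    exact ⟨⟨_, (orderOf_conj_eq g a).trans ha, rfl⟩, ⟨_, (orderOf_conj_eq g b).trans hb, rfl⟩,
      ⟨_, (orderOf_conj_eq g c).trans hc, rfl⟩, hτ _ _ htri.tau_left_mid,
      hτ _ _ htri.tau_left_right, hτ _ _ htri.tau_mid_right⟩
  have hcard : (Set.range f).ncard = (cubeCentralizer H).index := by
    rw [← Nat.card_coe_set_eq, Nat.card_range_of_injective hfinj, Subgroup.index]
  refine ⟨hcard ▸ (Set.ncard_le_ncard hfS hSfin).trans hScard, fun h => ?_⟩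
  have heq : Set.range f = S := Set.eq_of_subset_of_ncard_le hfS (by omega) hSfin
  have hswap : (ρ b, ρ a, ρ c) ∈ S := ⟨htri.mem_mid, htri.mem_left, htri.mem_right, by
    rw [cubeTau_comm]; exact htri.tau_left_mid, htri.tau_mid_right, htri.tau_left_right⟩
  rw [← heq] at hswap
  obtain ⟨⟨g⟩, hg⟩ := hswap
  change (ρ (g * a * g⁻¹), ρ (g * b * g⁻¹), ρ (g * c * g⁻¹)) = (ρ b, ρ a, ρ c) at hg
  simp only [Prod.mk.injEq, hρ.injective.eq_iff, mul_inv_eq_iff_eq_mul] at hg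
  exact ⟨g, hg⟩

end FixedPointFreeRep

theorem exists_orderOf_eq_four {H : Type*} [Group H] [Finite H] {z : H}
    (hinv : ∀ y : H, orderOf y = 2 → y = z) (Γ : Subgroup H) (h : 4 ∣ Nat.card Γ) :
    ∃ w ∈ Γ, orderOf w = 4 := by
  have : Fact (Nat.Prime 2) := ⟨Nat.prime_two⟩
  obtain ⟨S, hS⟩ := Sylow.exists_subgroup_card_pow_prime (G := Γ) 2 (n := 2) h
  have hex : ∃ w : S, (w : Γ).1 ≠ 1 ∧ (w : Γ).1 ≠ z := by
    by_contra hcon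
    push Not at hcon
    have hsub : Nat.card S ≤ ({1, z} : Set H).ncard := by
      rw [← Nat.card_coe_set_eq]
      refine Nat.card_le_card_of_injective
        (fun w : S => (⟨(w : Γ).1, ?_⟩ : ({1, z} : Set H))) ?_
      · by_cases hw : (w : Γ).1 = 1
        · exact Or.inl hw
        · exact Or.inr (hcon w hw)
      · intro w w' hww
        exact Subtype.ext (Subtype.ext (Subtype.mk.inj hww))
    have h2 : ({1, z} : Set H).ncard ≤ 2 := 
      (Set.ncard_insert_le _ _).trans (by rw [Set.ncard_singleton])
    omega
  obtain ⟨w, hw1, hwz⟩ := hex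
  refine ⟨(w : Γ).1, (w : Γ).2, ?_⟩
  have h1 : orderOf (w : Γ).1 ∣ 2 ^ 2 := by
    rw [Subgroup.orderOf_coe, Subgroup.orderOf_coe, ← hS]
    exact orderOf_dvd_natCard w
  obtain ⟨i, hi, h2⟩ := (Nat.dvd_prime_pow Nat.prime_two).1 h1
  interval_cases i
  · exact absurd (orderOf_eq_one_iff.1 h2) hw1
  · exact absurd (hinv _ h2) hwz
  · exact h2

namespace FixedPointFreeRep

variable {k V H : Type*} [Field k] [AddCommGroup V] [Module k V] [Group H]
  {ρ : H →* Module.End k V} [IsAlgClosed k] [FiniteDimensional k V] [Nontrivial V] [Finite H]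

/-- Inside a triangle of elements of order three there is an element of order five that commutes
with everything centralizing the elements of order three, but not with all of these. -/
theorem exists_orderOf_eq_five (hρ : FixedPointFreeRep ρ) {z a b c : H}
    (hz : orderOf z = 2) (htri : IsCubeTriangle (ρ '' {a | orderOf a = 3}) (ρ a) (ρ b) (ρ c))
    (ha : orderOf a = 3) (hb : orderOf b = 3) (hc : orderOf c = 3) :
    ∃ y : H, orderOf y = 5 ∧ (∀ g ∈ cubeCentralizer H, Commute g y) ∧
      y = z * (b * (a * c * a⁻¹)) ∧ ¬ Commute b y := by
  have hT := hρ.isCubeConfig hz ha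
  have hc' : orderOf (a * c * a⁻¹) = 3 := by rw [orderOf_conj_eq, hc]
  have h5 := (hT.golden_of_adj htri).1
  rw [hρ.cubeRot_map ha] at h5
  generalize a * c * a⁻¹ = c' at *
  have h1 := hρ.mul_pow_five_of_cubeTau hz hb hc' h5
  have hnc := not_commute_of_mul_pow hz hb hc' h1
  have hzc := hρ.involution_commute hz
  have hnc' : ¬ Commute b (z * (b * c')) := by
    intro h
    apply hnc
    have h2 : Commute b (z⁻¹ * (z * (b * c'))) := (hzc b).symm.inv_right.mul_right h
    rw [inv_mul_cancel_left] at h2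
    have h3 : Commute b (b⁻¹ * (b * c')) := (Commute.refl b).inv_right.mul_right h2
    rwa [inv_mul_cancel_left] at h3
  refine ⟨z * (b * c'), ?_, ?_, rfl, hnc'⟩
  · have : Fact (Nat.Prime 5) := ⟨Nat.prime_five⟩
    refine orderOf_eq_prime ?_ ?_
    · rw [(hzc _).mul_pow, h1, ← pow_succ, show (5 + 1) = 2 * 3 from rfl, pow_mul, ← hz,
        pow_orderOf_eq_one, one_pow]
    · intro h
      rw [h] at hnc'
      exact hnc' (Commute.one_right b)
  · intro g hg
    rw [mem_cubeCentralizer] at hg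
    exact (hzc g).symm.mul_right ((hg b hb).mul_right (hg c' hc'))

theorem card_cubeCentralizer (hρ : FixedPointFreeRep ρ) {z a b c : H}
    (hz : orderOf z = 2) (htri : IsCubeTriangle (ρ '' {a | orderOf a = 3}) (ρ a) (ρ b) (ρ c))
    (ha : orderOf a = 3) (hb : orderOf b = 3) (hc : orderOf c = 3) :
    2 ∣ Nat.card (cubeCentralizer H) ∧ ¬ 3 ∣ Nat.card (cubeCentralizer H) ∧
      ¬ 5 ∣ Nat.card (cubeCentralizer H) ∧ ¬ 4 ∣ Nat.card (cubeCentralizer H) := by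
  have hbc := not_commute_of_mul_pow hz hb hc (hρ.mul_sq_of_cubeTau hz hb hc htri.tau_mid_right)
  have hnot : ∀ x y : H, x ∈ cubeCentralizer H → Commute x y → y ^ orderOf x = 1 →
      y ∈ cubeCentralizer H := fun x y hx hxy h =>
    (Subgroup.zpowers_le.2 hx) (hρ.mem_zpowers_of_commute hxy h)
  refine ⟨?_, fun h => ?_, fun h => ?_, fun h => ?_⟩
  · have hzm : z ∈ cubeCentralizer H :=
      mem_cubeCentralizer.2 fun x _ => hρ.involution_commute hz x
    rw [← hz, ← Subgroup.orderOf_mk z hzm]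
    exact orderOf_dvd_natCard _
  · have : Fact (Nat.Prime 3) := ⟨Nat.prime_three⟩
    obtain ⟨⟨w, hw⟩, ho⟩ := exists_prime_orderOf_dvd_card' 3 h
    rw [Subgroup.orderOf_mk] at ho
    have hbm := hnot w b hw (mem_cubeCentralizer.1 hw b hb) (by
      rw [ho, ← hb, pow_orderOf_eq_one])
    exact hbc (mem_cubeCentralizer.1 hbm c hc)
  · have : Fact (Nat.Prime 5) := ⟨Nat.prime_five⟩
    obtain ⟨⟨w, hw⟩, ho⟩ := exists_prime_orderOf_dvd_card' 5 h
    rw [Subgroup.orderOf_mk] at ho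
    obtain ⟨y, hy, hyc, -, hby⟩ := hρ.exists_orderOf_eq_five hz htri ha hb hc
    have hym := hnot w y hw (hyc w hw) (by rw [ho, ← hy, pow_orderOf_eq_one])
    exact hby (mem_cubeCentralizer.1 hym b hb).symm
  · obtain ⟨w, hw, ho⟩ := exists_orderOf_eq_four
      (fun y hy => hρ.involution_unique hz hy) _ h
    have hu : (c⁻¹ * b * c⁻¹) ^ 2 = z := by
      refine hρ.injective ?_
      rw [map_pow, ← hρ.sub_map hc htri.tau_mid_right, hρ.map_involution hz, pow_two]
      exact cube_sub_sq (hρ.sq_add_self_add_one hb) (hρ.sq_add_self_add_one hc) htri.tau_mid_right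
    have hwb := mem_cubeCentralizer.1 hw b hb
    have hwc := mem_cubeCentralizer.1 hw c hc
    have hum := hnot w (c⁻¹ * b * c⁻¹) hw
      ((hwc.inv_right.mul_right hwb).mul_right hwc.inv_right)
      (by rw [ho, show 4 = 2 * 2 from rfl, pow_mul, hu, ← hz, pow_orderOf_eq_one])
    have h1 := (mem_cubeCentralizer.1 hum c hc).symm
    have h2 : Commute c (c * (c⁻¹ * b * c⁻¹) * c) :=
      ((Commute.refl c).mul_right h1).mul_right (Commute.refl c)
    have h3 : c * (c⁻¹ * b * c⁻¹) * c = b := by group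
    rw [h3] at h2
    exact hbc h2.symm

end FixedPointFreeRep

theorem Subgroup.mem_of_orderOf_coprime_index {H : Type*} [Group H] {Γ : Subgroup H}
    [Γ.Normal] {x : H} (h : (orderOf x).Coprime Γ.index) : x ∈ Γ := by
  have h1 : (x : H ⧸ Γ) ^ orderOf x = 1 := by
    rw [← QuotientGroup.mk_pow, pow_orderOf_eq_one, QuotientGroup.mk_one]
  have h2 : (x : H ⧸ Γ) ^ Γ.index = 1 := by
    rw [← QuotientGroup.mk_pow, QuotientGroup.eq_one_iff]
    exact Γ.pow_index_mem x
  have h3 := pow_gcd_eq_one.2 ⟨h1, h2⟩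
  rw [Nat.Coprime.gcd_eq_one h, pow_one] at h3
  exact (QuotientGroup.eq_one_iff x).1 h3

theorem commute_of_orderOf_five {H : Type*} [Group H] {b y : H} (hb : orderOf b = 3)
    (hy : orderOf y = 5) (hn : b * y * b⁻¹ ∈ Subgroup.zpowers y) : Commute b y := by
  obtain ⟨i, hi⟩ := Subgroup.mem_zpowers_iff.1 hn
  have h1 : ∀ j : ℤ, b * y ^ j * b⁻¹ = y ^ (i * j) := by
    intro j
    rw [← conj_zpow, ← hi, zpow_mul]
  have h3 : y = y ^ (i * (i * i)) := by
    have hb3 : b * (b * (b * y * b⁻¹) * b⁻¹) * b⁻¹ = y := by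
      have : b * b * b = 1 := by
        rw [← pow_orderOf_eq_one b, hb, pow_succ, pow_two]
      calc b * (b * (b * y * b⁻¹) * b⁻¹) * b⁻¹ = (b * b * b) * y * (b * b * b)⁻¹ := by group
        _ = y := by rw [this]; simp
    rw [← hi, h1, h1] at hb3
    exact hb3.symm
  have h4 : (5 : ℤ) ∣ i * (i * i) - 1 := by
    have := orderOf_dvd_iff_zpow_eq_one (x := y) (i := i * (i * i) - 1)
    rw [hy] at this
    refine this.2 ?_
    rw [zpow_sub, ← h3, zpow_one, mul_inv_cancel]
  have h5 : (5 : ℤ) ∣ i - 1 := by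
    have : i % 5 = 0 ∨ i % 5 = 1 ∨ i % 5 = 2 ∨ i % 5 = 3 ∨ i % 5 = 4 := by omega
    rcases this with h | h | h | h | h <;>
      simp [Int.dvd_iff_emod_eq_zero, Int.sub_emod, Int.mul_emod, h] at h4 ⊢
  have h6 : y ^ i = y := by
    have := (orderOf_dvd_iff_zpow_eq_one (x := y) (i := i - 1)).1 (by rw [hy]; exact h5)
    rw [zpow_sub, zpow_one, mul_inv_eq_one] at this
    exact this
  rw [h6] at hi
  exact (mul_inv_eq_iff_eq_mul.1 hi.symm)

theorem orderCount_five {H : Type*} [Group H] [Finite H] {Γ : Subgroup H} [Γ.Normal] {b y : H}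
    (hb : orderOf b = 3) (hy : orderOf y = 5) (hby : ¬ Commute b y)
    (hΓ : ∀ g ∈ Γ, Commute g y) (h5 : ¬ 5 ∣ Nat.card Γ) (hk : Γ.index ∣ 120) :
    orderCount H 5 = 24 ∧ ∀ x : H, orderOf x = 5 → ∀ g ∈ Γ, Commute g x := by
  have : Fact (Nat.Prime 5) := ⟨by norm_num⟩
  have hcard := Γ.card_mul_index
  have hfac : (Nat.card H).factorization 5 = 1 := by
    have hpos : 0 < Nat.card H := Nat.card_pos
    have h1 : 5 ∣ Nat.card H := hy ▸ orderOf_dvd_natCard y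
    have h2 : ¬ 5 ^ 2 ∣ Nat.card H := by
      intro h
      rw [← hcard] at h
      have h3 : Nat.Coprime (5 ^ 2) (Nat.card Γ) :=
        Nat.Coprime.pow_left 2 ((Nat.Prime.coprime_iff_not_dvd (by norm_num)).2 h5)
      have h4 := (h3.dvd_of_dvd_mul_left h).trans hk
      norm_num at h4
    have h3 := (Nat.Prime.dvd_iff_one_le_factorization (by norm_num) hpos.ne').1 h1
    have h4 := (Nat.Prime.pow_dvd_iff_le_factorization (k := 2) (by norm_num : Nat.Prime 5)
      hpos.ne').not.1 h2
    omega
  have hcz : ∀ x : H, orderOf x = 5 →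
      Nat.card (Subgroup.zpowers x) = 5 ^ (Nat.card H).factorization 5 := by
    intro x hx
    rw [hfac, Nat.card_zpowers, hx, pow_one]
  have hconj : ∀ x : H, orderOf x = 5 → ∀ g ∈ Γ, Commute g x := by
    intro x hx g hg
    obtain ⟨t, ht⟩ := MulAction.exists_smul_eq H (Sylow.ofCard _ (hcz y hy))
      (Sylow.ofCard _ (hcz x hx))
    have hxm : x ∈ t • (Sylow.ofCard _ (hcz y hy)) := by
      rw [ht]
      exact Subgroup.mem_zpowers x
    obtain ⟨w, hw, hwx⟩ := hxm
    obtain ⟨i, rfl⟩ := Subgroup.mem_zpowers_iff.1 (show w ∈ Subgroup.zpowers y from hw)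
    have hwx' : t * y ^ i * t⁻¹ = x := hwx
    have h1 : Commute (t⁻¹ * g * t) (y ^ i) :=
      (hΓ _ (by simpa using (inferInstance : Γ.Normal).conj_mem g hg t⁻¹)).zpow_right i
    rw [← hwx']
    have := h1.eq
    change g * (t * y ^ i * t⁻¹) = t * y ^ i * t⁻¹ * g
    calc g * (t * y ^ i * t⁻¹) = t * ((t⁻¹ * g * t) * y ^ i) * t⁻¹ := by group
      _ = t * (y ^ i * (t⁻¹ * g * t)) * t⁻¹ := by rw [this]
      _ = t * y ^ i * t⁻¹ * g := by group
  refine ⟨?_, hconj⟩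
  have hnorm : Nat.card (Sylow 5 H) =
      (Subgroup.normalizer (Subgroup.zpowers y : Set H)).index :=
    (Sylow.ofCard _ (hcz y hy)).card_eq_index_normalizer
  have hmod := card_sylow_modEq_one 5 H
  have hNΓ : Γ ≤ Subgroup.normalizer (Subgroup.zpowers y : Set H) := by
    intro g hg
    rw [Subgroup.mem_normalizer_iff]
    have h1 : ∀ g ∈ Γ, ∀ n ∈ Subgroup.zpowers y, g * n * g⁻¹ = n := by
      intro g hg n hn
      obtain ⟨i, rfl⟩ := Subgroup.mem_zpowers_iff.1 hn
      rw [((hΓ g hg).zpow_right i).eq, mul_inv_cancel_right]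
    intro n
    constructor
    · intro hn
      rwa [h1 g hg n hn]
    · intro hn
      have := h1 g⁻¹ (Γ.inv_mem hg) _ hn
      have h2 : n = g * n * g⁻¹ := by rw [← this]; group
      rwa [h2]
  have hN := (Subgroup.normalizer (Subgroup.zpowers y : Set H)).card_mul_index
  have hd1 : Nat.card Γ * 5 ∣ Nat.card (Subgroup.normalizer (Subgroup.zpowers y : Set H)) := by
    refine Nat.Coprime.mul_dvd_of_dvd_of_dvd ?_ (Subgroup.card_dvd_of_le hNΓ) ?_
    · exact ((Nat.Prime.coprime_iff_not_dvd (by norm_num)).2 h5).symm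
    · refine dvd_trans (by rw [Nat.card_zpowers, hy])
        (Subgroup.card_dvd_of_le (H := Subgroup.zpowers y) ?_)
      exact Subgroup.le_normalizer
  have hd2 : Nat.card (Sylow 5 H) ∣ 24 := by
    obtain ⟨c, hc⟩ := hd1
    rw [← hnorm, hc, ← hcard] at hN
    have hpos : 0 < Nat.card Γ := Nat.card_pos
    have h1 : 5 * c * Nat.card (Sylow 5 H) = Γ.index :=
      Nat.eq_of_mul_eq_mul_left hpos (by rw [← hN]; ring)
    rw [← h1, mul_assoc, show 120 = 5 * 24 from rfl] at hk
    exact (Dvd.intro_left c rfl).trans (Nat.dvd_of_mul_dvd_mul_left (by norm_num) hk)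
  have hne1 : Nat.card (Sylow 5 H) ≠ 1 := by
    intro h
    rw [hnorm, Subgroup.index_eq_one] at h
    apply hby
    apply commute_of_orderOf_five hb hy
    have hbm : b ∈ Subgroup.normalizer (Subgroup.zpowers y : Set H) := h ▸ Subgroup.mem_top b
    exact (Subgroup.mem_normalizer_iff.1 hbm y).1 (Subgroup.mem_zpowers y)
  have h6 : Nat.card (Sylow 5 H) = 6 := by
    have hle := Nat.le_of_dvd (by norm_num) hd2
    unfold Nat.ModEq at hmod
    clear hnorm
    generalize Nat.card (Sylow 5 H) = n at hle hmod hd2 hne1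
    interval_cases n <;> revert hmod hd2 hne1 <;> decide
  rw [orderCount_prime (by norm_num)]
  have he : Nat.card {P : Subgroup H // Nat.card P = 5} = Nat.card (Sylow 5 H) := by
    refine Nat.card_congr ⟨fun Q => Sylow.ofCard Q.1 (by rw [Q.2, hfac, pow_one]),
      fun Q => ⟨Q, by rw [Q.card_eq_multiplicity, hfac, pow_one]⟩, fun _ => rfl, fun _ => rfl⟩
  rw [he, h6]

theorem eq_sixty_or_of_dvd {k g : ℕ} (hk : k ≤ 120) (hkpos : 0 < k) (h2 : 2 ∣ g) (h4 : ¬ 4 ∣ g)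
    (h3 : ¬ 3 ∣ g) (h5 : ¬ 5 ∣ g) (h : 120 ∣ g * k) : k = 60 ∨ k = 120 := by
  obtain ⟨m, rfl⟩ := h2
  have hm : Nat.Coprime 60 m := by
    have c2 : Nat.Coprime 2 m := (Nat.Prime.coprime_iff_not_dvd Nat.prime_two).2 (by omega)
    have c3 : Nat.Coprime 3 m := (Nat.Prime.coprime_iff_not_dvd Nat.prime_three).2 (by omega)
    have c5 : Nat.Coprime 5 m := (Nat.Prime.coprime_iff_not_dvd (by norm_num)).2 (by omega)
    exact ((c2.mul_left c2).mul_left c3).mul_left c5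
  rw [mul_assoc, show 120 = 2 * 60 from rfl] at h
  have := hm.dvd_of_dvd_mul_left (Nat.dvd_of_mul_dvd_mul_left (by norm_num) h)
  omega

theorem sq_add_one_dvd_ten {q m : ℕ} (hq : Odd q)
    (hm : ∀ l : ℕ, l.Prime → l ∣ m → l % 4 = 3) (h : q ^ 2 + 1 ∣ 240 * m) : q ^ 2 + 1 ∣ 10 := by
  have hl : ∀ l : ℕ, l.Prime → l % 4 = 3 → Nat.Coprime (q ^ 2 + 1) l := by
    intro l hl h3
    refine ((Nat.Prime.coprime_iff_not_dvd hl).2 fun hd => ?_).symm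
    have : Fact l.Prime := ⟨hl⟩
    have h0 : ((q ^ 2 + 1 : ℕ) : ZMod l) = 0 := (ZMod.natCast_eq_zero_iff _ _).2 hd
    push_cast at h0
    exact ZMod.mod_four_ne_three_of_sq_eq_neg_one (y := (q : ZMod l))
      (eq_neg_of_add_eq_zero_left h0) h3
  have hcm : Nat.Coprime (q ^ 2 + 1) m := by
    refine Nat.Coprime.symm (Nat.coprime_of_dvd fun l hlp hlm hld => ?_)
    exact (Nat.Prime.coprime_iff_not_dvd hlp).1 (hl l hlp (hm l hlp hlm)).symm hld
  have h240 := hcm.dvd_of_dvd_mul_right h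
  have h80 : q ^ 2 + 1 ∣ 80 := 
    (hl 3 Nat.prime_three rfl).dvd_of_dvd_mul_right (m := 80) h240
  obtain ⟨j, rfl⟩ := hq
  have he : (2 * j + 1) ^ 2 + 1 = 2 * (2 * (j ^ 2 + j) + 1) := by ring
  rw [he] at h80 ⊢
  have h40 : 2 * (j ^ 2 + j) + 1 ∣ 8 * 5 := Nat.dvd_of_mul_dvd_mul_left (k := 2) (by norm_num) h80
  have hc8 : Nat.Coprime (2 * (j ^ 2 + j) + 1) 8 :=
    Nat.Coprime.pow_right 3 (Nat.coprime_two_right.2 ⟨_, rfl⟩)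
  exact Nat.mul_dvd_mul_left 2 (hc8.dvd_of_dvd_mul_left h40)

/-- If `240 * m = p ^ (4 * s) - 1` with all prime factors of `m` congruent to `3` modulo `4`, then
the factor `p ^ (2 * s) + 1` is too big. -/
theorem pow_sub_one_ne_of_primeFactors {p s m : ℕ} (hp : p.Prime) (hs : s ≠ 0)
    (hm : ∀ l : ℕ, l.Prime → l ∣ m → l % 4 = 3) : 240 * m ≠ p ^ (4 * s) - 1 := by
  intro h
  have hpos : 0 < p ^ (4 * s) := pow_pos hp.pos _
  have hr : p ^ (4 * s) = 240 * m + 1 := by omega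
  have hnd : ∀ d : ℕ, d ∣ 240 → d.Prime → p ≠ d := by
    rintro d hd hdp rfl
    have h1 : p ∣ 240 * m + 1 := by
      rw [← hr]; exact dvd_pow_self p (by omega)
    have h2 : p ∣ 1 := (Nat.dvd_add_right (hd.mul_right m)).1 h1
    exact hdp.one_lt.ne' (Nat.dvd_one.1 h2)
  have n2 := hnd 2 (by norm_num) Nat.prime_two
  have n3 := hnd 3 (by norm_num) Nat.prime_three
  have hodd : Odd (p ^ s) := (hp.odd_of_ne_two n2).pow
  have hdvd : (p ^ s) ^ 2 + 1 ∣ 240 * m := by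
    refine ⟨(p ^ s) ^ 2 - 1, ?_⟩
    rw [h, show p ^ (4 * s) = ((p ^ s) ^ 2) ^ 2 by rw [← pow_mul, ← pow_mul]; ring_nf]
    simpa using Nat.sq_sub_sq ((p ^ s) ^ 2) 1
  have hle := Nat.le_of_dvd (by norm_num) (sq_add_one_dvd_ten hodd hm hdvd)
  have h4 : 4 ≤ p := by
    have := hp.two_le
    omega
  have : p ≤ p ^ s := Nat.le_self_pow hs p
  nlinarith

theorem FixedPointFreeRep.comp_subtype {k V H : Type*} [Field k] [AddCommGroup V] [Module k V]
    [Group H] {ρ : H →* Module.End k V} (hρ : FixedPointFreeRep ρ) (R : Subgroup H) :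
    FixedPointFreeRep (ρ.comp R.subtype) := fun h hh v hv =>
  hρ h (fun h1 => hh (Subtype.ext h1)) v hv

theorem twentyfour_mul_dvd_card {H : Type*} [Group H] [Finite H]
    (hpoc : PerfectOrderClasses H) {Γ : Subgroup H} [Γ.Normal] (hcount : orderCount H 5 = 24)
    (hcomm : ∀ x : H, orderOf x = 5 → ∀ g ∈ Γ, Commute g x) {l : ℕ} (hl : l.Prime)
    (hlΓ : l ∣ Nat.card Γ) (hl5 : l ≠ 5) (hk : l.Coprime Γ.index) :
    24 * (l - 1) ∣ Nat.card H := by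
  have : Fact l.Prime := ⟨hl⟩
  have hmul : orderCount H (5 * l) = 24 * orderCount H l := by
    rw [← hcount]
    refine orderCount_mul (by norm_num) hl.pos
      ((Nat.coprime_primes (by norm_num) hl).2 hl5.symm) fun x y hx hy => ?_
    exact (hcomm x hx y (Subgroup.mem_of_orderOf_coprime_index (hy ▸ hk))).symm
  have hne : orderCount H l ≠ 0 := by
    obtain ⟨x, hx⟩ := exists_prime_orderOf_dvd_card' l
      (hlΓ.trans (Subgroup.card_subgroup_dvd_card Γ))
    have : Nonempty {g : H // orderOf g = l} := ⟨⟨x, hx⟩⟩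
    exact Nat.card_pos.ne'
  have hd := (hpoc (5 * l) (Nat.mul_pos (by norm_num) hl.pos)).resolve_left
    (by rw [hmul]; exact mul_ne_zero (by norm_num) hne)
  rw [hmul, orderCount_prime hl] at hd
  exact (Nat.mul_dvd_mul_left 24 (Dvd.intro_left _ rfl)).trans hd

namespace FixedPointFreeRep

variable {k V H : Type*} [Field k] [AddCommGroup V] [Module k V] [Group H]
  {ρ : H →* Module.End k V} [IsAlgClosed k] [FiniteDimensional k V] [Nontrivial V] [Finite H]

theorem natCast_orderOf_ne_zero (hρ : FixedPointFreeRep ρ) (g : H) : (orderOf g : k) ≠ 0 := by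
  obtain ⟨c, -, v, hv, hc, -⟩ := exists_common_eigenvector (Commute.refl (ρ g))
  have : NeZero (orderOf g) := ⟨(orderOf_pos g).ne'⟩
  exact (hρ.isPrimitiveRoot_of_eigen hv hc).neZero'.ne

theorem exists_perfect_isCubeTriangle (hρ : FixedPointFreeRep ρ) (hH : ¬ Group.IsSolvable H) :
    ∃ R : Subgroup H, commutator R = ⊤ ∧ 8 ∣ Nat.card R ∧ ∃ z a b c : H, z ∈ R ∧ a ∈ R ∧ b ∈ R ∧
      c ∈ R ∧ orderOf z = 2 ∧ orderOf a = 3 ∧ orderOf b = 3 ∧ orderOf c = 3 ∧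
      IsCubeTriangle (ρ '' {a | orderOf a = 3}) (ρ a) (ρ b) (ρ c) := by
  rw [Group.isSolvable_iff_commutator_lt] at hH
  push Not at hH
  obtain ⟨R, hR0, hR⟩ := hH
  have hRR : ⁅R, R⁆ = R := by
    refine le_antisymm (Subgroup.commutator_le_self R) ?_
    by_contra hcon
    exact hR (lt_of_le_not_ge (Subgroup.commutator_le_self R) hcon)
  have hperf : commutator R = ⊤ := by
    apply Subgroup.map_injective R.subtype_injective
    rw [Subgroup.map_subtype_commutator, hRR, ← MonoidHom.range_eq_map, R.range_subtype]
  have : Nontrivial R := (Subgroup.nontrivial_iff_ne_bot R).2 hR0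
  have hρR := hρ.comp_subtype R
  have h8 := (hρR.commutingCyclic.perfect_facts hperf
    fun y z hy hz => hρR.involution_unique hz hy).1
  have : Fact (Nat.Prime 2) := ⟨Nat.prime_two⟩
  obtain ⟨z, hz⟩ := exists_prime_orderOf_dvd_card' (G := R) 2 (dvd_trans (by norm_num) h8)
  obtain ⟨a, b, c, h⟩ := hρR.exists_isCubeTriangle hperf hz
  have hmem : ∀ x : R, (ρ.comp R.subtype) x ∈ (ρ.comp R.subtype) '' {a | orderOf a = 3} →
      orderOf (x : H) = 3 := by
    rintro x ⟨w, hw, hwx⟩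
    rw [← hρR.injective hwx, Subgroup.orderOf_coe]
    exact hw
  have ha := hmem a h.mem_left
  have hb := hmem b h.mem_mid
  have hc := hmem c h.mem_right
  exact ⟨R, hperf, h8, z, a, b, c, z.2, a.2, b.2, c.2, by rwa [Subgroup.orderOf_coe], ha, hb, hc,
    ⟨⟨_, ha, rfl⟩, ⟨_, hb, rfl⟩, ⟨_, hc, rfl⟩, h.tau_left_mid, h.tau_left_right,
      h.tau_mid_right⟩⟩

theorem four_dvd_finrank_of_isCubeTriangle (hρ : FixedPointFreeRep ρ) {z a b c y g : H}
    (hz : orderOf z = 2) (htri : IsCubeTriangle (ρ '' {a | orderOf a = 3}) (ρ a) (ρ b) (ρ c))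
    (ha : orderOf a = 3) (hb : orderOf b = 3) (hc : orderOf c = 3) (hy : orderOf y = 5)
    (hga : g * a = b * g) (hgb : g * b = a * g) (hgc : g * c = c * g) :
    4 ∣ Module.finrank k V := by
  have h5 : (5 : k) ≠ 0 := by
    have := hρ.natCast_orderOf_ne_zero y
    rw [hy] at this
    exact_mod_cast this
  have hmap : ∀ {x y : H}, g * x = y * g → ρ g * ρ x = ρ y * ρ g := by
    intro x y h
    rw [← map_mul, h, map_mul]
  have sq : ∀ {x : H}, orderOf x = 3 → (2 * ρ x + 1) * (2 * ρ x + 1) + 3 = 0 := by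
    intro x hx
    linear_combination (norm := (noncomm_ring; try norm_num)) 4 * hρ.sq_add_self_add_one hx
  have cross : ∀ {x y : H}, cubeTau (ρ x) (ρ y) = 0 →
      (2 * ρ x + 1) * (2 * ρ y + 1) + (2 * ρ y + 1) * (2 * ρ x + 1) + 2 = 0 := by
    intro x y h
    unfold cubeTau at h
    linear_combination (norm := (noncomm_ring; try norm_num)) 4 * h
  have swap : ∀ {x y : H}, g * x = y * g →
      ρ g * (2 * ρ x + 1) = (2 * ρ y + 1) * ρ g := by
    intro x y h
    linear_combination (norm := (noncomm_ring; try norm_num)) 2 * hmap h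
  refine four_dvd_finrank_of_swap (g := ρ g) (hρ.two_ne_zero hz) (hρ.three_ne_zero ha) h5
    (sq ha) (sq hb) (sq hc) (cross htri.tau_left_mid) (cross htri.tau_left_right)
    (cross htri.tau_mid_right) ?_ (swap hga) (swap hgb) (swap hgc)
  rw [LinearMap.ker_eq_bot']
  intro v hv
  have h1 : (ρ g⁻¹ * ρ g) v = v := by rw [← map_mul, inv_mul_cancel, map_one]; rfl
  rw [← h1, Module.End.mul_apply, hv, map_zero]

/-- An insoluble group with perfect order classes and a fixed-point-free representation of
dimension `r` is perfect, if its order is of the form `p ^ r - 1`. -/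
theorem commutator_eq_top (hρ : FixedPointFreeRep ρ) (hH : ¬ Group.IsSolvable H)
    (hpoc : PerfectOrderClasses H) {p : ℕ} (hp : p.Prime)
    (hcard : Nat.card H = p ^ Module.finrank k V - 1) : commutator H = ⊤ := by
  obtain ⟨R, hperf, h8, z, a, b, c, hzR, haR, hbR, hcR, hz, ha, hb, hc, htri⟩ :=
    hρ.exists_perfect_isCubeTriangle hH
  obtain ⟨y, hy, hyΓ, hyeq, hby⟩ := hρ.exists_orderOf_eq_five hz htri ha hb hc
  obtain ⟨hΓ2, hΓ3, hΓ5, hΓ4⟩ := hρ.card_cubeCentralizer hz htri ha hb hc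
  obtain ⟨hle, hswap⟩ := hρ.cubeCentralizer_index hz htri ha hb hc
  have hRdvd : 120 ∣ Nat.card R := by
    have h3 : 3 ∣ Nat.card R := by
      rw [← ha, ← Subgroup.orderOf_mk a haR]
      exact orderOf_dvd_natCard _
    have h5 : 5 ∣ Nat.card R := by
      have hyR : y ∈ R := by
        rw [hyeq]
        exact R.mul_mem hzR (R.mul_mem hbR (R.mul_mem (R.mul_mem haR hcR) (R.inv_mem haR)))
      rw [← hy, ← Subgroup.orderOf_mk y hyR]
      exact orderOf_dvd_natCard _
    omega
  have hΓk := (cubeCentralizer H).card_mul_index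
  have hk := eq_sixty_or_of_dvd hle (Nat.pos_of_ne_zero Subgroup.index_ne_zero_of_finite)
    hΓ2 hΓ4 hΓ3 hΓ5 (hΓk ▸ hRdvd.trans (Subgroup.card_subgroup_dvd_card R))
  have hk120 : (cubeCentralizer H).index ∣ 120 := by rcases hk with h | h <;> rw [h]; norm_num
  obtain ⟨hcount, hcomm⟩ := orderCount_five hb hy hby hyΓ hΓ5 hk120
  obtain ⟨m, hm⟩ := hΓ2
  rw [hm] at hΓ3 hΓ5 hΓ4
  have hprime : ∀ l : ℕ, l.Prime → l ∣ m → l % 2 = 1 ∧ 24 * (l - 1) ∣ Nat.card H := by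
    intro l hl hlm
    obtain ⟨m', rfl⟩ := hlm
    have h2 : l ≠ 2 := by rintro rfl; omega
    have h3 : l ≠ 3 := by rintro rfl; omega
    have h5 : l ≠ 5 := by rintro rfl; omega
    refine ⟨(hl.eq_two_or_odd).resolve_left h2, ?_⟩
    refine twentyfour_mul_dvd_card hpoc hcount hcomm hl ?_ h5 ?_
    · rw [hm]
      exact ⟨2 * m', by ring⟩
    · have c2 := (Nat.coprime_primes hl Nat.prime_two).2 h2
      have c3 := (Nat.coprime_primes hl Nat.prime_three).2 h3
      have c5 := (Nat.coprime_primes hl (by norm_num)).2 h5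
      exact Nat.Coprime.coprime_dvd_right hk120
        ((((c2.mul_right c2).mul_right c2).mul_right c3).mul_right c5)
  rw [← hΓk, hm] at hprime
  rcases hk with hk | hk
  · rw [hk] at hprime
    have hm1 : m = 1 := by
      by_contra hne
      obtain ⟨l, hl, hlm⟩ := Nat.exists_prime_and_dvd hne
      obtain ⟨hodd, t, ht⟩ := hprime l hl hlm
      obtain ⟨u, hu⟩ : ∃ u, l = 2 * u + 1 := ⟨l / 2, by omega⟩
      rw [hu, Nat.add_sub_cancel] at ht
      have h1 : 24 * (2 * u) * t = 48 * (u * t) := by ring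
      omega
    have hR120 : Nat.card H = 120 := by rw [← hΓk, hm, hk, hm1]
    have hRtop : R = ⊤ := Subgroup.eq_top_of_card_eq R
      (Nat.dvd_antisymm (Subgroup.card_subgroup_dvd_card R) (hR120 ▸ hRdvd))
    rw [eq_top_iff, ← hRtop, ← R.range_subtype, MonoidHom.range_eq_map, ← hperf,
      Subgroup.map_subtype_commutator]
    exact Subgroup.commutator_mono le_top le_top
  · exfalso
    obtain ⟨g, hga, hgb, hgc⟩ := hswap hk
    obtain ⟨s, hs⟩ := hρ.four_dvd_finrank_of_isCubeTriangle hz htri ha hb hc hy hga hgb hgc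
    have hfin : Module.finrank k V ≠ 0 := Module.finrank_pos.ne'
    refine pow_sub_one_ne_of_primeFactors (s := s) (m := m) hp (by omega) (fun l hl hlm => ?_)
      (by rw [← hs, ← hcard, ← hΓk, hm, hk]; ring)
    rw [hk] at hprime
    obtain ⟨hodd, t, ht⟩ := hprime l hl hlm
    by_contra hne
    obtain ⟨u, hu⟩ : ∃ u, l = 4 * u + 1 := ⟨l / 4, by omega⟩
    rw [hu, Nat.add_sub_cancel] at ht
    have h1 : 24 * (4 * u) * t = 96 * (u * t) := by ring
    omega

end FixedPointFreeRep

namespace IsFrobeniusWith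

variable {G : Type*} [Group G] {K H : Subgroup G}

theorem exists_conj_eq_mul [Finite G] (hF : IsFrobeniusWith K H) {h k : G} (hh : h ∈ H)
    (h1 : h ≠ 1) (hk : k ∈ K) : ∃ x ∈ K, x * h * x⁻¹ = k * h := by
  obtain ⟨-, -, hK, -, -, hfree⟩ := hF
  have hfpf : MonoidHom.FixedPointFree (MulAut.conjNormal h : MulAut K) := by
    intro x hx
    by_contra hne
    refine hfree h hh h1 x x.2 (fun h => hne (Subtype.ext h)) ?_
    rw [← MulAut.conjNormal_apply, hx]
  obtain ⟨x, hx⟩ := hfpf.commutatorMap_surjective ⟨k, hk⟩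
  refine ⟨x, x.2, ?_⟩
  have h2 : (x : G) * (h * x * h⁻¹)⁻¹ = k := by
    have := congrArg (Subtype.val : K → G) hx
    rwa [MonoidHom.commutatorMap_apply, div_eq_mul_inv, Subgroup.coe_mul, Subgroup.coe_inv,
      MulAut.conjNormal_apply] at this
  rw [← h2]
  group

theorem card_mul_card (hF : IsFrobeniusWith K H) : Nat.card K * Nat.card H = Nat.card G := by
  obtain ⟨-, -, -, hinter, hgen, -⟩ := hF
  refine (Subgroup.isComplement'_of_disjoint_and_mul_eq_univ
    (disjoint_iff.2 hinter) ?_).card_mul_card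
  refine Set.eq_univ_of_forall fun g => ?_
  obtain ⟨k, hk, h, hh, rfl⟩ := hgen g
  exact Set.mul_mem_mul hk hh

theorem ne_bot_complement (hF : IsFrobeniusWith K H) : H ≠ ⊥ := by
  rintro rfl
  refine hF.2.1 (eq_top_iff.2 fun g _ => ?_)
  obtain ⟨k, hk, h, hh, rfl⟩ := hF.2.2.2.2.1 g
  rw [Subgroup.mem_bot.1 hh, mul_one]
  exact hk

/-- The complement acts freely on the nontrivial elements of the kernel. -/
theorem card_dvd_card_subtype (hF : IsFrobeniusWith K H) {P : G → Prop} (h1 : ¬ P 1)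
    (hP : ∀ h ∈ H, ∀ x, P x → P (h * x * h⁻¹)) :
    Nat.card H ∣ Nat.card {x : G // x ∈ K ∧ P x} := by
  obtain ⟨-, -, hK, -, -, hfree⟩ := hF
  let _ : MulAction H {x : G // x ∈ K ∧ P x} :=
    { smul := fun h x => ⟨h * x * (h : G)⁻¹, hK.conj_mem _ x.2.1 _, hP h h.2 x x.2.2⟩
      one_smul := fun x => Subtype.ext (show (1 : G) * x * (1 : G)⁻¹ = x by simp)
      mul_smul := fun a b x => Subtype.ext (show (a * b : G) * x * (a * b : G)⁻¹ =
        a * (b * x * (b : G)⁻¹) * (a : G)⁻¹ by group) }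
  have hst : ∀ x : {x : G // x ∈ K ∧ P x}, MulAction.stabilizer H x = ⊥ := by
    intro x
    rw [Subgroup.eq_bot_iff_forall]
    intro h hh
    by_contra hne
    refine hfree h h.2 (fun h0 => hne (Subtype.ext h0)) x x.2.1 ?_ (congrArg Subtype.val hh)
    intro hx
    exact h1 (hx ▸ x.2.2)
  rw [Nat.card_congr (MulAction.selfEquivOrbitsQuotientProd hst), Nat.card_prod]
  exact Dvd.intro_left _ rfl

theorem coprime_card [Finite G] (hF : IsFrobeniusWith K H) :
    (Nat.card K).Coprime (Nat.card H) := by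
  have h := hF.card_dvd_card_subtype (P := fun x => x ≠ 1) (by simp)
    fun h _ x hx hc => hx (by simpa using hc)
  have h1 : Nat.card {x : G // x ∈ K ∧ x ≠ 1} + 1 = Nat.card K := by
    have h2 : Nat.card {x : G // x ∈ K ∧ x ≠ 1} = ((K : Set G) \ {1}).ncard := rfl
    rw [h2, Set.ncard_sdiff_singleton_add_one K.one_mem]
    rfl
  rw [← h1]
  obtain ⟨c, hc⟩ := h
  rw [hc]
  simp

theorem orderOf_mul [Finite G] (hF : IsFrobeniusWith K H) {h k : G} (hh : h ∈ H)
    (h1 : h ≠ 1) (hk : k ∈ K) : orderOf (k * h) = orderOf h := by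
  obtain ⟨x, -, hx⟩ := hF.exists_conj_eq_mul hh h1 hk
  rw [← hx, orderOf_conj_eq]

theorem orderCount_of_dvd_card_complement [Finite G] (hF : IsFrobeniusWith K H) {n : ℕ}
    (hn : n ≠ 1) (hdvd : n ∣ Nat.card H) :
    orderCount G n = Nat.card K * orderCount H n := by
  unfold orderCount
  rw [← Nat.card_prod]
  symm
  have hne : ∀ h : {h : H // orderOf h = n}, (h : G) ≠ 1 := by
    intro h h0
    apply hn
    rw [← h.2, orderOf_eq_one_iff]
    exact Subtype.ext h0
  refine Nat.card_congr (Equiv.ofBijective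
    (fun x => ⟨x.1 * (x.2 : G), by
      rw [hF.orderOf_mul x.2.1.2 (hne x.2) x.1.2, Subgroup.orderOf_coe, x.2.2]⟩) ⟨?_, ?_⟩)
  · rintro ⟨⟨k, hk⟩, ⟨h, hh⟩, ho⟩ ⟨⟨k', hk'⟩, ⟨h', hh'⟩, ho'⟩ he
    have he' : k * h = k' * h' := Subtype.mk.inj he
    have h2 : k'⁻¹ * k = h' * h⁻¹ := by
      rw [inv_mul_eq_iff_eq_mul, ← mul_assoc, ← he', mul_inv_cancel_right]
    have h3 : k'⁻¹ * k ∈ K ⊓ H := ⟨K.mul_mem (K.inv_mem hk') hk, h2 ▸ H.mul_mem hh' (H.inv_mem hh)⟩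
    rw [hF.2.2.2.1, Subgroup.mem_bot] at h3
    obtain rfl : k' = k := inv_mul_eq_one.1 h3
    obtain rfl : h' = h := mul_inv_eq_one.1 (h2 ▸ h3)
    rfl
  · rintro ⟨g, hg⟩
    obtain ⟨k, hk, h, hh, rfl⟩ := hF.2.2.2.2.1 g
    have h1 : h ≠ 1 := by
      rintro rfl
      rw [mul_one] at hg
      have hd : n ∣ Nat.card K := hg ▸ (Subgroup.orderOf_mk k hk ▸ orderOf_dvd_natCard _)
      exact hn (Nat.eq_one_of_dvd_coprimes hF.coprime_card hd hdvd)
    refine ⟨⟨⟨k, hk⟩, ⟨h, hh⟩, ?_⟩, rfl⟩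
    rw [Subgroup.orderOf_mk, ← hg, hF.orderOf_mul hh h1 hk]

theorem orderCount_of_dvd_card_kernel [Finite G] (hF : IsFrobeniusWith K H) {n : ℕ}
    (hn : n ≠ 1) (hdvd : n ∣ Nat.card K) : orderCount G n = orderCount K n := by
  unfold orderCount
  symm
  refine Nat.card_congr (Equiv.ofBijective
    (fun x => ⟨x.1, by rw [Subgroup.orderOf_coe, x.2]⟩) ⟨?_, ?_⟩)
  · intro x y h
    exact Subtype.ext (Subtype.ext (Subtype.mk.inj h))
  · rintro ⟨g, hg⟩
    obtain ⟨k, hk, h, hh, rfl⟩ := hF.2.2.2.2.1 g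
    have h1 : h = 1 := by
      by_contra h1
      rw [hF.orderOf_mul hh h1 hk] at hg
      have hd : n ∣ Nat.card H := hg ▸ (Subgroup.orderOf_mk h hh ▸ orderOf_dvd_natCard _)
      exact hn (Nat.eq_one_of_dvd_coprimes hF.coprime_card hdvd hd)
    subst h1
    rw [mul_one] at hg
    exact ⟨⟨⟨k, hk⟩, by rw [Subgroup.orderOf_mk, hg]⟩, Subtype.ext (by simp)⟩

theorem card_dvd_orderCount (hF : IsFrobeniusWith K H) {n : ℕ} (hn : n ≠ 1) :
    Nat.card H ∣ orderCount K n := by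
  have h := hF.card_dvd_card_subtype (P := fun x => orderOf x = n)
    (by rw [orderOf_one]; exact hn.symm) fun h _ x hx => by rw [orderOf_conj_eq, hx]
  refine h.trans (dvd_of_eq ?_)
  refine Nat.card_congr
    ⟨fun x => ⟨⟨x.1, x.2.1⟩, by rw [Subgroup.orderOf_mk]; exact x.2.2⟩,
      fun x => ⟨x.1, x.1.2, by rw [Subgroup.orderOf_coe, x.2]⟩, fun _ => rfl, fun _ => rfl⟩

theorem perfectOrderClasses_complement [Finite G] (hF : IsFrobeniusWith K H)
    (hpoc : PerfectOrderClasses G) : PerfectOrderClasses H := by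
  intro n hn
  by_cases h1 : n = 1
  · subst h1
    right
    have : Nat.card {h : H // orderOf h = 1} = 1 := by simp [orderOf_eq_one_iff]
    rw [orderCount, this]
    exact one_dvd _
  · by_cases hd : n ∣ Nat.card H
    · have h := hpoc n hn
      rw [hF.orderCount_of_dvd_card_complement h1 hd, ← hF.card_mul_card] at h
      have hpos : 0 < Nat.card K := Nat.card_pos
      rcases h with h | h
      · exact Or.inl ((Nat.mul_eq_zero.1 h).resolve_left hpos.ne')
      · exact Or.inr (Nat.dvd_of_mul_dvd_mul_left hpos h)
    · left
      have : IsEmpty {h : H // orderOf h = n} := ⟨fun h => hd (h.2 ▸ orderOf_dvd_natCard _)⟩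
      exact Nat.card_of_isEmpty

theorem not_isSolvable_complement (hF : IsFrobeniusWith K H) (hK : ∀ x y : K, Commute x y)
    (hG : ¬ Group.IsSolvable G) : ¬ Group.IsSolvable H := by
  intro hH
  have := hF.2.2.1
  refine hG ((Group.isSolvable_iff_subgroup_quotient K).2
    ⟨Group.isSolvable_of_comm fun a b => hK a b, ?_⟩)
  refine Group.isSolvable_of_surjective (f := (QuotientGroup.mk' K).comp H.subtype) fun q => ?_
  obtain ⟨g, rfl⟩ := QuotientGroup.mk'_surjective K q
  obtain ⟨k, hk, h, hh, rfl⟩ := hF.2.2.2.2.1 g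
  refine ⟨⟨h, hh⟩, ?_⟩
  rw [map_mul, QuotientGroup.mk'_apply K k, (QuotientGroup.eq_one_iff k).2 hk, one_mul]
  rfl

end IsFrobeniusWith

theorem orderCount_ne_zero {G : Type*} [Group G] [Finite G] {x : G} {n : ℕ} (h : orderOf x = n) :
    orderCount G n ≠ 0 :=
  have : Nonempty {g : G // orderOf g = n} := ⟨⟨x, h⟩⟩
  Nat.card_pos.ne'

theorem PerfectOrderClasses.two_dvd_card {G : Type*} [Group G] [Finite G] [Nontrivial G]
    (h : PerfectOrderClasses G) : 2 ∣ Nat.card G := by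
  obtain ⟨q, hq, hqd⟩ := Nat.exists_prime_and_dvd (Finite.one_lt_card (α := G)).ne'
  have : Fact q.Prime := ⟨hq⟩
  obtain ⟨x, hx⟩ := exists_prime_orderOf_dvd_card' q hqd
  have hd := (h q hq.pos).resolve_left (orderCount_ne_zero hx)
  rcases hq.eq_two_or_odd with rfl | hodd
  · exact hqd
  · rw [orderCount_prime hq] at hd
    exact (show 2 ∣ q - 1 by omega).trans ((Dvd.intro_left _ rfl).trans hd)

open scoped TensorProduct

/-- A fixed-point-free action on an elementary abelian group yields a fixed-point-free
representation over an algebraically closed field. -/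
theorem FixedPointFreeRep.baseChange {F W H : Type*} (k : Type*) [Field F] [Field k] [Algebra F k]
    [AddCommGroup W] [Module F W] [FiniteDimensional F W] [Group H] {φ : H →* Module.End F W}
    (hφ : FixedPointFreeRep φ) :
    FixedPointFreeRep (((Module.End.baseChangeHom F k W : _ →ₐ[F] _) :
      Module.End F W →* Module.End k (k ⊗[F] W)).comp φ) := by
  intro h hh v hv
  obtain ⟨u, hu⟩ := LinearMap.exists_leftInverse_of_injective (φ h - 1) (by
    rw [LinearMap.ker_eq_bot']
    intro w hw
    exact hφ h hh w (sub_eq_zero.1 hw))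
  have hu' : u * φ h = 1 + u := by
    have h1 : u * (φ h - 1) = 1 := hu
    rw [← h1, mul_sub, mul_one, sub_add_cancel]
  have h2 := LinearMap.congr_fun (congrArg (Module.End.baseChangeHom F k W) hu') v
  rw [map_mul, map_add, map_one, Module.End.mul_apply, LinearMap.add_apply,
    Module.End.one_apply] at h2
  have h3 : (Module.End.baseChangeHom F k W (φ h)) v = v := hv
  rw [h3] at h2
  exact left_eq_add.1 (h2.trans (add_comm _ _))

theorem commutator_eq_top_of_fixedPointFree {W H : Type*} [AddCommGroup W] [Finite W] [Nontrivial W]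
    [Group H] [Finite H] {p : ℕ} [Fact p.Prime] [Module (ZMod p) W]
    (φ : H →* AddMonoid.End W) (hφ : ∀ h : H, h ≠ 1 → ∀ w, φ h w = w → w = 0)
    (hH : ¬ Group.IsSolvable H) (hpoc : PerfectOrderClasses H)
    (hcard : Nat.card H = Nat.card W - 1) : commutator H = ⊤ := by
  let ψ : H →* Module.End (ZMod p) W :=
    { toFun := fun h => (φ h).toZModLinearMap p
      map_one' := by
        ext w
        change φ 1 w = w
        rw [map_one]
        rfl
      map_mul' := fun a b => by
        ext w
        change φ (a * b) w = φ a (φ b w)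
        rw [map_mul]
        rfl }
  have : FiniteDimensional (ZMod p) W := Module.Finite.of_finite
  have hψ : FixedPointFreeRep ψ := hφ
  refine (hψ.baseChange (AlgebraicClosure (ZMod p))).commutator_eq_top hH hpoc
    (Fact.out : p.Prime) ?_
  rw [hcard, Module.finrank_baseChange, Module.natCard_eq_pow_finrank (K := ZMod p), Nat.card_zmod]

namespace IsFrobeniusWith

variable {G : Type*} [Group G] [Finite G] {K H : Subgroup G}

theorem commute_of_mem_kernel (hF : IsFrobeniusWith K H) (h2 : 2 ∣ Nat.card H) (x y : K) :
    Commute x y := by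
  have : Fact (Nat.Prime 2) := ⟨Nat.prime_two⟩
  obtain ⟨z, hz⟩ := exists_prime_orderOf_dvd_card' 2 h2
  have hz1 : (z : G) ≠ 1 := fun h => by
    rw [← Subgroup.orderOf_coe, h, orderOf_one] at hz
    norm_num at hz
  obtain ⟨-, -, hK, -, -, hfree⟩ := hF
  have hfpf : MonoidHom.FixedPointFree (MulAut.conjNormal (z : G) : MulAut K) := by
    intro x hx
    by_contra hne
    refine hfree z z.2 hz1 x x.2 (fun h => hne (Subtype.ext h)) ?_
    rw [← MulAut.conjNormal_apply, hx]
  refine hfpf.commute_all_of_involutive (fun x => ?_) x y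
  have hzz : (z : G) * z = 1 := by
    have := pow_orderOf_eq_one z
    rw [hz, pow_two] at this
    exact congrArg Subtype.val this
  rw [← MulAut.mul_apply, ← map_mul, hzz, map_one, MulAut.one_apply]

theorem eq_of_prime_dvd_card_kernel (hF : IsFrobeniusWith K H) (hpoc : PerfectOrderClasses G)
    (hK : ∀ x y : K, Commute x y) {p q : ℕ} (hp : p.Prime) (hq : q.Prime)
    (hpK : p ∣ Nat.card K) (hqK : q ∣ Nat.card K) : p = q := by
  by_contra hne
  have : Fact p.Prime := ⟨hp⟩
  have : Fact q.Prime := ⟨hq⟩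
  have hpq := (Nat.coprime_primes hp hq).2 hne
  have hmul : orderCount K (p * q) = orderCount K p * orderCount K q :=
    orderCount_mul hp.pos hq.pos hpq fun x y _ _ => hK x y
  have hpq1 : p * q ≠ 1 := fun h => hp.one_lt.ne' (mul_eq_one.1 h).1
  obtain ⟨x, hx⟩ := exists_prime_orderOf_dvd_card' p hpK
  obtain ⟨y, hy⟩ := exists_prime_orderOf_dvd_card' q hqK
  have hd := hpoc (p * q) (Nat.mul_pos hp.pos hq.pos)
  rw [hF.orderCount_of_dvd_card_kernel hpq1 (hpq.mul_dvd_of_dvd_of_dvd hpK hqK), hmul,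
    ← hF.card_mul_card] at hd
  have hd' := hd.resolve_left (mul_ne_zero (orderCount_ne_zero hx) (orderCount_ne_zero hy))
  have hHH := (mul_dvd_mul (hF.card_dvd_orderCount hp.one_lt.ne')
    (hF.card_dvd_orderCount hq.one_lt.ne')).trans hd'
  have hHK := Nat.dvd_of_mul_dvd_mul_right Nat.card_pos hHH
  exact hF.ne_bot_complement ((Subgroup.card_eq_one).1
    (Nat.eq_one_of_dvd_coprimes hF.coprime_card hHK dvd_rfl))

theorem card_complement (hF : IsFrobeniusWith K H) (hpoc : PerfectOrderClasses G)
    (hK : ∀ x y : K, Commute x y) {p : ℕ} (hp : p.Prime) (hpK : p ∣ Nat.card K)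
    {W : Subgroup K} (hW : ∀ x : K, x ∈ W ↔ x ^ p = 1) : Nat.card H = Nat.card W - 1 := by
  have : Fact p.Prime := ⟨hp⟩
  obtain ⟨x, hx⟩ := exists_prime_orderOf_dvd_card' p hpK
  have hcount : orderCount K p = Nat.card W - 1 := by
    have h1 : Nat.card {x : K // orderOf x = p} = ((W : Set K) \ {1}).ncard := by
      rw [← Nat.card_coe_set_eq]
      refine Nat.card_congr (Equiv.subtypeEquivRight fun x => ?_)
      rw [orderOf_eq_prime_iff, Set.mem_sdiff, SetLike.mem_coe, hW, Set.mem_singleton_iff]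
    rw [orderCount, h1, Set.ncard_sdiff_singleton_of_mem W.one_mem]
    rfl
  have hd := (hpoc p hp.pos).resolve_left (by
    rw [hF.orderCount_of_dvd_card_kernel hp.one_lt.ne' hpK]
    exact orderCount_ne_zero hx)
  rw [hF.orderCount_of_dvd_card_kernel hp.one_lt.ne' hpK, ← hF.card_mul_card] at hd
  rw [← hcount]
  refine Nat.dvd_antisymm (hF.card_dvd_orderCount hp.one_lt.ne') ?_
  refine Nat.Coprime.dvd_of_dvd_mul_left ?_ hd
  refine Nat.coprime_of_dvd fun q hq hq1 hq2 => ?_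
  obtain rfl := hF.eq_of_prime_dvd_card_kernel hpoc hK hp hq hpK hq2
  have hpW : p ∣ Nat.card W := by
    have hxW : x ∈ W := (hW x).2 (hx ▸ pow_orderOf_eq_one x)
    rw [← hx, ← Subgroup.orderOf_mk x hxW]
    exact orderOf_dvd_natCard _
  rw [hcount] at hq1
  have h1 : 1 ≤ Nat.card W := Nat.card_pos
  have := (Nat.dvd_sub_iff_right h1 hpW).1 hq1
  exact hp.one_lt.ne' (Nat.dvd_one.1 this)

theorem commutator_complement_eq_top (hF : IsFrobeniusWith K H) (hG : ¬ Group.IsSolvable G)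
    (hpoc : PerfectOrderClasses G) : commutator H = ⊤ := by
  have hpocH := hF.perfectOrderClasses_complement hpoc
  have : Nontrivial H := (Subgroup.nontrivial_iff_ne_bot H).2 hF.ne_bot_complement
  have hcomm := hF.commute_of_mem_kernel hpocH.two_dvd_card
  have hKn := hF.2.2.1
  obtain ⟨p, hp, hpK⟩ := Nat.exists_prime_and_dvd
    (fun h => hF.1 (Subgroup.card_eq_one.1 h) : Nat.card K ≠ 1)
  have : Fact p.Prime := ⟨hp⟩
  let _ : CommGroup K := { (inferInstance : Group K) with mul_comm := fun a b => hcomm a b }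
  let W : Subgroup K := (powMonoidHom p : K →* K).ker
  have hW : ∀ x : K, x ∈ W ↔ x ^ p = 1 := fun x => Iff.rfl
  have : Nontrivial W := by
    obtain ⟨x, hx⟩ := exists_prime_orderOf_dvd_card' p hpK
    refine ⟨⟨x, (hW x).2 (hx ▸ pow_orderOf_eq_one x)⟩, 1, fun h => ?_⟩
    have hx1 : x = 1 := Subtype.mk.inj h
    rw [hx1, orderOf_one] at hx
    exact hp.one_lt.ne hx
  have hmem : ∀ (h : H) (w : W), MulAut.conjNormal (h : G) (w : K) ∈ W := by
    intro h w
    rw [hW, ← map_pow, (hW w).1 w.2, map_one]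
  let φ : H →* AddMonoid.End (Additive W) :=
    { toFun := fun h =>
        { toFun := fun w => Additive.ofMul ⟨MulAut.conjNormal (h : G) (w.toMul : K), hmem h w.toMul⟩
          map_zero' := by
            refine congrArg Additive.ofMul (Subtype.ext ?_)
            exact map_one _
          map_add' := fun a b => by
            refine congrArg Additive.ofMul (Subtype.ext ?_)
            exact map_mul _ _ _ }
      map_one' := by
        refine AddMonoidHom.ext fun w => ?_
        refine congrArg Additive.ofMul (Subtype.ext ?_)
        change MulAut.conjNormal (1 : G) (w.toMul : K) = w.toMul
        rw [map_one, MulAut.one_apply]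
      map_mul' := fun a b => by
        refine AddMonoidHom.ext fun w => ?_
        refine congrArg Additive.ofMul (Subtype.ext ?_)
        change MulAut.conjNormal (a * b : G) (w.toMul : K) = _
        rw [map_mul, MulAut.mul_apply]
        rfl }
  let _ : Module (ZMod p) (Additive W) := AddCommGroup.zmodModule fun w =>
    congrArg Additive.ofMul (Subtype.ext ((hW (w.toMul : K)).1 w.toMul.2))
  refine commutator_eq_top_of_fixedPointFree (W := Additive W) (p := p) φ ?_
    (hF.not_isSolvable_complement hcomm hG) hpocH (hF.card_complement hpoc hcomm hp hpK hW)
  · intro h hh w hw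
    have hw' : MulAut.conjNormal (h : G) (w.toMul : K) = (w.toMul : K) :=
      congrArg Subtype.val (congrArg Additive.toMul hw)
    by_contra hne
    refine hF.2.2.2.2.2 h h.2 (fun h1 => hh (Subtype.ext h1)) (w.toMul : K) (w.toMul : K).2 ?_ ?_
    · intro h1
      exact hne (congrArg Additive.ofMul (Subtype.ext (Subtype.ext h1)))
    · rw [← MulAut.conjNormal_apply, hw']

theorem commutator_eq_top_of_complement (hF : IsFrobeniusWith K H) (hH : commutator H = ⊤) :
    commutator G = ⊤ := by
  have hHG : H ≤ commutator G := by
    rw [← H.range_subtype, MonoidHom.range_eq_map, ← hH, Subgroup.map_subtype_commutator]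
    exact Subgroup.commutator_mono le_top le_top
  obtain ⟨h, hh, h1⟩ := H.bot_or_exists_ne_one.resolve_left hF.ne_bot_complement
  rw [eq_top_iff]
  intro g _
  obtain ⟨k, hk, t, ht, rfl⟩ := hF.2.2.2.2.1 g
  refine Subgroup.mul_mem _ ?_ (hHG ht)
  obtain ⟨x, -, hx⟩ := hF.exists_conj_eq_mul hh h1 hk
  rw [← mul_inv_eq_iff_eq_mul.2 hx]
  exact Subgroup.commutator_mem_commutator (Subgroup.mem_top x) (Subgroup.mem_top h)

end IsFrobeniusWith

/-- An insoluble finite Frobenius group with perfect order classes is perfect. -/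
theorem insoluble_frobenius_perfectOrderClasses_isPerfect
    {G : Type*} [Group G] [Fintype G] (K H : Subgroup G)
    (hFrob : IsFrobeniusWith K H) (hinsol : ¬ IsSolvable G)
    (hpoc : PerfectOrderClasses G) :
    commutator G = ⊤ :=
  hFrob.commutator_eq_top_of_complement (hFrob.commutator_complement_eq_top hinsol hpoc)
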